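/- For any convex bodies $A, B, C, K_1,\dots,K_{n-2}$ in $\mathbb{R}^n$ ($n \geq 2$): $V(A[2],K_1,\dots,K_{n-2})\,V(B,C,K_1,\dots,K_{n-2}) \leq 2\, V(A,B,K_1,\dots,K_{n-2})\, V(A,C,K_1,\dots,K_{n-2})$. -/

import Mathlib

open scoped Pointwise
open MeasureTheory

/-- A convex body in `ℝⁿ`: a compact convex set with nonempty interior. -/
def IsConvexBody {n : ℕ} (K : Set (EuclideanSpace ℝ (Fin n))) : Prop :=
  Convex ℝ K ∧ IsCompact K ∧ (interior K).Nonempty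

/-- The mixed volume of `n` convex bodies in `ℝⁿ`, via the
inclusion-exclusion (polarization) formula for Minkowski sums. -/
noncomputable def mixedVolume {n : ℕ} (K : Fin n → Set (EuclideanSpace ℝ (Fin n))) : ℝ :=
  ((n.factorial : ℝ))⁻¹ *
    ∑ S : Finset (Fin n), (-1 : ℝ) ^ (n + S.card) * (volume (∑ i ∈ S, K i)).toReal



namespace Fenchel
open Finset

lemma quad_identity {ι : Type*} [Fintype ι] (M : ι → ι → ℝ) (hs : ∀ i j, M i j = M j i)
    (φ z : ι → ℝ) :
    ∑ i, (z i) ^ 2 * φ i * ∑ j, M i j * φ j - ∑ i, ∑ j, M i j * (φ i * z i) * (φ j * z j)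
      = (1 / 2) * ∑ i, ∑ j, M i j * φ i * φ j * (z i - z j) ^ 2 := by
  have h1 : ∑ i, (z i) ^ 2 * φ i * ∑ j, M i j * φ j = ∑ i, ∑ j, M i j * φ i * φ j * z i ^ 2 := by
    refine sum_congr rfl fun i _ => ?_
    rw [mul_sum]
    exact sum_congr rfl fun j _ => by ring
  have h2 : ∑ i, ∑ j, M i j * φ i * φ j * z i ^ 2 = ∑ i, ∑ j, M i j * φ i * φ j * z j ^ 2 := by
    rw [sum_comm]
    refine sum_congr rfl fun i _ => sum_congr rfl fun j _ => ?_
    rw [hs i j]; ring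
  have h3 : ∑ i, ∑ j, M i j * φ i * φ j * (z i - z j) ^ 2
      = ∑ i, ∑ j, M i j * φ i * φ j * z i ^ 2 + ∑ i, ∑ j, M i j * φ i * φ j * z j ^ 2
        - 2 * ∑ i, ∑ j, M i j * (φ i * z i) * (φ j * z j) := by
    simp only [mul_sum, ← sum_add_distrib, ← sum_sub_distrib]
    exact sum_congr rfl fun i _ => sum_congr rfl fun j _ => by ring
  rw [h3, h1, ← h2]; ring

lemma nsd_of_super {ι : Type*} [Fintype ι] (M : ι → ι → ℝ) (hs : ∀ i j, M i j = M j i)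
    (ho : ∀ i j, i ≠ j → 0 ≤ M i j) (φ w : ι → ℝ) (hφ : ∀ i, 0 < φ i)
    (h : ∀ i, ∑ j, M i j * φ j ≤ w i * φ i) (y : ι → ℝ) :
    ∑ i, ∑ j, M i j * y i * y j ≤ ∑ i, w i * y i ^ 2 := by
  have hy : ∀ i, φ i * (y i / φ i) = y i := fun i => by
    have := (hφ i).ne'; field_simp
  have key := quad_identity M hs φ (fun i => y i / φ i)
  simp only [hy] at key
  have h1 : 0 ≤ ∑ i, ∑ j, M i j * φ i * φ j * (y i / φ i - y j / φ j) ^ 2 := by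
    refine sum_nonneg fun i _ => sum_nonneg fun j _ => ?_
    by_cases hij : i = j
    · subst hij; simp
    · have := ho i j hij; have := hφ i; have := hφ j; positivity
  have h2 : ∑ i, (y i / φ i) ^ 2 * φ i * ∑ j, M i j * φ j ≤ ∑ i, w i * y i ^ 2 := by
    refine sum_le_sum fun i _ => ?_
    have := hφ i
    calc (y i / φ i) ^ 2 * φ i * ∑ j, M i j * φ j ≤ (y i / φ i) ^ 2 * φ i * (w i * φ i) := by
          gcongr; exact h i
      _ = w i * y i ^ 2 := by field_simp
  linarith

/-- Quadratic polynomial that is nonpositive and vanishes at `0` has zero linear term. -/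
lemma lin_zero_of_quad {b c : ℝ} (h : ∀ t : ℝ, b * t + c * t ^ 2 ≤ 0) : b = 0 := by
  by_contra hb
  have h1 := h (b / (1 + |c|))
  have hc : 0 < 1 + |c| := by positivity
  have h2 : b * (b / (1 + |c|)) + c * (b / (1 + |c|)) ^ 2
      = b ^ 2 / (1 + |c|) ^ 2 * (1 + |c| + c) := by field_simp
  rw [h2] at h1
  have h3 : 0 < b ^ 2 / (1 + |c|) ^ 2 := by positivity
  have h4 : 0 < 1 + |c| + c := by linarith [neg_abs_le c]
  have := mul_pos h3 h4
  linarith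

lemma perron_bochner {ι : Type*} [Fintype ι] (M : ι → ι → ℝ) (hs : ∀ i j, M i j = M j i)
    (ho : ∀ i j, i ≠ j → 0 ≤ M i j) (k p : ι → ℝ) (hk : ∀ i, 0 < k i) (hp : ∀ i, 0 < p i)
    (hMk : ∀ i, ∑ j, M i j * k j = p i)
    (hB : ∀ x : ι → ℝ, ∑ i, ∑ j, M i j * x i * x j ≤ ∑ i, k i * (∑ j, M i j * x j) ^ 2 / p i)
    (hconn : ∀ z : ι → ℝ, (∀ i j, i ≠ j → M i j ≠ 0 → z i = z j) → ∀ i j, z i = z j)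
    (x : ι → ℝ) (hx : ∑ i, x i * p i = 0) : ∑ i, ∑ j, M i j * x i * x j ≤ 0 := by
  classical
  by_contra hpos
  push Not at hpos
  set w : ι → ℝ := fun i => p i / k i with hw
  have hwpos : ∀ i, 0 < w i := fun i => div_pos (hp i) (hk i)
  let q : (ι → ℝ) → ℝ := fun y => ∑ i, ∑ j, M i j * y i * y j
  let nn : (ι → ℝ) → ℝ := fun y => ∑ i, w i * y i ^ 2
  let S : Set (ι → ℝ) := {y | nn y = 1 ∧ ∑ i, y i * p i = 0}
  have hnnpos : ∀ y, y ≠ 0 → 0 < nn y := by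
    intro y hy
    obtain ⟨i, hi⟩ := Function.ne_iff.mp hy
    have hi : y i ≠ 0 := hi
    refine sum_pos' (fun i _ => mul_nonneg (hwpos i).le (sq_nonneg _)) ⟨i, mem_univ _, ?_⟩
    have := hwpos i; positivity
  have hScl : IsClosed S := by
    apply IsClosed.inter
    · exact isClosed_eq (by fun_prop) continuous_const
    · exact isClosed_eq (by fun_prop) continuous_const
  have hScomp : IsCompact S := by
    refine IsCompact.of_isClosed_subset
      (isCompact_univ_pi (fun i : ι => isCompact_Icc (a := -(Real.sqrt (1 / w i))) (b := Real.sqrt (1 / w i)))) hScl ?_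
    intro y hy i _
    have h1 : w i * y i ^ 2 ≤ 1 := by
      rw [← hy.1]
      exact single_le_sum (f := fun i => w i * y i ^ 2)
        (fun i _ => mul_nonneg (hwpos i).le (sq_nonneg _)) (mem_univ i)
    have h2 : y i ^ 2 ≤ 1 / w i := by
      rw [le_div_iff₀ (hwpos i)]; linarith
    exact abs_le.mp (Real.abs_le_sqrt h2)
  have hx0 : x ≠ 0 := by
    rintro rfl; simp at hpos
  have hqs : ∀ (c : ℝ) y, q (fun i => c * y i) = c ^ 2 * q y := by
    intro c y
    simp only [q, mul_sum]
    exact sum_congr rfl fun i _ => sum_congr rfl fun j _ => by ring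
  have hns : ∀ (c : ℝ) y, nn (fun i => c * y i) = c ^ 2 * nn y := by
    intro c y
    simp only [nn, mul_sum]
    exact sum_congr rfl fun i _ => by ring
  have hnorm : ∀ y, y ≠ 0 → ∑ i, y i * p i = 0 → (fun i => (Real.sqrt (nn y))⁻¹ * y i) ∈ S := by
    intro y hy hy0
    constructor
    · rw [hns, inv_pow, Real.sq_sqrt (hnnpos y hy).le]
      exact inv_mul_cancel₀ (hnnpos y hy).ne'
    · simp only [mul_assoc, ← mul_sum, hy0, mul_zero]
  obtain ⟨m, hmS, hmax⟩ := hScomp.exists_isMaxOn (f := q) ⟨_, hnorm x hx0 hx⟩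
    (by apply Continuous.continuousOn; fun_prop)
  set μ := q m with hμ
  have hle : ∀ y, ∑ i, y i * p i = 0 → q y ≤ μ * nn y := by
    intro y hy0
    by_cases hy : y = 0
    · subst hy; simp [q, nn]
    have := hmax (hnorm y hy hy0)
    simp only [Set.mem_ofPred_eq] at this
    rw [hqs, inv_pow, Real.sq_sqrt (hnnpos y hy).le] at this
    rwa [inv_mul_le_iff₀ (hnnpos y hy), mul_comm] at this
  have hμpos : 0 < μ := by
    have h1 := hle x hx
    have h2 : 0 < q x := hpos
    by_contra hcon
    push Not at hcon
    nlinarith [hnnpos x hx0]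
  -- eigenvector equation tested against `y`
  have hcross : ∀ y : ι → ℝ, ∑ i, y i * p i = 0 →
      ∑ i, y i * ((∑ j, M i j * m j) - μ * w i * m i) = 0 := by
    intro y hy0
    have key : ∀ t : ℝ, (2 * ∑ i, y i * ((∑ j, M i j * m j) - μ * w i * m i)) * t
        + (q y - μ * nn y) * t ^ 2 ≤ 0 := by
      intro t
      have h1 := hle (fun i => m i + t * y i) (by
        simp only [add_mul, sum_add_distrib, hmS.2, mul_assoc, ← mul_sum, hy0]; simp)
      have h2 : q (fun i => m i + t * y i) = q m + 2 * t * (∑ i, y i * (∑ j, M i j * m j))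
          + t ^ 2 * q y := by
        have e1 : ∑ i, ∑ j, M i j * m i * y j = ∑ i, ∑ j, M i j * y i * m j := by
          rw [sum_comm]
          exact sum_congr rfl fun i _ => sum_congr rfl fun j _ => by rw [hs i j]; ring
        have e2 : ∑ i, y i * (∑ j, M i j * m j) = ∑ i, ∑ j, M i j * y i * m j := by
          refine sum_congr rfl fun i _ => ?_
          rw [mul_sum]; exact sum_congr rfl fun j _ => by ring
        have e3 : q (fun i => m i + t * y i) = q m + t * (∑ i, ∑ j, M i j * m i * y j)
            + t * (∑ i, ∑ j, M i j * y i * m j) + t ^ 2 * q y := by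
          simp only [q, mul_sum, ← sum_add_distrib]
          exact sum_congr rfl fun i _ => sum_congr rfl fun j _ => by ring
        rw [e3, e1, e2]; ring
      have h3 : nn (fun i => m i + t * y i) = 1 + 2 * t * (∑ i, y i * (w i * m i))
          + t ^ 2 * nn y := by
        rw [← hmS.1]
        simp only [nn, mul_sum, ← sum_add_distrib]
        exact sum_congr rfl fun i _ => by ring
      rw [h2, h3] at h1
      have h4 : ∑ i, y i * ((∑ j, M i j * m j) - μ * w i * m i)
          = ∑ i, y i * (∑ j, M i j * m j) - μ * ∑ i, y i * (w i * m i) := by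
        rw [mul_sum, ← sum_sub_distrib]
        exact sum_congr rfl fun i _ => by ring
      rw [h4]; nlinarith
    have := lin_zero_of_quad key
    linarith
  set r : ι → ℝ := fun i => (∑ j, M i j * m j) - μ * w i * m i with hr
  have hkr : ∑ i, k i * r i = 0 := by
    have e1 : ∑ i, k i * (∑ j, M i j * m j) = ∑ j, m j * p j := by
      simp only [mul_sum]
      rw [sum_comm]
      refine sum_congr rfl fun j _ => ?_
      rw [← hMk j, mul_sum]
      exact sum_congr rfl fun i _ => by rw [hs i j]; ring
    have e2 : ∑ i, k i * (μ * w i * m i) = μ * ∑ j, m j * p j := by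
      rw [mul_sum]
      refine sum_congr rfl fun j _ => ?_
      have := (hk j).ne'
      simp only [hw]; field_simp
    simp only [hr, mul_sub, sum_sub_distrib]
    rw [e1, e2, hmS.2]; simp
  have hkp : 0 < ∑ i, k i * p i := by
    have : ∃ i : ι, x i ≠ 0 := Function.ne_iff.mp hx0
    obtain ⟨i, -⟩ := this
    exact sum_pos (fun i _ => mul_pos (hk i) (hp i)) ⟨i, mem_univ _⟩
  -- r is zero
  have hr0 : ∀ i, r i = 0 := by
    -- test with y = r - c k ... in the weighted sense
    have hall : ∀ y : ι → ℝ, ∑ i, y i * r i = 0 := by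
      intro y
      set c := (∑ i, y i * p i) / ∑ i, k i * p i with hc
      have h1 := hcross (fun i => y i - c * k i) (by
        simp only [sub_mul, sum_sub_distrib, mul_assoc, ← mul_sum, hc]
        field_simp; ring)
      have h2 : ∑ i, (y i - c * k i) * r i = ∑ i, y i * r i - c * ∑ i, k i * r i := by
        rw [mul_sum, ← sum_sub_distrib]
        exact sum_congr rfl fun i _ => by ring
      have h1' : ∑ i, (y i - c * k i) * r i = 0 := h1
      rw [h2, hkr] at h1'
      linarith
    intro i
    have := hall (Pi.single i 1)
    simpa [Pi.single_apply] using this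
  have heig : ∀ i, ∑ j, M i j * m j = μ * w i * m i := fun i => by
    have := hr0 i; simp only [hr] at this; linarith
  have hμ1 : 1 ≤ μ := by
    have h1 := hB m
    have h2 : ∑ i, k i * (∑ j, M i j * m j) ^ 2 / p i = μ ^ 2 * nn m := by
      simp only [nn, mul_sum]
      refine sum_congr rfl fun i _ => ?_
      rw [heig i]
      have := (hk i).ne'; have := (hp i).ne'
      simp only [hw]; field_simp
    rw [h2, hmS.1] at h1
    have h3 : μ ≤ μ ^ 2 * 1 := h1
    nlinarith
  -- Perron identity
  have hid := quad_identity M hs k (fun i => m i / k i)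
  have hy : ∀ i, k i * (m i / k i) = m i := fun i => by have := (hk i).ne'; field_simp
  simp only [hy, hMk] at hid
  have e1 : ∑ i, (m i / k i) ^ 2 * k i * p i = 1 := by
    rw [← hmS.1]
    refine sum_congr rfl fun i _ => ?_
    have := (hk i).ne'
    simp only [hw]; field_simp
  rw [e1] at hid
  have hterm : ∀ i j, 0 ≤ M i j * k i * k j * (m i / k i - m j / k j) ^ 2 := by
    intro i j
    by_cases hij : i = j
    · subst hij; simp
    · have := ho i j hij; have := hk i; have := hk j; positivity
  have hsum0 : ∑ i, ∑ j, M i j * k i * k j * (m i / k i - m j / k j) ^ 2 = 0 := by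
    refine le_antisymm ?_ (sum_nonneg fun i _ => sum_nonneg fun j _ => hterm i j)
    have : 1 - μ = 1 / 2 * ∑ i, ∑ j, M i j * k i * k j * (m i / k i - m j / k j) ^ 2 := hid
    linarith
  have hz : ∀ i j, M i j * k i * k j * (m i / k i - m j / k j) ^ 2 = 0 := by
    intro i j
    have h1 := (sum_eq_zero_iff_of_nonneg (fun i _ => sum_nonneg fun j _ => hterm i j)).mp hsum0 i (mem_univ _)
    exact (sum_eq_zero_iff_of_nonneg (fun j _ => hterm i j)).mp h1 j (mem_univ _)
  have hconst := hconn (fun i => m i / k i) (by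
    intro i j _ hM
    have := hz i j
    have hki := (hk i).ne'; have hkj := (hk j).ne'
    have h2 : (m i / k i - m j / k j) ^ 2 = 0 := by
      simpa [hM, hki, hkj] using this
    have := pow_eq_zero_iff (two_ne_zero) |>.mp h2
    linarith)
  obtain ⟨i0, -⟩ := Function.ne_iff.mp hx0
  have hm : ∀ i, m i = (m i0 / k i0) * k i := fun i => by
    have := hconst i i0
    rw [← this]; have := (hk i).ne'; field_simp
  have h0 := hmS.2
  have h1 : ∑ i, m i * p i = (m i0 / k i0) * ∑ i, k i * p i := by
    rw [mul_sum]; exact sum_congr rfl fun i _ => by rw [hm i]; ring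
  rw [h1] at h0
  have hc0 : m i0 / k i0 = 0 := by
    rcases mul_eq_zero.mp h0 with h | h
    · exact h
    · exact absurd h hkp.ne'
  have hm0 : m = 0 := by
    funext i; rw [hm i, hc0]; simp
  have := hmS.1
  rw [hm0] at this
  simp [nn] at this

end Fenchel


namespace Fenchel
open Finset

/-- Combinatorial data of a simple polytope with facet normals `u`. -/
structure Fan (V : Type) [Fintype V] [DecidableEq V] (E : Type) [NormedAddCommGroup E]
    [InnerProductSpace ℝ E] (n : ℕ) where
  u : V → E
  facets : Finset (Finset V)
  card_eq : ∀ I ∈ facets, I.card = n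
  vtx : Finset V → (V → ℝ) →ₗ[ℝ] E
  vtx_eq : ∀ I ∈ facets, ∀ i ∈ I, ∀ h, inner ℝ (u i) (vtx I h) = h i
  span : ∀ I ∈ facets, ∀ w : E, ∃ c : V → ℝ, w = ∑ i ∈ I, c i • u i
  adj : ∀ I ∈ facets, ∀ i ∈ I, ∃ i', i' ∉ I ∧ insert i' (I.erase i) ∈ facets
  nonempty : facets.Nonempty

variable {V : Type} [Fintype V] [DecidableEq V] {E : Type} [NormedAddCommGroup E]
    [InnerProductSpace ℝ E] {n : ℕ}

/-- Support vectors strictly of the given combinatorial type. -/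
def Fan.T0 (f : Fan V E n) (h : V → ℝ) : Prop :=
  ∀ I ∈ f.facets, ∀ j, j ∉ I → inner ℝ (f.u j) (f.vtx I h) < h j

/-- Linear support vectors. -/
def Fan.ell (f : Fan V E n) (x : E) : V → ℝ := fun i => inner ℝ (f.u i) x

def Fan.IsFace (f : Fan V E n) (S : Finset V) : Prop := ∃ I ∈ f.facets, S ⊆ I

open Classical in
noncomputable def Fan.lk (f : Fan V E n) (S : Finset V) : Finset V :=
  univ.filter fun j => j ∉ S ∧ f.IsFace (insert j S)

lemma Fan.mem_lk {f : Fan V E n} {S : Finset V} {j : V} :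
    j ∈ f.lk S ↔ j ∉ S ∧ f.IsFace (insert j S) := by
  simp [Fan.lk]

lemma Fan.mem_lk_of {f : Fan V E n} {S I : Finset V} {j : V} (hI : I ∈ f.facets) (hS : S ⊆ I)
    (hj : j ∈ I) (hjS : j ∉ S) : j ∈ f.lk S :=
  Fan.mem_lk.mpr ⟨hjS, I, hI, insert_subset hj hS⟩

lemma Fan.coeff_zero (f : Fan V E n) {I : Finset V} (hI : I ∈ f.facets) {c : V → ℝ}
    (hc : ∑ i ∈ I, c i • f.u i = 0) : ∀ i ∈ I, c i = 0 := by
  intro i hi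
  have h1 : inner ℝ (∑ i ∈ I, c i • f.u i) (f.vtx I c) = 0 := by rw [hc]; simp
  rw [sum_inner] at h1
  have h2 : ∑ i ∈ I, c i ^ 2 = 0 := by
    rw [← h1]
    refine sum_congr rfl fun i hi => ?_
    rw [real_inner_smul_left, f.vtx_eq I hI i hi]; ring
  have := (sum_eq_zero_iff_of_nonneg (fun i _ => sq_nonneg (c i))).mp h2 i hi
  exact pow_eq_zero_iff two_ne_zero |>.mp this

/-- Simplex method. -/
lemma Fan.simplex (f : Fan V E n) {k : V → ℝ} (hk : f.T0 k) {τ I0 : Finset V}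
    (hI0 : I0 ∈ f.facets) (hτ : τ ⊆ I0) (w : E) (Φ : Finset V → Prop) (hΦ0 : Φ I0)
    (hΦ : ∀ I ∈ f.facets, τ ⊆ I → Φ I → ∀ i ∈ I, i ∉ τ → ∀ i', i' ∉ I →
      insert i' (I.erase i) ∈ f.facets → Φ (insert i' (I.erase i))) :
    ∃ I ∈ f.facets, τ ⊆ I ∧ Φ I ∧ ∃ c : V → ℝ, w = ∑ i ∈ I, c i • f.u i ∧
      ∀ i ∈ I, i ∉ τ → 0 ≤ c i := by
  classical
  obtain ⟨I, hI, hmax⟩ := exists_max_image (f.facets.filter fun I => τ ⊆ I ∧ Φ I)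
    (fun I => inner ℝ w (f.vtx I k)) ⟨I0, by simp [hI0, hτ, hΦ0]⟩
  rw [mem_filter] at hI
  obtain ⟨hIf, hτI, hΦI⟩ := hI
  obtain ⟨c, hc⟩ := f.span I hIf w
  refine ⟨I, hIf, hτI, hΦI, c, hc, ?_⟩
  intro i hi hiτ
  by_contra hneg
  push Not at hneg
  obtain ⟨i', hi', hI'⟩ := f.adj I hIf i hi
  have hiI' : i ∉ insert i' (I.erase i) := by
    simp only [mem_insert, mem_erase]
    rintro (rfl | h)
    · exact hi' hi
    · exact h.1 rfl
  have hm := hmax (insert i' (I.erase i)) (by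
    rw [mem_filter]
    refine ⟨hI', ?_, hΦ I hIf hτI hΦI i hi hiτ i' hi' hI'⟩
    intro a ha
    refine mem_insert_of_mem (mem_erase.mpr ⟨?_, hτI ha⟩)
    rintro rfl; exact hiτ ha)
  have h1 : inner ℝ w (f.vtx I k) = ∑ b ∈ I, c b * k b := by
    rw [hc, sum_inner]
    exact sum_congr rfl fun b hb => by rw [real_inner_smul_left, f.vtx_eq I hIf b hb]
  have h2 : inner ℝ w (f.vtx (insert i' (I.erase i)) k)
      = ∑ b ∈ I, c b * inner ℝ (f.u b) (f.vtx (insert i' (I.erase i)) k) := by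
    rw [hc, sum_inner]
    exact sum_congr rfl fun b hb => by rw [real_inner_smul_left]
  rw [h1, h2, ← add_sum_erase _ _ hi, ← add_sum_erase _ _ hi] at hm
  have h3 : ∑ b ∈ I.erase i, c b * inner ℝ (f.u b) (f.vtx (insert i' (I.erase i)) k)
      = ∑ b ∈ I.erase i, c b * k b :=
    sum_congr rfl fun b hb => by rw [f.vtx_eq _ hI' b (mem_insert_of_mem hb)]
  have h4 := hk _ hI' i hiI'
  rw [h3] at hm
  nlinarith

/-- Two cones of the fan that share a point (modulo a common face). -/
lemma Fan.fan (f : Fan V E n) {k : V → ℝ} (hk : f.T0 k) {τ I I' : Finset V}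
    (hI : I ∈ f.facets) (hI' : I' ∈ f.facets) (hτI : τ ⊆ I) (hτI' : τ ⊆ I') (c c' : V → ℝ)
    (hcc : ∑ i ∈ I, c i • f.u i = ∑ i ∈ I', c' i • f.u i)
    (hc : ∀ i ∈ I, i ∉ τ → 0 ≤ c i) (hc' : ∀ i ∈ I', i ∉ τ → 0 ≤ c' i) :
    ∀ i ∈ I, i ∉ τ → 0 < c i → i ∈ I' := by
  have gen : ∀ (I I' : Finset V), I ∈ f.facets → I' ∈ f.facets → τ ⊆ I' → ∀ c : V → ℝ,
      (∀ i ∈ I, i ∉ τ → 0 ≤ c i) →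
      (∀ i ∈ I, c i * inner ℝ (f.u i) (f.vtx I' k) ≤ c i * k i) := by
    intro I I' hI hI' hτI' c hc i hi
    by_cases hiI' : i ∈ I'
    · rw [f.vtx_eq I' hI' i hiI']
    · have h1 := hk I' hI' i hiI'
      have h2 := hc i hi (fun h => hiI' (hτI' h))
      nlinarith
  have ex : ∀ (I I' : Finset V), I ∈ f.facets → ∀ c : V → ℝ,
      inner ℝ (∑ i ∈ I, c i • f.u i) (f.vtx I' k) = ∑ i ∈ I, c i * inner ℝ (f.u i) (f.vtx I' k) := by
    intro I I' hI c
    rw [sum_inner]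
    exact sum_congr rfl fun b hb => by rw [real_inner_smul_left]
  have ex' : ∀ (I : Finset V), I ∈ f.facets → ∀ c : V → ℝ,
      inner ℝ (∑ i ∈ I, c i • f.u i) (f.vtx I k) = ∑ i ∈ I, c i * k i := by
    intro I hI c
    rw [ex I I hI]
    exact sum_congr rfl fun b hb => by rw [f.vtx_eq I hI b hb]
  intro i hi hiτ hpos
  by_contra hiI'
  have s1 : ∑ i ∈ I, c i * inner ℝ (f.u i) (f.vtx I' k) < ∑ i ∈ I, c i * k i := by
    refine sum_lt_sum (gen I I' hI hI' hτI' c hc) ⟨i, hi, ?_⟩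
    have := hk I' hI' i hiI'
    nlinarith
  have s2 : ∑ i ∈ I', c' i * inner ℝ (f.u i) (f.vtx I k) ≤ ∑ i ∈ I', c' i * k i :=
    sum_le_sum (gen I' I hI' hI hτI c' hc')
  rw [← ex I I' hI, ← ex' I hI, hcc] at s1
  rw [← ex I' I hI', ← ex' I' hI'] at s2
  linarith

lemma Fan.norm_pos (f : Fan V E n) {k : V → ℝ} (hk : f.T0 k) {τ : Finset V} (hτ : f.IsFace τ) :
    ∃ x : E, (∀ i ∈ τ, k i - f.ell x i = 0) ∧ ∀ j ∈ f.lk τ, 0 < k j - f.ell x j := by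
  classical
  set F := f.facets.filter fun I => τ ⊆ I with hF
  have hFne : F.Nonempty := by
    obtain ⟨I, hI, h⟩ := hτ
    exact ⟨I, by simp [hF, hI, h]⟩
  have hcard : (0 : ℝ) < F.card := by exact_mod_cast hFne.card_pos
  have key : ∀ j, k j - f.ell ((F.card : ℝ)⁻¹ • ∑ I ∈ F, f.vtx I k) j
      = (F.card : ℝ)⁻¹ * ∑ I ∈ F, (k j - inner ℝ (f.u j) (f.vtx I k)) := by
    intro j
    simp only [Fan.ell, real_inner_smul_right, inner_sum, sum_sub_distrib, sum_const, nsmul_eq_mul]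
    field_simp
  refine ⟨(F.card : ℝ)⁻¹ • ∑ I ∈ F, f.vtx I k, ?_, ?_⟩
  · intro i hi
    rw [key, sum_eq_zero, mul_zero]
    intro I hI
    rw [hF, mem_filter] at hI
    rw [f.vtx_eq I hI.1 i (hI.2 hi), sub_self]
  · intro j hj
    rw [key]
    refine mul_pos (inv_pos.mpr hcard) ?_
    obtain ⟨hjτ, I, hI, hjI⟩ := Fan.mem_lk.mp hj
    obtain ⟨i', hi', hI'⟩ := f.adj I hI j (hjI (mem_insert_self _ _))
    refine sum_pos' ?_ ⟨insert i' (I.erase j), ?_, ?_⟩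
    · intro J hJ
      rw [hF, mem_filter] at hJ
      by_cases hjJ : j ∈ J
      · rw [f.vtx_eq J hJ.1 j hjJ, sub_self]
      · exact (sub_pos.mpr (hk J hJ.1 j hjJ)).le
    · rw [hF, mem_filter]
      refine ⟨hI', fun a ha => mem_insert_of_mem (mem_erase.mpr ⟨?_, hjI (mem_insert_of_mem ha)⟩)⟩
      rintro rfl; exact hjτ ha
    · refine sub_pos.mpr (hk _ hI' j ?_)
      simp only [mem_insert, mem_erase]
      rintro (rfl | h)
      · exact hi' (hjI (mem_insert_self _ _))
      · exact h.1 rfl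

lemma Fan.norm_zero (f : Fan V E n) (h : V → ℝ) {τ : Finset V} (hτ : f.IsFace τ) :
    ∃ x : E, (∀ i ∈ τ, h i - f.ell x i = 0) := by
  obtain ⟨I, hI, hτI⟩ := hτ
  exact ⟨f.vtx I h, fun i hi => by
    simp only [Fan.ell]
    rw [f.vtx_eq I hI i (hτI hi), sub_self]⟩

end Fenchel


namespace Fenchel
open Finset

variable {V : Type} [Fintype V] [DecidableEq V] {E : Type} [NormedAddCommGroup E]
    [InnerProductSpace ℝ E] {n : ℕ} {R : Type} [CommRing R] [Algebra ℝ R]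

/-- Linear form with coefficients `h`. -/
def LL (X : V → R) (h : V → ℝ) : R := ∑ i, h i • X i

lemma LL_add (X : V → R) (h h' : V → ℝ) : LL X (h + h') = LL X h + LL X h' := by
  simp [LL, add_smul, sum_add_distrib]

lemma LL_smul (X : V → R) (c : ℝ) (h : V → ℝ) : LL X (c • h) = c • LL X h := by
  simp [LL, smul_sum, mul_smul]

lemma LL_sub (X : V → R) (h h' : V → ℝ) : LL X (h - h') = LL X h - LL X h' := by
  simp [LL, sub_smul, sum_sub_distrib]

/-- Abstract properties of the volume functional. -/
structure VolFun (f : Fan V E n) (X : V → R) (Λ : R →ₗ[ℝ] ℝ) : Prop where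
  trans : ∀ x p, Λ (LL X (f.ell x) * p) = 0
  nonface : ∀ S p, ¬ f.IsFace S → Λ ((∏ i ∈ S, X i) * p) = 0
  pos : ∀ I ∈ f.facets, 0 < Λ (∏ i ∈ I, X i)

variable {f : Fan V E n} {X : V → R} {Λ : R →ₗ[ℝ] ℝ}

lemma VolFun.shift (H : VolFun f X Λ) (h : V → ℝ) (x : E) (p : R) :
    Λ (LL X (h - f.ell x) * p) = Λ (LL X h * p) := by
  rw [LL_sub, sub_mul, map_sub, H.trans, sub_zero]

lemma VolFun.expand (H : VolFun f X Λ) {τ : Finset V} {h : V → ℝ} (h0 : ∀ i ∈ τ, h i = 0) (q : R) :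
    Λ (LL X h * ((∏ i ∈ τ, X i) * q)) = ∑ j ∈ f.lk τ, h j * Λ ((∏ i ∈ insert j τ, X i) * q) := by
  classical
  rw [LL, sum_mul, map_sum, ← sum_subset (subset_univ (f.lk τ))]
  · refine sum_congr rfl fun j hj => ?_
    rw [prod_insert (Fan.mem_lk.mp hj).1, smul_mul_assoc, map_smul, smul_eq_mul, mul_assoc]
  · intro j _ hj
    by_cases hjτ : j ∈ τ
    · rw [h0 j hjτ]; simp
    · have : ¬ f.IsFace (insert j τ) := fun h => hj (Fan.mem_lk.mpr ⟨hjτ, h⟩)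
      have h1 := H.nonface _ q this
      rw [prod_insert hjτ] at h1
      rw [smul_mul_assoc, map_smul, ← mul_assoc, h1, smul_zero]

lemma VolFun.positive (H : VolFun f X Λ) : ∀ (ks : List (V → ℝ)) (τ : Finset V),
    (∀ k ∈ ks, f.T0 k) → f.IsFace τ → τ.card + ks.length = n →
    0 < Λ ((∏ i ∈ τ, X i) * (ks.map (LL X)).prod) := by
  intro ks
  induction ks with
  | nil =>
    intro τ _ hτ hc
    obtain ⟨I, hI, hτI⟩ := hτ
    have : τ = I := eq_of_subset_of_card_le hτI (by rw [f.card_eq I hI]; simp at hc; omega)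
    subst this
    simpa using H.pos τ hI
  | cons k ks ih =>
    intro τ hks hτ hc
    obtain ⟨x, hx0, hxp⟩ := f.norm_pos (hks k (by simp)) hτ
    have h1 : (∏ i ∈ τ, X i) * ((k :: ks).map (LL X)).prod
        = LL X k * ((∏ i ∈ τ, X i) * (ks.map (LL X)).prod) := by
      simp only [List.map_cons, List.prod_cons]; ring
    rw [h1, ← H.shift k x, H.expand (h := k - f.ell x) (fun i hi => hx0 i hi)]
    refine sum_pos ?_ ?_
    · intro j hj
      refine mul_pos (hxp j hj) (ih _ (fun k hk => hks k (by simp [hk])) (Fan.mem_lk.mp hj).2 ?_)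
      rw [card_insert_of_notMem (Fan.mem_lk.mp hj).1]
      simp at hc; omega
    · obtain ⟨I, hI, hτI⟩ := hτ
      have : τ ⊂ I := by
        refine hτI.ssubset_of_ne ?_
        rintro rfl
        have := f.card_eq _ hI
        simp at hc; omega
      obtain ⟨j, hj, hjτ⟩ := exists_of_ssubset this
      exact ⟨j, Fan.mem_lk_of hI hτI hj hjτ⟩

/-- Pure algebra: from nonpositivity of one combination to the discriminant inequality. -/
lemma disc_of {a xx xk kk r : ℝ} (ha : a ≠ 0) (hkk : 0 < kk)
    (h : a ^ 2 * xx - 2 * a * r * xk + r ^ 2 * kk ≤ 0) : xx * kk ≤ xk ^ 2 := by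
  have h1 : a ^ 2 * (xx * kk) ≤ a ^ 2 * xk ^ 2 := by
    nlinarith [sq_nonneg (a * xk - r * kk)]
  exact le_of_mul_le_mul_left h1 (by positivity)

lemma quad_exp (X : V → R) (Λ : R →ₗ[ℝ] ℝ) (a r : ℝ) (x k : V → ℝ) (p : R) :
    Λ (LL X (a • x - r • k) * (LL X (a • x - r • k) * p))
      = a ^ 2 * Λ (LL X x * (LL X x * p)) - 2 * a * r * Λ (LL X x * (LL X k * p))
        + r ^ 2 * Λ (LL X k * (LL X k * p)) := by
  have : LL X (a • x - r • k) * (LL X (a • x - r • k) * p)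
      = (a ^ 2) • (LL X x * (LL X x * p)) - (2 * a * r) • (LL X x * (LL X k * p))
        + (r ^ 2) • (LL X k * (LL X k * p)) := by
    rw [LL_sub, LL_smul, LL_smul]
    simp only [Algebra.smul_def, map_mul, map_pow, map_ofNat]
    ring
  rw [this]; simp

lemma VolFun.shift2 (H : VolFun f X Λ) (h h' : V → ℝ) (x x' : E) (p : R) :
    Λ (LL X (h - f.ell x) * (LL X (h' - f.ell x') * p)) = Λ (LL X h * (LL X h' * p)) := by
  rw [H.shift, mul_left_comm, H.shift, mul_left_comm]

/-- Base case of the Alexandrov-Fenchel inequality (two-dimensional faces). -/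
lemma VolFun.af_base (H : VolFun f X Λ) {τ : Finset V} (hτ : f.IsFace τ) (hc : τ.card + 2 = n)
    {k : V → ℝ} (hk : f.T0 k) (x : V → ℝ) :
    Λ (LL X x * (LL X x * ∏ i ∈ τ, X i)) * Λ (LL X k * (LL X k * ∏ i ∈ τ, X i))
      ≤ Λ (LL X x * (LL X k * ∏ i ∈ τ, X i)) ^ 2 := by
  classical
  set p := ∏ i ∈ τ, X i with hp
  have hkk : 0 < Λ (LL X k * (LL X k * p)) := by
    have := H.positive [k, k] τ (by simp [hk]) hτ (by simp [hc])
    simp only [List.map_cons, List.map_nil, List.prod_cons, List.prod_nil, mul_one] at this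
    convert this using 2
    ring
  obtain ⟨I0, hI0, hτI0⟩ := hτ
  have hcard : (I0 \ τ).card = 2 := by
    rw [card_sdiff_of_subset hτI0, f.card_eq I0 hI0]; omega
  obtain ⟨z, j0, hzj, hI0τ⟩ := card_eq_two.mp hcard
  have hz : z ∈ I0 ∧ z ∉ τ := by rw [← mem_sdiff, hI0τ]; simp
  have hj0 : j0 ∈ I0 ∧ j0 ∉ τ := by rw [← mem_sdiff, hI0τ]; simp
  have hI0mem : ∀ a ∈ I0, a ∉ τ → a = z ∨ a = j0 := by
    intro a ha haτ
    have : a ∈ I0 \ τ := mem_sdiff.mpr ⟨ha, haτ⟩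
    rw [hI0τ] at this; simpa using this
  obtain ⟨I, hI, hτI, -, c, hcw, hc0⟩ := f.simplex hk hI0 hτI0 (-f.u z) (fun _ => True) trivial
    (by simp)
  have hzI : z ∉ I := by
    intro hzI
    have h1 : ∑ i ∈ I, (c i + if i = z then 1 else 0) • f.u i = 0 := by
      simp only [add_smul, sum_add_distrib, ← hcw, ite_smul, one_smul, zero_smul]
      rw [sum_ite_eq' I z]; simp [hzI]
    have := f.coeff_zero hI h1 z hzI
    have := hc0 z hzI hz.2
    simp at *
    linarith
  -- the vector y
  set y0 : V → ℝ := x - f.ell (f.vtx I x) with hy0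
  set k2 : V → ℝ := k - f.ell (f.vtx I k) with hk2
  have hk2z : 0 < k2 z := sub_pos.mpr (hk I hI z hzI)
  set r := y0 z / k2 z with hr
  set y : V → ℝ := (1 : ℝ) • y0 - r • k2 with hy
  have hy0I : ∀ i ∈ I, y0 i = 0 := fun i hi => by
    simp only [hy0, Pi.sub_apply, Fan.ell]; rw [f.vtx_eq I hI i hi, sub_self]
  have hk2I : ∀ i ∈ I, k2 i = 0 := fun i hi => by
    simp only [hk2, Pi.sub_apply, Fan.ell]; rw [f.vtx_eq I hI i hi, sub_self]
  have hyI : ∀ i ∈ I, y i = 0 := fun i hi => by simp [hy, hy0I i hi, hk2I i hi]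
  have hyz : y z = 0 := by
    simp only [hy, Pi.sub_apply, Pi.smul_apply, smul_eq_mul, one_mul, hr]
    field_simp; simp
  suffices hneg : Λ (LL X y * (LL X y * p)) ≤ 0 by
    rw [hy, quad_exp, hy0, hk2, H.shift2, H.shift2, H.shift2] at hneg
    exact disc_of one_ne_zero hkk hneg
  -- the test vector
  set x0 := f.vtx I0 (Pi.single j0 1) with hx0
  set g := f.ell x0 with hg
  have hgτ : ∀ i ∈ τ, g i = 0 := fun i hi => by
    simp only [hg, Fan.ell, hx0]; rw [f.vtx_eq I0 hI0 i (hτI0 hi)]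
    rw [Pi.single_apply, if_neg]; rintro rfl; exact hj0.2 hi
  have hgz : g z = 0 := by
    simp only [hg, Fan.ell, hx0]; rw [f.vtx_eq I0 hI0 z hz.1]
    rw [Pi.single_apply, if_neg hzj]
  have hgj : g j0 = 1 := by
    simp only [hg, Fan.ell, hx0]; rw [f.vtx_eq I0 hI0 j0 hj0.1]; simp
  -- the key consequence of the fan property
  have key : ∀ J ∈ f.facets, τ ⊆ J → ∀ d : V → ℝ, (∀ i ∈ J, i ∉ τ → 0 ≤ d i) →
      ∑ i ∈ J, d i * g i = 0 →
      (∀ i ∈ J, i ∉ τ → 0 < d i → i ∈ I0) ∨ (∀ i ∈ J, i ∉ τ → 0 < d i → i ∈ I) := by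
    intro J hJ hτJ d hd hdg
    obtain ⟨e, he⟩ := f.span I0 hI0 (∑ i ∈ J, d i • f.u i)
    have hej : e j0 = 0 := by
      have h1 : inner ℝ (∑ i ∈ J, d i • f.u i) x0 = 0 := by
        rw [sum_inner, ← hdg]
        exact sum_congr rfl fun i _ => by rw [real_inner_smul_left]; rfl
      rw [he, sum_inner, sum_eq_single j0] at h1
      · rw [real_inner_smul_left] at h1
        have : inner ℝ (f.u j0) x0 = 1 := hgj
        rwa [this, mul_one] at h1
      · intro b hb hbj
        rw [real_inner_smul_left, hx0, f.vtx_eq I0 hI0 b hb, Pi.single_apply, if_neg hbj, mul_zero]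
      · intro h; exact absurd hj0.1 h
    rcases le_or_gt 0 (e z) with hez | hez
    · left
      refine f.fan hk hJ hI0 hτJ hτI0 d e he hd ?_
      intro i hi hiτ
      rcases hI0mem i hi hiτ with rfl | rfl
      · exact hez
      · exact hej.ge
    · right
      refine f.fan hk hJ hI hτJ hτI d (fun i => (-e z) * c i + if i ∈ τ then e i else 0) ?_ hd ?_
      · rw [he]
        simp only [add_smul, sum_add_distrib, mul_smul, ← smul_sum, ← hcw]
        have h1 : I0 = insert z (insert j0 τ) := by
          ext a
          simp only [mem_insert]
          constructor
          · intro ha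
            by_cases haτ : a ∈ τ
            · simp [haτ]
            · rcases hI0mem a ha haτ with h | h <;> simp [h]
          · rintro (rfl | rfl | h)
            · exact hz.1
            · exact hj0.1
            · exact hτI0 h
        rw [h1, sum_insert (by simp [hzj, hz.2]), sum_insert hj0.2, hej, zero_smul, zero_add,
          neg_smul, smul_neg, neg_neg]
        congr 1
        simp only [ite_smul, zero_smul]
        rw [← sum_filter]
        congr 1
        ext a; simp only [mem_filter]
        exact ⟨fun h => ⟨hτI h, h⟩, fun h => h.2⟩
      · intro i hi hiτ
        have := hc0 i hi hiτ
        simp only [hiτ, if_false, add_zero]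
        exact mul_nonneg (by linarith) this
  set A := (f.lk τ).filter fun a => a ∉ I ∧ a ≠ z with hA
  have hAmem : ∀ a ∈ A, a ∈ f.lk τ ∧ a ∉ I ∧ a ≠ z := fun a ha => by
    simpa [hA] using ha
  have hgA : ∀ a ∈ A, g a ≠ 0 := by
    intro a ha hga
    obtain ⟨hal, haI, haz⟩ := hAmem a ha
    obtain ⟨haτ, J, hJ, hJs⟩ := Fan.mem_lk.mp hal
    have haJ : a ∈ J := hJs (mem_insert_self _ _)
    rcases key J hJ (fun b hb => hJs (mem_insert_of_mem hb)) (fun i => if i = a then 1 else 0)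
      (by intro i _ _; positivity) (by simp [hga]) with h | h
    · have := h a haJ haτ (by simp)
      rcases hI0mem a this haτ with h1 | h1
      · exact haz h1
      · rw [h1, hgj] at hga; exact one_ne_zero hga
    · exact haI (h a haJ haτ (by simp))
  have hgg : ∀ a ∈ A, ∀ b, b ∉ τ → b ≠ a → f.IsFace (insert b (insert a τ)) → 0 ≤ g a * g b := by
    intro a ha b hbτ hba hface
    obtain ⟨hal, haI, haz⟩ := hAmem a ha
    obtain ⟨haτ, -⟩ := Fan.mem_lk.mp hal
    obtain ⟨J, hJ, hJs⟩ := hface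
    have haJ : a ∈ J := hJs (by simp)
    have hbJ : b ∈ J := hJs (by simp)
    by_contra hneg
    push Not at hneg
    have hga : g a ≠ 0 := by rintro h; simp [h] at hneg
    have hgb : g b ≠ 0 := by rintro h; simp [h] at hneg
    have hsum : |g b| * g a + |g a| * g b = 0 := by
      rcases mul_neg_iff.mp hneg with ⟨h1, h2⟩ | ⟨h1, h2⟩
      · rw [abs_of_pos h1, abs_of_neg h2]; ring
      · rw [abs_of_pos h2, abs_of_neg h1]; ring
    rcases key J hJ (fun b hb => hJs (by simp [hb]))
      (fun i => (if i = a then |g b| else 0) + (if i = b then |g a| else 0))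
      (by intro i _ _; positivity)
      (by simp only [add_mul, sum_add_distrib, ite_mul, zero_mul]
          rw [sum_ite_eq' J a, sum_ite_eq' J b]; simp [haJ, hbJ, hsum]) with h | h
    · have h1 := h a haJ haτ (by simp [hba.symm, hgb])
      have h2 := h b hbJ hbτ (by simp [hba, hga])
      rcases hI0mem a h1 haτ with h3 | h3
      · exact haz h3
      rcases hI0mem b h2 hbτ with h4 | h4
      · rw [h4] at hgb; exact hgb hgz
      · exact hba (h4.trans h3.symm)
    · exact haI (h a haJ haτ (by simp [hba.symm, hgb]))
  -- the matrix
  set M : V → V → ℝ := fun a b => Λ (X a * (X b * p)) with hM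
  have hMs : ∀ a b, M a b = M b a := fun a b => by
    simp only [hM]; congr 1; ring
  have hMo : ∀ a ∈ f.lk τ, ∀ b ∈ f.lk τ, a ≠ b → (f.IsFace (insert b (insert a τ)) ∧ 0 < M a b) ∨ M a b = 0 := by
    intro a ha b hb hab
    have hbn : b ∉ insert a τ := by simp [hab.symm, (Fan.mem_lk.mp hb).1]
    have hprod : ∏ i ∈ insert b (insert a τ), X i = X a * (X b * p) := by
      rw [prod_insert hbn, prod_insert (Fan.mem_lk.mp ha).1]; ring
    by_cases hF : f.IsFace (insert b (insert a τ))
    · left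
      refine ⟨hF, ?_⟩
      have := H.positive [] _ (by simp) hF (by
        rw [card_insert_of_notMem hbn, card_insert_of_notMem (Fan.mem_lk.mp ha).1]; simpa using hc)
      simpa [hprod] using this
    · right
      have := H.nonface _ 1 hF
      rw [hprod] at this
      simpa using this
  have hexp : ∀ h : V → ℝ, (∀ i ∈ τ, h i = 0) → ∀ q, Λ (LL X h * (p * q)) = ∑ j ∈ f.lk τ, h j * Λ (X j * (p * q)) := by
    intro h h0 q
    rw [hp, H.expand h0]
    refine sum_congr rfl fun j hj => ?_
    rw [prod_insert (Fan.mem_lk.mp hj).1, mul_assoc]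
  have hyτ : ∀ i ∈ τ, y i = 0 := fun i hi => hyI i (hτI hi)
  have hQ : Λ (LL X y * (LL X y * p)) = ∑ a ∈ f.lk τ, ∑ b ∈ f.lk τ, M a b * y a * y b := by
    rw [mul_comm (LL X y) p, hexp y hyτ]
    refine sum_congr rfl fun a _ => ?_
    have : X a * (p * LL X y) = LL X y * (p * X a) := by ring
    rw [this, hexp y hyτ, mul_sum]
    refine sum_congr rfl fun b _ => ?_
    have : X b * (p * X a) = X a * (X b * p) := by ring
    rw [this]; simp only [hM]; ring
  have hrow : ∀ a, ∑ b ∈ f.lk τ, M a b * g b = 0 := by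
    intro a
    have h1 := H.trans x0 (p * X a)
    rw [← hg, hexp g hgτ] at h1
    rw [← h1]
    refine sum_congr rfl fun b _ => ?_
    have : X b * (p * X a) = X a * (X b * p) := by ring
    rw [this]; simp only [hM]; ring
  have hQA : Λ (LL X y * (LL X y * p)) = ∑ a ∈ A, ∑ b ∈ A, M a b * y a * y b := by
    have hyA : ∀ a ∈ f.lk τ, a ∉ A → y a = 0 := by
      intro a ha haA
      by_cases haI : a ∈ I
      · exact hyI a haI
      · by_cases haz : a = z
        · rw [haz, hyz]
        · exact absurd (by simp [hA, ha, haI, haz]) haA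
    rw [hQ, ← sum_subset (filter_subset _ _ : A ⊆ f.lk τ)]
    · refine sum_congr rfl fun a _ => ?_
      rw [← sum_subset (filter_subset _ _ : A ⊆ f.lk τ)]
      intro b hb hbA
      rw [hyA b hb hbA, mul_zero]
    · intro a ha haA
      refine sum_eq_zero fun b _ => ?_
      rw [hyA a ha haA]; ring
  have := nsd_of_super (ι := A) (fun a b => M a b) (fun a b => hMs a b)
    (fun a b hab => by
      rcases hMo a (hAmem a a.2).1 b (hAmem b b.2).1 (fun h => hab (Subtype.ext h)) with h | h
      · exact h.2.le
      · exact h.ge)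
    (fun a => |g a|) (fun _ => 0) (fun a => abs_pos.mpr (hgA a a.2))
    (by
      rintro ⟨a, ha⟩
      simp only [zero_mul]
      rw [sum_coe_sort A (fun b => M a b * |g b|)]
      have hal := (hAmem a ha).1
      have hga := hgA a ha
      have hsg : (SignType.sign (g a) : ℝ) * g a = |g a| := by
        rw [mul_comm, self_mul_sign]
      have hterm : ∀ b ∈ f.lk τ, b ≠ a → M a b * |g b| = M a b * ((SignType.sign (g a) : ℝ) * g b) := by
        intro b hb hba
        rcases hMo a hal b hb hba.symm with ⟨h, -⟩ | h
        · have := hgg a ha b (Fan.mem_lk.mp hb).1 hba h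
          congr 1
          rcases lt_or_gt_of_ne hga with h1 | h1
          · rw [sign_neg h1]
            have : g b ≤ 0 := by nlinarith
            rw [abs_of_nonpos this]; simp
          · rw [sign_pos h1]
            have : 0 ≤ g b := by nlinarith
            rw [abs_of_nonneg this]; simp
        · rw [h]; simp
      calc ∑ b ∈ A, M a b * |g b| ≤ ∑ b ∈ f.lk τ, M a b * |g b| := by
            refine sum_le_sum_of_subset_of_nonneg (filter_subset _ _) ?_
            intro b hb hbA
            have hab : a ≠ b := by rintro rfl; exact hbA ha
            rcases hMo a hal b hb hab with h | h
            · have := h.2; positivity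
            · rw [h]; simp
        _ = ∑ b ∈ f.lk τ, M a b * ((SignType.sign (g a) : ℝ) * g b) := by
            refine sum_congr rfl fun b hb => ?_
            by_cases hba : b = a
            · rw [hba, hsg]
            · exact hterm b hb hba
        _ = (SignType.sign (g a) : ℝ) * ∑ b ∈ f.lk τ, M a b * g b := by
            rw [mul_sum]; exact sum_congr rfl fun b _ => by ring
        _ ≤ 0 := by rw [hrow, mul_zero])
    (fun a => y a)
  rw [hQA]
  rw [← sum_coe_sort A]
  simp only [← sum_coe_sort A (fun b => _)]
  simpa using this

end Fenchel


namespace Fenchel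
open Finset

variable {V : Type} [Fintype V] [DecidableEq V] {E : Type} [NormedAddCommGroup E]
    [InnerProductSpace ℝ E] {n : ℕ} {R : Type} [CommRing R] [Algebra ℝ R]

variable {f : Fan V E n} {X : V → R} {Λ : R →ₗ[ℝ] ℝ}

lemma Fan.connected (f : Fan V E n) {k : V → ℝ} (hk : f.T0 k) {τ : Finset V}
    (hc : τ.card + 2 ≤ n) (z : V → ℝ)
    (hz : ∀ i ∈ f.lk τ, ∀ j ∈ f.lk τ, i ≠ j → f.IsFace (insert j (insert i τ)) → z i = z j) :
    ∀ i ∈ f.lk τ, ∀ j ∈ f.lk τ, z i = z j := by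
  intro i hi j hj
  obtain ⟨hiτ, Ii, hIi, hIis⟩ := Fan.mem_lk.mp hi
  obtain ⟨hjτ, Ij, hIj, hIjs⟩ := Fan.mem_lk.mp hj
  have hτi : τ ⊆ Ii := fun a ha => hIis (mem_insert_of_mem ha)
  have hτj : τ ⊆ Ij := fun a ha => hIjs (mem_insert_of_mem ha)
  have hcl : ∀ I ∈ f.facets, τ ⊆ I → ∀ a ∈ I, a ∉ τ → ∀ b ∈ I, b ∉ τ → z a = z b := by
    intro I hI hτI a ha haτ b hb hbτ
    by_cases hab : a = b
    · rw [hab]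
    · exact hz a (Fan.mem_lk_of hI hτI ha haτ) b (Fan.mem_lk_of hI hτI hb hbτ) hab
        ⟨I, hI, insert_subset hb (insert_subset ha hτI)⟩
  obtain ⟨I, hI, hτI, hΦ, c, hcw, hc0⟩ := f.simplex hk hIi hτi (∑ b ∈ Ij, (if b ∈ τ then (0 : ℝ) else 1) • f.u b)
    (fun I => ∀ a ∈ I, a ∉ τ → z a = z i)
    (fun a ha haτ => hcl Ii hIi hτi a ha haτ i (hIis (mem_insert_self _ _)) hiτ)
    (by
      intro I hI hτI hΦ b hb hbτ b' hb' hI' a ha haτ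
      have hτI' : τ ⊆ insert b' (I.erase b) := fun a haa =>
        mem_insert_of_mem (mem_erase.mpr ⟨by rintro rfl; exact hbτ haa, hτI haa⟩)
      have : ∃ d ∈ I.erase b, d ∉ τ := by
        by_contra hcon
        push Not at hcon
        have := card_le_card (show I.erase b ⊆ τ from hcon)
        rw [card_erase_of_mem hb, f.card_eq I hI] at this
        omega
      obtain ⟨d, hd, hdτ⟩ := this
      rw [← hΦ d (mem_of_mem_erase hd) hdτ]
      exact hcl _ hI' hτI' a ha haτ d (mem_insert_of_mem hd) hdτ)
  have hjI : j ∈ I := f.fan hk hIj hI hτj hτI _ c hcw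
    (by intro b _ _; positivity) hc0 j (hIjs (mem_insert_self _ _)) hjτ (by simp [hjτ])
  exact (hΦ j hjI hjτ).symm

/-- Alexandrov-Fenchel inequality for the abstract volume functional. -/
lemma VolFun.af (H : VolFun f X Λ) : ∀ (ks : List (V → ℝ)) (τ : Finset V),
    (∀ k ∈ ks, f.T0 k) → f.IsFace τ → τ.card + ks.length + 2 = n →
    ∀ (k : V → ℝ), f.T0 k → ∀ x : V → ℝ,
    Λ (LL X x * (LL X x * ((∏ i ∈ τ, X i) * (ks.map (LL X)).prod)))
      * Λ (LL X k * (LL X k * ((∏ i ∈ τ, X i) * (ks.map (LL X)).prod)))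
      ≤ Λ (LL X x * (LL X k * ((∏ i ∈ τ, X i) * (ks.map (LL X)).prod))) ^ 2 := by
  classical
  intro ks
  induction ks with
  | nil =>
    intro τ _ hτ hc k hk x
    simpa using H.af_base hτ (by simpa using hc) hk x
  | cons k0 ks ih =>
    intro τ hks hτ hc k hk x
    have hk0 : f.T0 k0 := hks k0 (by simp)
    have hks' : ∀ k ∈ ks, f.T0 k := fun k hk => hks k (by simp [hk])
    simp only [List.length_cons] at hc
    set P := (ks.map (LL X)).prod with hP
    set p := ∏ i ∈ τ, X i with hp
    have hcons : p * ((k0 :: ks).map (LL X)).prod = p * (LL X k0 * P) := by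
      simp [hP]
    rw [hcons]
    -- positivity facts
    have hpos1 : ∀ k k' : V → ℝ, f.T0 k → f.T0 k' → 0 < Λ (LL X k * (LL X k' * (p * (LL X k0 * P)))) := by
      intro k k' hk hk'
      have := H.positive (k :: k' :: k0 :: ks) τ (by
        intro a ha; simp only [List.mem_cons] at ha
        rcases ha with rfl | rfl | rfl | h
        exacts [hk, hk', hk0, hks' a h]) hτ (by simp; omega)
      convert this using 2
      simp only [List.map_cons, List.prod_cons, ← hP, ← hp]; ring
    have hexp : ∀ h : V → ℝ, (∀ i ∈ τ, h i = 0) → ∀ q, Λ (LL X h * (p * q)) = ∑ j ∈ f.lk τ, h j * Λ (X j * (p * q)) := by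
      intro h h0 q
      rw [hp, H.expand h0]
      refine sum_congr rfl fun j hj => ?_
      rw [prod_insert (Fan.mem_lk.mp hj).1, mul_assoc]
    obtain ⟨y0, hy0z, hy0p⟩ := f.norm_pos hk0 hτ
    set M : V → V → ℝ := fun a b => Λ (X a * (X b * (p * (LL X k0 * P)))) with hM
    set pp : V → ℝ := fun a => Λ (X a * (LL X k0 * (p * (LL X k0 * P)))) with hpp
    have hMs : ∀ a b, M a b = M b a := fun a b => by
      simp only [hM]; congr 1; ring
    have hMo : ∀ a ∈ f.lk τ, ∀ b ∈ f.lk τ, a ≠ b → (f.IsFace (insert b (insert a τ)) ∧ 0 < M a b) ∨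
        (¬ f.IsFace (insert b (insert a τ)) ∧ M a b = 0) := by
      intro a ha b hb hab
      have hbn : b ∉ insert a τ := by simp [hab.symm, (Fan.mem_lk.mp hb).1]
      have hprod : (∏ i ∈ insert b (insert a τ), X i) * (LL X k0 * P) = X a * (X b * (p * (LL X k0 * P))) := by
        rw [prod_insert hbn, prod_insert (Fan.mem_lk.mp ha).1]; ring
      by_cases hF : f.IsFace (insert b (insert a τ))
      · left
        refine ⟨hF, ?_⟩
        have := H.positive (k0 :: ks) _ hks hF (by
          rw [card_insert_of_notMem hbn, card_insert_of_notMem (Fan.mem_lk.mp ha).1]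
          simp only [List.length_cons]; omega)
        simpa [← hP, hprod] using this
      · right
        have := H.nonface _ (LL X k0 * P) hF
        rw [hprod] at this
        exact ⟨hF, this⟩
    have hpppos : ∀ a ∈ f.lk τ, 0 < pp a := by
      intro a ha
      have := H.positive (k0 :: k0 :: ks) (insert a τ) (by
        intro a ha; simp only [List.mem_cons] at ha
        rcases ha with rfl | rfl | h
        exacts [hk0, hk0, hks' a h]) (Fan.mem_lk.mp ha).2 (by
          rw [card_insert_of_notMem (Fan.mem_lk.mp ha).1]; simp only [List.length_cons]; omega)
      simp only [hpp]
      convert this using 2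
      rw [prod_insert (Fan.mem_lk.mp ha).1]
      simp only [List.map_cons, List.prod_cons, ← hP, ← hp]; ring
    have hrow : ∀ (a : V) (h : V → ℝ), (∀ i ∈ τ, h i = 0) →
        Λ (X a * (LL X h * (p * (LL X k0 * P)))) = ∑ b ∈ f.lk τ, M a b * h b := by
      intro a h h0
      have : X a * (LL X h * (p * (LL X k0 * P))) = LL X h * (p * (X a * (LL X k0 * P))) := by ring
      rw [this, hexp h h0]
      refine sum_congr rfl fun b _ => ?_
      have : X b * (p * (X a * (LL X k0 * P))) = X a * (X b * (p * (LL X k0 * P))) := by ring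
      rw [this]; simp only [hM]; ring
    have hQ : ∀ h : V → ℝ, (∀ i ∈ τ, h i = 0) →
        Λ (LL X h * (LL X h * (p * (LL X k0 * P)))) = ∑ a ∈ f.lk τ, ∑ b ∈ f.lk τ, M a b * h a * h b := by
      intro h h0
      have : LL X h * (LL X h * (p * (LL X k0 * P))) = LL X h * (p * (LL X h * (LL X k0 * P))) := by ring
      rw [this, hexp h h0]
      refine sum_congr rfl fun a _ => ?_
      have : X a * (p * (LL X h * (LL X k0 * P))) = X a * (LL X h * (p * (LL X k0 * P))) := by ring
      rw [this, hrow a h h0, mul_sum]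
      exact sum_congr rfl fun b _ => by ring
    -- Bochner
    have hneg : ∀ x : V → ℝ, Λ (LL X x * (LL X k0 * (p * (LL X k0 * P)))) = 0 →
        Λ (LL X x * (LL X x * (p * (LL X k0 * P)))) ≤ 0 := by
      intro x hx
      obtain ⟨v, hv⟩ := f.norm_zero x hτ
      set h : V → ℝ := x - f.ell v with hh
      have h0 : ∀ i ∈ τ, h i = 0 := hv
      rw [← H.shift2 x x v v, ← hh, hQ h h0]
      have hx2 : ∑ a ∈ f.lk τ, h a * pp a = 0 := by
        rw [← hx, ← H.shift x v, ← hh]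
        have : LL X h * (LL X k0 * (p * (LL X k0 * P))) = LL X h * (p * (LL X k0 * (LL X k0 * P))) := by ring
        rw [this, hexp h h0]
        refine sum_congr rfl fun b _ => ?_
        have : X b * (p * (LL X k0 * (LL X k0 * P))) = X b * (LL X k0 * (p * (LL X k0 * P))) := by ring
        rw [this]
      have key := perron_bochner (ι := f.lk τ) (fun a b => M a b) (fun a b => hMs a b)
        (fun a b hab => by
          rcases hMo a a.2 b b.2 (fun h => hab (Subtype.ext h)) with h | h
          · exact h.2.le
          · exact h.2.ge)
        (fun a => k0 a - f.ell y0 a) (fun a => pp a) (fun a => hy0p a a.2) (fun a => hpppos a a.2)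
        (by
          intro a
          rw [sum_coe_sort (f.lk τ) (fun b => M a b * (k0 b - f.ell y0 b))]
          have := hrow a (k0 - f.ell y0) hy0z
          rw [mul_left_comm, H.shift, mul_left_comm] at this
          exact this.symm)
        (by
          intro w
          set W : V → ℝ := fun a => if ha : a ∈ f.lk τ then w ⟨a, ha⟩ else 0 with hW
          have hWw : ∀ a : f.lk τ, w a = W a := fun a => by simp [hW]
          have hW0 : ∀ i ∈ τ, W i = 0 := fun i hi => by
            simp only [hW]
            rw [dif_neg]
            intro h; exact (Fan.mem_lk.mp h).1 hi
          simp only [hWw]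
          have hl : ∑ a : f.lk τ, ∑ b : f.lk τ, M a b * W a * W b = ∑ a ∈ f.lk τ, ∑ b ∈ f.lk τ, M a b * W a * W b := by
            rw [← sum_coe_sort (f.lk τ)]
            refine sum_congr rfl fun a _ => ?_
            rw [← sum_coe_sort (f.lk τ)]
          have hr : ∀ a : f.lk τ, ∑ b : f.lk τ, M a b * W b = Λ (X a * (LL X W * (p * (LL X k0 * P)))) := by
            intro a
            rw [hrow a W hW0, ← sum_coe_sort (f.lk τ)]
          rw [hl, ← hQ W hW0]
          have e1 : Λ (LL X W * (LL X W * (p * (LL X k0 * P))))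
              = ∑ a ∈ f.lk τ, (k0 a - f.ell y0 a) * Λ (LL X W * (LL X W * ((∏ i ∈ insert a τ, X i) * P))) := by
            have : LL X W * (LL X W * (p * (LL X k0 * P))) = LL X k0 * (p * (LL X W * (LL X W * P))) := by ring
            rw [this, ← H.shift k0 y0, hexp (k0 - f.ell y0) hy0z]
            refine sum_congr rfl fun a ha => ?_
            rw [prod_insert (Fan.mem_lk.mp ha).1]
            simp only [Pi.sub_apply]
            congr 2; ring
          rw [e1, ← sum_coe_sort (f.lk τ)]
          refine sum_le_sum fun a _ => ?_
          rw [hr a]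
          have h1 := ih (insert (a : V) τ) hks' (Fan.mem_lk.mp a.2).2 (by
            rw [card_insert_of_notMem (Fan.mem_lk.mp a.2).1]; omega) k0 hk0 W
          have e2 : LL X k0 * (LL X k0 * ((∏ i ∈ insert (a : V) τ, X i) * P))
              = X a * (LL X k0 * (p * (LL X k0 * P))) := by
            rw [prod_insert (Fan.mem_lk.mp a.2).1]; ring
          have e3 : LL X W * (LL X k0 * ((∏ i ∈ insert (a : V) τ, X i) * P))
              = X a * (LL X W * (p * (LL X k0 * P))) := by
            rw [prod_insert (Fan.mem_lk.mp a.2).1]; ring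
          rw [e2, e3] at h1
          have hp1 := hpppos a a.2
          have h2 : Λ (LL X W * (LL X W * ((∏ i ∈ insert (a : V) τ, X i) * P)))
              ≤ Λ (X a * (LL X W * (p * (LL X k0 * P)))) ^ 2 / pp a := by
            rw [le_div_iff₀ hp1]; exact h1
          calc _ ≤ (k0 a - f.ell y0 a) * (Λ (X a * (LL X W * (p * (LL X k0 * P)))) ^ 2 / pp a) :=
                mul_le_mul_of_nonneg_left h2 (hy0p a a.2).le
            _ = _ := by ring)
        (by
          intro w hw a b
          set W : V → ℝ := fun a => if ha : a ∈ f.lk τ then w ⟨a, ha⟩ else 0 with hW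
          have hWw : ∀ a : f.lk τ, w a = W a := fun a => by simp [hW]
          rw [hWw, hWw]
          refine f.connected hk0 (by omega) W ?_ a a.2 b b.2
          intro i hi j hj hij hface
          have := hw ⟨i, hi⟩ ⟨j, hj⟩ (by simpa using hij) (by
            rcases hMo i hi j hj hij with h | h
            · exact h.2.ne'
            · exact absurd hface h.1)
          simpa [hWw] using this)
        (fun a => h a) (by rw [sum_coe_sort (f.lk τ) (fun a => h a * pp a)]; exact hx2)
      rw [← sum_coe_sort (f.lk τ)]
      refine le_trans (le_of_eq ?_) key
      refine sum_congr rfl fun a _ => ?_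
      rw [← sum_coe_sort (f.lk τ)]
    have h1 := hpos1 k k0 hk hk0
    set al := Λ (LL X k * (LL X k0 * (p * (LL X k0 * P)))) with hal
    set be := Λ (LL X x * (LL X k0 * (p * (LL X k0 * P)))) with hbe
    have h2 := hneg (al • x - be • k) (by
      rw [LL_sub, LL_smul, LL_smul, sub_mul, map_sub, smul_mul_assoc, smul_mul_assoc, map_smul,
        map_smul, ← hal, ← hbe]
      simp only [smul_eq_mul]; ring)
    rw [quad_exp] at h2
    exact disc_of h1.ne' (hpos1 k k hk hk) h2

/-- Fenchel's inequality for the abstract volume functional. -/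
lemma VolFun.fenchel (H : VolFun f X Λ) (ks : List (V → ℝ)) (hks : ∀ k ∈ ks, f.T0 k)
    (hn : ks.length + 2 = n) (a b c : V → ℝ) (ha : f.T0 a) (hb : f.T0 b) (hc : f.T0 c) :
    Λ (LL X a * (LL X a * (ks.map (LL X)).prod)) * Λ (LL X b * (LL X c * (ks.map (LL X)).prod))
      ≤ 2 * Λ (LL X a * (LL X b * (ks.map (LL X)).prod)) * Λ (LL X a * (LL X c * (ks.map (LL X)).prod)) := by
  set P := (ks.map (LL X)).prod with hP
  have hface : f.IsFace ∅ := by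
    obtain ⟨I, hI⟩ := f.nonempty
    exact ⟨I, hI, empty_subset _⟩
  have hpos : ∀ k k' : V → ℝ, f.T0 k → f.T0 k' → 0 < Λ (LL X k * (LL X k' * P)) := by
    intro k k' hk hk'
    have := H.positive (k :: k' :: ks) ∅ (by
      intro a ha; simp only [List.mem_cons] at ha
      rcases ha with rfl | rfl | h
      exacts [hk, hk', hks a h]) hface (by simp; omega)
    simpa [← hP] using this
  have haf : ∀ x, Λ (LL X x * (LL X x * P)) * Λ (LL X a * (LL X a * P)) ≤ Λ (LL X x * (LL X a * P)) ^ 2 := by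
    intro x
    simpa [← hP] using H.af ks ∅ hks hface (by simp; omega) a ha x
  have aa := hpos a a ha ha
  have ab := hpos a b ha hb
  have ac := hpos a c ha hc
  have bb := hpos b b hb hb
  have cc := hpos c c hc hc
  set Qaa := Λ (LL X a * (LL X a * P)) with hQaa
  set Qab := Λ (LL X a * (LL X b * P)) with hQab
  set Qac := Λ (LL X a * (LL X c * P)) with hQac
  set Qbb := Λ (LL X b * (LL X b * P)) with hQbb
  set Qcc := Λ (LL X c * (LL X c * P)) with hQcc
  set Qbc := Λ (LL X b * (LL X c * P)) with hQbc
  have h := haf (Qac • b + Qab • c)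
  have e1 : Λ (LL X (Qac • b + Qab • c) * (LL X (Qac • b + Qab • c) * P))
      = Qac ^ 2 * Qbb + 2 * Qac * Qab * Qbc + Qab ^ 2 * Qcc := by
    have : LL X (Qac • b + Qab • c) * (LL X (Qac • b + Qab • c) * P)
      = (Qac ^ 2) • (LL X b * (LL X b * P)) + (2 * Qac * Qab) • (LL X b * (LL X c * P))
        + (Qab ^ 2) • (LL X c * (LL X c * P)) := by
      rw [LL_add, LL_smul, LL_smul]
      simp only [Algebra.smul_def, map_mul, map_pow, map_ofNat]
      ring
    rw [this]; simp [hQbb, hQcc, hQbc]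
  have e2 : Λ (LL X (Qac • b + Qab • c) * (LL X a * P)) = 2 * Qab * Qac := by
    have : LL X (Qac • b + Qab • c) * (LL X a * P)
      = Qac • (LL X a * (LL X b * P)) + Qab • (LL X a * (LL X c * P)) := by
      rw [LL_add, LL_smul, LL_smul]
      simp only [Algebra.smul_def]
      ring
    rw [this]; simp only [map_add, map_smul, smul_eq_mul, ← hQab, ← hQac]; ring
  rw [e1, e2] at h
  have h3 : (2 * Qac * Qab) * (Qaa * Qbc) ≤ (2 * Qac * Qab) * (2 * Qab * Qac) := by
    have : 0 ≤ (Qac ^ 2 * Qbb + Qab ^ 2 * Qcc) * Qaa := by positivity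
    nlinarith
  exact le_of_mul_le_mul_left h3 (by positivity)

end Fenchel


namespace Fenchel
open Finset

variable {V : Type} [Fintype V] [DecidableEq V] {E : Type} [NormedAddCommGroup E]
    [InnerProductSpace ℝ E] {n : ℕ}

/-- The polytope with support vector `h`. -/
def Fan.P (f : Fan V E n) (h : V → ℝ) : Set E := {x | ∀ j, inner ℝ (f.u j) x ≤ h j}

/-- Weakly admissible support vectors. -/
def Fan.T (f : Fan V E n) (h : V → ℝ) : Prop :=
  ∀ I ∈ f.facets, ∀ j, inner ℝ (f.u j) (f.vtx I h) ≤ h j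

lemma Fan.T0.T {f : Fan V E n} {h : V → ℝ} (hh : f.T0 h) : f.T h := by
  intro I hI j
  by_cases hj : j ∈ I
  · exact (f.vtx_eq I hI j hj h).le
  · exact (hh I hI j hj).le

lemma Fan.T.add {f : Fan V E n} {h h' : V → ℝ} (hh : f.T h) (hh' : f.T h') : f.T (h + h') := by
  intro I hI j
  rw [map_add, inner_add_right]
  exact add_le_add (hh I hI j) (hh' I hI j)

lemma Fan.T0.add {f : Fan V E n} {h h' : V → ℝ} (hh : f.T0 h) (hh' : f.T0 h') : f.T0 (h + h') := by
  intro I hI j hj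
  rw [map_add, inner_add_right]
  exact add_lt_add (hh I hI j hj) (hh' I hI j hj)

lemma Fan.T.add_T0 {f : Fan V E n} {h h' : V → ℝ} (hh : f.T h) (hh' : f.T0 h') : f.T0 (h + h') := by
  intro I hI j hj
  rw [map_add, inner_add_right]
  exact add_lt_add_of_le_of_lt (hh I hI j) (hh' I hI j hj)

lemma Fan.T0.smul {f : Fan V E n} {h : V → ℝ} (hh : f.T0 h) {c : ℝ} (hc : 0 < c) : f.T0 (c • h) := by
  intro I hI j hj
  rw [map_smul, inner_smul_right]
  exact mul_lt_mul_of_pos_left (hh I hI j hj) hc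

lemma Fan.T0.sum {f : Fan V E n} {ι : Type*} (S : Finset ι) (hS : S.Nonempty) (h : ι → V → ℝ)
    (hh : ∀ i ∈ S, f.T0 (h i)) : f.T0 (∑ i ∈ S, h i) := by
  intro I hI j hj
  rw [map_sum, inner_sum, Finset.sum_apply]
  exact sum_lt_sum_of_nonempty hS fun i hi => hh i hi I hI j hj

lemma Fan.vtx_mem (f : Fan V E n) {h : V → ℝ} (hh : f.T h) {I : Finset V} (hI : I ∈ f.facets) :
    f.vtx I h ∈ f.P h := fun j => hh I hI j

lemma Fan.vtx_unique (f : Fan V E n) {h : V → ℝ} {I : Finset V} (hI : I ∈ f.facets) {x : E}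
    (hx : ∀ i ∈ I, inner ℝ (f.u i) x = h i) : x = f.vtx I h := by
  obtain ⟨c, hc⟩ := f.span I hI (x - f.vtx I h)
  have : inner ℝ (x - f.vtx I h) (x - f.vtx I h) = 0 := by
    nth_rewrite 1 [hc]
    rw [sum_inner]
    refine sum_eq_zero fun i hi => ?_
    rw [real_inner_smul_left, inner_sub_right, hx i hi, f.vtx_eq I hI i hi, sub_self, mul_zero]
  rw [inner_self_eq_zero] at this
  exact sub_eq_zero.mp this

/-- Hull lemma. -/
lemma Fan.hull [CompleteSpace E] (f : Fan V E n) {k : V → ℝ} (hk : f.T0 k) {h : V → ℝ} {L : Set E} (hLc : Convex ℝ L)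
    (hL : IsClosed L) (hv : ∀ I ∈ f.facets, f.vtx I h ∈ L) : f.P h ⊆ L := by
  intro x hx
  by_contra hxL
  obtain ⟨g, s, hg1, hg2⟩ := geometric_hahn_banach_closed_point hLc hL hxL
  set w := (InnerProductSpace.toDual ℝ E).symm g with hw
  have hgw : ∀ y, g y = inner ℝ w y := fun y => by rw [hw, InnerProductSpace.toDual_symm_apply]
  obtain ⟨I0, hI0⟩ := f.nonempty
  obtain ⟨I, hI, -, -, c, hcw, hc0⟩ := f.simplex hk hI0 (empty_subset _) w (fun _ => True) trivial (by simp)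
  have h1 := hg1 _ (hv I hI)
  rw [hgw, hcw, sum_inner] at h1
  rw [hgw, hcw, sum_inner] at hg2
  have : ∑ i ∈ I, inner ℝ (c i • f.u i) x ≤ ∑ i ∈ I, inner ℝ (c i • f.u i) (f.vtx I h) := by
    refine sum_le_sum fun i hi => ?_
    rw [real_inner_smul_left, real_inner_smul_left, f.vtx_eq I hI i hi]
    exact mul_le_mul_of_nonneg_left (hx i) (hc0 i hi (by simp))
  linarith

lemma Fan.hull_weights [CompleteSpace E] (f : Fan V E n) {k : V → ℝ} (hk : f.T0 k) {h : V → ℝ} {x : E} (hx : x ∈ f.P h) :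
    ∃ l : Finset V → ℝ, (∀ I ∈ f.facets, 0 ≤ l I) ∧ ∑ I ∈ f.facets, l I = 1 ∧
      x = ∑ I ∈ f.facets, l I • f.vtx I h := by
  classical
  let A : (f.facets → ℝ) →ₗ[ℝ] E := ∑ I : f.facets, (LinearMap.proj I).smulRight (f.vtx I h)
  have hA : ∀ l, A l = ∑ I : f.facets, l I • f.vtx I h := fun l => by simp [A]
  have hAc : Continuous A := A.continuous_of_finiteDimensional
  have := f.hull hk (h := h) (L := A '' stdSimplex ℝ f.facets)
    ((convex_stdSimplex ℝ _).linear_image A)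
    ((isCompact_stdSimplex ℝ _).image hAc).isClosed
    (by
      intro I hI
      refine ⟨Pi.single ⟨I, hI⟩ 1, single_mem_stdSimplex ℝ _, ?_⟩
      rw [hA, Fintype.sum_eq_single (⟨I, hI⟩ : f.facets)]
      · simp
      · intro J hJ; simp [hJ])
  obtain ⟨l, hl, hlx⟩ := this hx
  refine ⟨fun I => if hI : I ∈ f.facets then l ⟨I, hI⟩ else 0, ?_, ?_, ?_⟩
  · intro I hI; simp only [hI, dif_pos]; exact hl.1 _
  · rw [← hl.2, ← sum_coe_sort f.facets]
    exact sum_congr rfl fun I _ => by simp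
  · rw [← hlx, hA, ← sum_coe_sort f.facets]
    exact sum_congr rfl fun I _ => by simp

lemma Fan.isCompact_P [FiniteDimensional ℝ E] (f : Fan V E n) {k : V → ℝ} (hk : f.T0 k) (h : V → ℝ) :
    IsCompact (f.P h) := by
  classical
  have hfin : ((fun I => f.vtx I h) '' (f.facets : Set (Finset V))).Finite := f.facets.finite_toSet.image _
  refine IsCompact.of_isClosed_subset (hfin.isCompact_convexHull ℝ) ?_
    (f.hull hk (convex_convexHull ℝ _) (hfin.isCompact_convexHull ℝ).isClosed
    fun I hI => subset_convexHull ℝ _ ⟨I, hI, rfl⟩)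
  have : f.P h = ⋂ j, {x | inner ℝ (f.u j) x ≤ h j} := by ext x; simp [Fan.P]
  rw [this]
  exact isClosed_iInter fun j => isClosed_le (by fun_prop) continuous_const

lemma Fan.convex_P (f : Fan V E n) (h : V → ℝ) : Convex ℝ (f.P h) := by
  intro x hx y hy a b ha hb hab j
  rw [inner_add_right, inner_smul_right, inner_smul_right]
  have := hx j; have := hy j
  calc a * inner ℝ (f.u j) x + b * inner ℝ (f.u j) y ≤ a * h j + b * h j := by gcongr
    _ = h j := by rw [← add_mul, hab, one_mul]

lemma Fan.P_add [FiniteDimensional ℝ E] (f : Fan V E n) {k : V → ℝ} (hk : f.T0 k) {h h' : V → ℝ} (hh : f.T h) (hh' : f.T h') :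
    f.P h + f.P h' = f.P (h + h') := by
  apply Set.Subset.antisymm
  · rintro _ ⟨x, hx, y, hy, rfl⟩ j
    simp only [inner_add_right, Pi.add_apply]
    exact add_le_add (hx j) (hy j)
  · refine f.hull hk ((f.convex_P h).add (f.convex_P h')) ((f.isCompact_P hk h).add (f.isCompact_P hk h')).isClosed ?_
    intro I hI
    rw [map_add]
    exact Set.add_mem_add (f.vtx_mem hh hI) (f.vtx_mem hh' hI)

lemma Fan.P_sum [FiniteDimensional ℝ E] (f : Fan V E n) {ι : Type*} [DecidableEq ι] (S : Finset ι) (hS : S.Nonempty) (h : ι → V → ℝ)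
    (hh : ∀ i ∈ S, f.T0 (h i)) : ∑ i ∈ S, f.P (h i) = f.P (∑ i ∈ S, h i) := by
  induction hS using Finset.Nonempty.cons_induction with
  | singleton a => simp
  | cons a s ha hs ih =>
    rw [sum_cons, sum_cons, ih (fun i hi => hh i (by simp [hi]))]
    have h1 := hh a (by simp)
    exact f.P_add h1 h1.T (Fan.T0.sum s hs h (fun i hi => hh i (by simp [hi]))).T

lemma Fan.active_face [CompleteSpace E] (f : Fan V E n) {h : V → ℝ} (hh : f.T0 h) {x : E} (hx : x ∈ f.P h)
    (S : Finset V) (hS : ∀ i ∈ S, inner ℝ (f.u i) x = h i) : f.IsFace S := by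
  obtain ⟨l, hl0, hl1, hlx⟩ := f.hull_weights hh hx
  obtain ⟨I, hI, hIl⟩ : ∃ I ∈ f.facets, 0 < l I := by
    by_contra hcon
    push Not at hcon
    have := sum_nonpos hcon
    linarith
  refine ⟨I, hI, fun i hi => ?_⟩
  by_contra hiI
  have h1 : ∑ J ∈ f.facets, l J * inner ℝ (f.u i) (f.vtx J h) < ∑ J ∈ f.facets, l J * h i := by
    refine sum_lt_sum (fun J hJ => mul_le_mul_of_nonneg_left (hh.T J hJ i) (hl0 J hJ)) ⟨I, hI, ?_⟩
    exact mul_lt_mul_of_pos_left (hh I hI i hiI) hIl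
  rw [← sum_mul, hl1, one_mul, ← hS i hi, hlx, inner_sum] at h1
  simp only [inner_smul_right] at h1
  exact lt_irrefl _ h1

/-- Barycentre of a face. -/
noncomputable def Fan.bar (f : Fan V E n) (τ : Finset V) : (V → ℝ) →ₗ[ℝ] E :=
  (((f.facets.filter fun I => τ ⊆ I).card : ℝ)⁻¹) • ∑ I ∈ f.facets.filter fun I => τ ⊆ I, f.vtx I

lemma Fan.slack_bar (f : Fan V E n) {τ : Finset V} (hτ : f.IsFace τ) (h : V → ℝ) (j : V) :
    h j - inner ℝ (f.u j) (f.bar τ h) = ((f.facets.filter fun I => τ ⊆ I).card : ℝ)⁻¹ *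
      ∑ I ∈ f.facets.filter fun I => τ ⊆ I, (h j - inner ℝ (f.u j) (f.vtx I h)) := by
  have hne : (f.facets.filter fun I => τ ⊆ I).Nonempty := by
    obtain ⟨I, hI, hs⟩ := hτ
    exact ⟨I, by simp [hI, hs]⟩
  have hcard : (0 : ℝ) < (f.facets.filter fun I => τ ⊆ I).card := by exact_mod_cast hne.card_pos
  simp only [Fan.bar, LinearMap.smul_apply, LinearMap.sum_apply, real_inner_smul_right, inner_sum,
    sum_sub_distrib, sum_const, nsmul_eq_mul]
  field_simp

lemma Fan.slack_zero (f : Fan V E n) {τ : Finset V} (hτ : f.IsFace τ) (h : V → ℝ) {j : V} (hj : j ∈ τ) :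
    h j - inner ℝ (f.u j) (f.bar τ h) = 0 := by
  rw [f.slack_bar hτ, sum_eq_zero, mul_zero]
  intro I hI
  rw [mem_filter] at hI
  rw [f.vtx_eq I hI.1 j (hI.2 hj), sub_self]

lemma Fan.slack_pos (f : Fan V E n) {τ : Finset V} (hτ : f.IsFace τ) {h : V → ℝ} (hh : f.T0 h) {j : V} (hj : j ∉ τ) :
    0 < h j - inner ℝ (f.u j) (f.bar τ h) := by
  rw [f.slack_bar hτ]
  obtain ⟨I, hI, hs⟩ := hτ
  have hne : (f.facets.filter fun I => τ ⊆ I).Nonempty := ⟨I, by simp [hI, hs]⟩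
  refine mul_pos (inv_pos.mpr (by exact_mod_cast hne.card_pos)) ?_
  have : ∃ J ∈ f.facets, τ ⊆ J ∧ j ∉ J := by
    by_cases hjI : j ∈ I
    · obtain ⟨i', hi', hI'⟩ := f.adj I hI j hjI
      refine ⟨_, hI', fun a ha => mem_insert_of_mem (mem_erase.mpr ⟨?_, hs ha⟩), ?_⟩
      · rintro rfl; exact hj ha
      · simp only [mem_insert, mem_erase]
        rintro (rfl | h)
        · exact hi' hjI
        · exact h.1 rfl
    · exact ⟨I, hI, hs, hjI⟩
  obtain ⟨J, hJ, hτJ, hjJ⟩ := this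
  refine sum_pos' ?_ ⟨J, by simp [hJ, hτJ], sub_pos.mpr (hh J hJ j hjJ)⟩
  intro K hK
  rw [mem_filter] at hK
  exact sub_nonneg.mpr (hh.T K hK.1 j)

lemma Fan.bar_mem (f : Fan V E n) {τ : Finset V} (hτ : f.IsFace τ) {h : V → ℝ} (hh : f.T0 h) :
    f.bar τ h ∈ f.P h := by
  intro j
  by_cases hj : j ∈ τ
  · linarith [f.slack_zero hτ h hj]
  · linarith [f.slack_pos hτ hh hj]

lemma Fan.bar_facet (f : Fan V E n) {I : Finset V} (hI : I ∈ f.facets) (h : V → ℝ) :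
    f.bar I h = f.vtx I h :=
  f.vtx_unique hI fun i hi => by linarith [f.slack_zero ⟨I, hI, Subset.rfl⟩ h hi]

/-- One step of the subdivision. -/
lemma Fan.step (f : Fan V E n) {h : V → ℝ} (hh : f.T0 h) {τ : Finset V} (hτ : f.IsFace τ)
    (hc : τ.card < n) {x : E} (hx : x ∈ f.P h) (hxτ : ∀ i ∈ τ, inner ℝ (f.u i) x = h i) :
    ∃ y ∈ f.P h, ∃ j ∉ τ, (∀ i ∈ insert j τ, inner ℝ (f.u i) y = h i) ∧ ∃ m : ℝ, 0 ≤ m ∧ m ≤ 1 ∧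
      x = (1 - m) • f.bar τ h + m • y := by
  classical
  have hVne : (univ.filter fun j => j ∉ τ).Nonempty := by
    obtain ⟨I, hI, hs⟩ := hτ
    have : τ ⊂ I := hs.ssubset_of_ne (by rintro rfl; have := f.card_eq _ hI; omega)
    obtain ⟨j, -, hj⟩ := exists_of_ssubset this
    exact ⟨j, by simp [hj]⟩
  set b := f.bar τ h with hb
  have hbτ : ∀ i ∈ τ, inner ℝ (f.u i) b = h i := fun i hi => by linarith [f.slack_zero hτ h hi]
  have hbp : ∀ i, i ∉ τ → 0 < h i - inner ℝ (f.u i) b := fun i hi => f.slack_pos hτ hh hi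
  obtain ⟨j, hj, hmax⟩ := exists_max_image (univ.filter fun j => j ∉ τ)
    (fun j => (inner ℝ (f.u j) x - inner ℝ (f.u j) b) / (h j - inner ℝ (f.u j) b)) hVne
  simp only [mem_filter, mem_univ, true_and] at hj hmax
  set m := (inner ℝ (f.u j) x - inner ℝ (f.u j) b) / (h j - inner ℝ (f.u j) b) with hm
  have hle : ∀ i, i ∉ τ → inner ℝ (f.u i) x - inner ℝ (f.u i) b ≤ m * (h i - inner ℝ (f.u i) b) := by
    intro i hi
    have := hmax i hi
    rwa [div_le_iff₀ (hbp i hi)] at this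
  have hm1 : m ≤ 1 := by
    rw [hm, div_le_one (hbp j hj)]
    linarith [hx j]
  rcases le_or_gt m 0 with hm0 | hm0
  · -- x = b
    have hrec : ∀ i, inner ℝ (f.u i) (x - b) ≤ 0 := by
      intro i
      rw [inner_sub_right]
      by_cases hi : i ∈ τ
      · rw [hxτ i hi, hbτ i hi, sub_self]
      · have := hle i hi
        have := hbp i hi
        nlinarith
    have hxb : x = b := by
      obtain ⟨I0, hI0⟩ := f.nonempty
      obtain ⟨I, hI, -, -, c, hcw, hc0⟩ := f.simplex hh hI0 (empty_subset _) (x - b) (fun _ => True) trivial (by simp)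
      have : inner ℝ (x - b) (x - b) ≤ 0 := by
        nth_rewrite 1 [hcw]
        rw [sum_inner]
        refine sum_nonpos fun i hi => ?_
        rw [real_inner_smul_left]
        exact mul_nonpos_of_nonneg_of_nonpos (hc0 i hi (by simp)) (hrec i)
      exact sub_eq_zero.mp (inner_self_eq_zero (𝕜 := ℝ).mp (le_antisymm this real_inner_self_nonneg))
    obtain ⟨I, hI, hs⟩ := hτ
    have : τ ⊂ I := hs.ssubset_of_ne (by rintro rfl; have := f.card_eq _ hI; omega)
    obtain ⟨j', hj'I, hj'⟩ := exists_of_ssubset this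
    refine ⟨f.vtx I h, f.vtx_mem hh.T hI, j', hj', ?_, 0, le_rfl, zero_le_one, by simp [hxb]⟩
    intro i hi
    exact f.vtx_eq I hI i (insert_subset hj'I hs hi) h
  · have hy : ∀ i, inner ℝ (f.u i) (b + m⁻¹ • (x - b)) = inner ℝ (f.u i) b + (inner ℝ (f.u i) x - inner ℝ (f.u i) b) / m := by
      intro i
      rw [inner_add_right, inner_smul_right, inner_sub_right]; ring
    refine ⟨b + m⁻¹ • (x - b), ?_, j, hj, ?_, m, hm0.le, hm1, ?_⟩
    · intro i
      rw [hy]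
      by_cases hi : i ∈ τ
      · rw [hxτ i hi, hbτ i hi]; simp
      · have : (inner ℝ (f.u i) x - inner ℝ (f.u i) b) / m ≤ h i - inner ℝ (f.u i) b := by
          rw [div_le_iff₀ hm0]; linarith [hle i hi]
        linarith
    · intro i hi
      rw [hy]
      rcases mem_insert.mp hi with rfl | hi
      · have : (inner ℝ (f.u i) x - inner ℝ (f.u i) b) = m * (h i - inner ℝ (f.u i) b) := by
          rw [hm, div_mul_cancel₀ _ (hbp i hj).ne']
        rw [this]; field_simp; ring
      · rw [hxτ i hi, hbτ i hi]; simp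
    · rw [smul_add, smul_smul, mul_inv_cancel₀ hm0.ne', one_smul, sub_smul, one_smul]
      abel

end Fenchel


namespace Fenchel
open Finset

variable {V : Type} [Fintype V] [DecidableEq V] {E : Type} [NormedAddCommGroup E]
    [InnerProductSpace ℝ E] {n : ℕ}

/-- Initial segment of a flag. -/
def pre (e : Fin n → V) (m : ℕ) : Finset V := (univ.filter fun j : Fin n => (j : ℕ) < m).image e

lemma mem_pre {e : Fin n → V} {m : ℕ} {v : V} : v ∈ pre e m ↔ ∃ j : Fin n, (j : ℕ) < m ∧ e j = v := by
  simp [pre]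

lemma pre_congr {e e' : Fin n → V} {m : ℕ} (h : ∀ j : Fin n, (j : ℕ) < m → e j = e' j) :
    pre e m = pre e' m := by
  ext v
  simp only [mem_pre]
  constructor
  · rintro ⟨j, hj, rfl⟩; exact ⟨j, hj, (h j hj).symm⟩
  · rintro ⟨j, hj, rfl⟩; exact ⟨j, hj, h j hj⟩

lemma pre_succ (e : Fin n → V) {m : ℕ} (hm : m < n) : pre e (m + 1) = insert (e ⟨m, hm⟩) (pre e m) := by
  ext v
  simp only [mem_pre, mem_insert]
  constructor
  · rintro ⟨j, hj, rfl⟩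
    rcases Nat.lt_succ_iff_lt_or_eq.mp hj with h | h
    · exact Or.inr ⟨j, h, rfl⟩
    · left; congr 1; exact Fin.ext h
  · rintro (rfl | ⟨j, hj, rfl⟩)
    · exact ⟨⟨m, hm⟩, by simp, rfl⟩
    · exact ⟨j, by omega, rfl⟩

lemma pre_n (e : Fin n → V) : pre e n = univ.image e := by
  ext v; simp [mem_pre]

lemma pre_mono (e : Fin n → V) {m m' : ℕ} (h : m ≤ m') : pre e m ⊆ pre e m' := by
  intro v hv
  obtain ⟨j, hj, rfl⟩ := mem_pre.mp hv
  exact mem_pre.mpr ⟨j, by omega, rfl⟩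

lemma card_pre {e : Fin n → V} {m : ℕ} (hm : m ≤ n)
    (h : Set.InjOn e {j : Fin n | (j : ℕ) < m}) : (pre e m).card = m := by
  rw [pre, card_image_of_injOn (by intro a ha b hb; simp at ha hb; exact h ha hb)]
  have : (univ.filter fun j : Fin n => (j : ℕ) < m).card = m := by
    rw [Fin.card_filter_val_lt]; omega
  exact this

def Fan.IsFlag (f : Fan V E n) (e : Fin n → V) : Prop := Function.Injective e ∧ univ.image e ∈ f.facets

lemma Fan.IsFlag.face {f : Fan V E n} {e : Fin n → V} (he : f.IsFlag e) (m : ℕ) : f.IsFace (pre e m) :=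
  ⟨_, he.2, by intro v hv; obtain ⟨j, -, rfl⟩ := mem_pre.mp hv; simp⟩

lemma Fan.cover [CompleteSpace E] (f : Fan V E n) {h : V → ℝ} (hh : f.T0 h) : ∀ (d m : ℕ), m + d = n →
    ∀ e : Fin n → V, Set.InjOn e {j : Fin n | (j : ℕ) < m} → ∀ x ∈ f.P h,
    (∀ j : Fin n, (j : ℕ) < m → inner ℝ (f.u (e j)) x = h (e j)) →
    ∃ e' : Fin n → V, f.IsFlag e' ∧ (∀ j : Fin n, (j : ℕ) < m → e' j = e j) ∧
      ∃ l : Fin (n + 1) → ℝ, (∀ j, 0 ≤ l j) ∧ ∑ j, l j = 1 ∧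
        x = ∑ j, l j • f.bar (pre e' j) h := by
  intro d
  induction d with
  | zero =>
    intro m hm e hinj x hx hact
    have hmn : m = n := by omega
    subst hmn
    have hinj' : Function.Injective e := fun a b hab => hinj a.2 b.2 hab
    have hact' : ∀ i ∈ univ.image e, inner ℝ (f.u i) x = h i := by
      intro i hi
      obtain ⟨j, -, rfl⟩ := mem_image.mp hi
      exact hact j j.2
    obtain ⟨I, hI, hs⟩ := f.active_face hh hx _ hact'
    have hEq : univ.image e = I := eq_of_subset_of_card_le hs (by
      rw [f.card_eq I hI, card_image_of_injective _ hinj']; simp)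
    refine ⟨e, ⟨hinj', hEq ▸ hI⟩, fun _ _ => rfl, Pi.single (Fin.last m) 1, ?_, ?_, ?_⟩
    · intro j
      by_cases hj : j = Fin.last m
      · subst hj; simp
      · simp [hj]
    · simp
    · rw [Fintype.sum_eq_single (Fin.last m)]
      · simp only [Pi.single_eq_same, one_smul, Fin.val_last]
        rw [pre_n, hEq, f.bar_facet hI]
        exact f.vtx_unique hI (by rw [← hEq]; exact hact')
      · intro j hj; simp [hj]
  | succ d ih =>
    intro m hm e hinj x hx hact
    have hmn : m < n := by omega
    have hact' : ∀ i ∈ pre e m, inner ℝ (f.u i) x = h i := by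
      intro i hi
      obtain ⟨j, hj, rfl⟩ := mem_pre.mp hi
      exact hact j hj
    have hface := f.active_face hh hx _ hact'
    obtain ⟨y, hy, j, hj, hyact, μ, hμ0, hμ1, hxy⟩ := f.step hh hface (by rw [card_pre hmn.le hinj]; exact hmn) hx hact'
    have hval : ∀ i : Fin n, (i : ℕ) < m → Function.update e ⟨m, hmn⟩ j i = e i := by
      intro i hi
      rw [Function.update_of_ne]
      rintro rfl; simp at hi
    have hpre : pre (Function.update e ⟨m, hmn⟩ j) m = pre e m := pre_congr hval
    have hpre1 : pre (Function.update e ⟨m, hmn⟩ j) (m + 1) = insert j (pre e m) := by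
      rw [pre_succ _ hmn, hpre]; simp
    obtain ⟨e', he', hag, l, hl0, hl1, hly⟩ := ih (m + 1) (by omega) (Function.update e ⟨m, hmn⟩ j)
      (by
        have hne : ∀ a : Fin n, (a : ℕ) < m → j ≠ e a := by
          rintro a ha rfl; exact hj (mem_pre.mpr ⟨a, ha, rfl⟩)
        have hcase : ∀ a : Fin n, (a : ℕ) < m + 1 → (a : ℕ) < m ∨ a = ⟨m, hmn⟩ := by
          intro a ha
          rcases Nat.lt_succ_iff_lt_or_eq.mp ha with h | h
          · exact Or.inl h
          · exact Or.inr (Fin.ext h)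
        intro a ha b hb hab
        rcases hcase a ha with ha' | ha' <;> rcases hcase b hb with hb' | hb'
        · rw [hval a ha', hval b hb'] at hab; exact hinj ha' hb' hab
        · rw [hval a ha', hb', Function.update_self] at hab; exact absurd hab.symm (hne a ha')
        · rw [hval b hb', ha', Function.update_self] at hab; exact absurd hab (hne b hb')
        · rw [ha', hb']) y hy
      (by
        intro i hi
        refine hyact _ ?_
        rw [← hpre1]
        exact mem_pre.mpr ⟨i, hi, rfl⟩)
    have hag' : ∀ i : Fin n, (i : ℕ) < m → e' i = e i := fun i hi => by
      rw [hag i (by omega), hval i hi]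
    refine ⟨e', he', hag', (1 - μ) • Pi.single (⟨m, by omega⟩ : Fin (n + 1)) 1 + μ • l, ?_, ?_, ?_⟩
    · intro i
      have h1 : (0 : ℝ) ≤ (Pi.single (⟨m, by omega⟩ : Fin (n + 1)) (1 : ℝ) : Fin (n + 1) → ℝ) i := by
        rw [Pi.single_apply]; positivity
      have h2 := hl0 i
      have h3 : 0 ≤ 1 - μ := by linarith
      simp only [Pi.add_apply, Pi.smul_apply, smul_eq_mul]
      positivity
    · simp only [Pi.add_apply, Pi.smul_apply, smul_eq_mul, sum_add_distrib, ← mul_sum, hl1]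
      simp
    · have h1 : ∑ i, (Pi.single (⟨m, by omega⟩ : Fin (n + 1)) (1 : ℝ) : Fin (n + 1) → ℝ) i • f.bar (pre e' i) h
          = f.bar (pre e m) h := by
        rw [Fintype.sum_eq_single (⟨m, by omega⟩ : Fin (n + 1))]
        · simp [pre_congr hag']
        · intro i hi; simp [hi]
      simp only [Pi.add_apply, Pi.smul_apply, smul_eq_mul, add_smul, sum_add_distrib, mul_smul, ← smul_sum]
      rw [h1, ← hly, hxy]

/-- Slack functional of the `i`-th inequality at the barycentre of `τ`. -/
noncomputable def Fan.sl (f : Fan V E n) (i : V) (τ : Finset V) : (V → ℝ) →ₗ[ℝ] ℝ :=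
  LinearMap.proj i - (innerₛₗ ℝ (f.u i)).comp (f.bar τ)

lemma Fan.sl_apply (f : Fan V E n) (i : V) (τ : Finset V) (h : V → ℝ) :
    f.sl i τ h = h i - inner ℝ (f.u i) (f.bar τ h) := by
  simp [Fan.sl]

lemma Fan.disjoint (f : Fan V E n) {h : V → ℝ} (hh : f.T0 h) {e e' : Fin n → V} (he : f.IsFlag e) (he' : f.IsFlag e') :
    ∀ (d m : ℕ), m + d = n → (∀ j : Fin n, (j : ℕ) < m → e j = e' j) →
    ∀ l l' : Fin (n + 1) → ℝ, (∀ j : Fin (n + 1), (j : ℕ) < m → l j = 0) → (∀ j : Fin (n + 1), (j : ℕ) < m → l' j = 0) →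
    (∀ j : Fin (n + 1), m ≤ (j : ℕ) → 0 < l j) → (∀ j : Fin (n + 1), m ≤ (j : ℕ) → 0 < l' j) →
    (∀ i, ∑ j, l j * f.sl i (pre e j) h = ∑ j, l' j * f.sl i (pre e' j) h) → e = e' := by
  intro d
  induction d with
  | zero =>
    intro m hm hag l l' _ _ _ _ _
    funext j
    exact hag j (by omega)
  | succ d ih =>
    intro m hm hag l l' hl0 hl0' hlp hlp' hsum
    have hmn : m < n := by omega
    -- one-sided computation
    have one : ∀ (e e' : Fin n → V), f.IsFlag e → f.IsFlag e' → (∀ j : Fin n, (j : ℕ) < m → e j = e' j) →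
        ∀ l l' : Fin (n + 1) → ℝ, (∀ j : Fin (n + 1), (j : ℕ) < m → l j = 0) → (∀ j : Fin (n + 1), (j : ℕ) < m → l' j = 0) →
        (∀ j : Fin (n + 1), m ≤ (j : ℕ) → 0 < l j) → (∀ j : Fin (n + 1), m ≤ (j : ℕ) → 0 < l' j) →
        (∀ i, ∑ j, l j * f.sl i (pre e j) h = ∑ j, l' j * f.sl i (pre e' j) h) →
        (l' ⟨m, by omega⟩ ≤ l ⟨m, by omega⟩) ∧ (l' ⟨m, by omega⟩ = l ⟨m, by omega⟩ → e ⟨m, hmn⟩ = e' ⟨m, hmn⟩) := by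
      intro e e' he he' hag l l' hl0 hl0' hlp hlp' hsum
      have hnot : e ⟨m, hmn⟩ ∉ pre e m := by
        intro hmem
        obtain ⟨j, hj, hjj⟩ := mem_pre.mp hmem
        have := he.1 hjj
        rw [this] at hj; simp at hj
      have hs := hsum (e ⟨m, hmn⟩)
      have hpos := f.slack_pos (he.face m) hh hnot
      rw [← Fan.sl_apply] at hpos
      have h1 : ∑ j, l j * f.sl (e ⟨m, hmn⟩) (pre e j) h = l ⟨m, by omega⟩ * f.sl (e ⟨m, hmn⟩) (pre e m) h := by
        rw [Fintype.sum_eq_single (⟨m, by omega⟩ : Fin (n + 1))]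
        intro j hj
        rcases lt_or_ge (j : ℕ) m with hjm | hjm
        · rw [hl0 j hjm, zero_mul]
        · have : m < (j : ℕ) := lt_of_le_of_ne hjm (fun h => hj (Fin.ext h.symm))
          have hz := f.slack_zero (he.face j) h (mem_pre.mpr ⟨⟨m, hmn⟩, this, rfl⟩)
          rw [Fan.sl_apply, hz, mul_zero]
      have hnn : ∀ j : Fin (n + 1), 0 ≤ l' j * f.sl (e ⟨m, hmn⟩) (pre e' j) h := by
        intro j
        have h1 : 0 ≤ l' j := by
          rcases lt_or_ge (j : ℕ) m with hjm | hjm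
          · rw [hl0' j hjm]
          · exact (hlp' j hjm).le
        have h2 := f.bar_mem (he'.face j) hh (e ⟨m, hmn⟩)
        rw [Fan.sl_apply]
        exact mul_nonneg h1 (by linarith)
      have hmm : pre e' m = pre e m := pre_congr fun j hj => (hag j hj).symm
      have h2 : ∑ j, l' j * f.sl (e ⟨m, hmn⟩) (pre e' j) h = l' ⟨m, by omega⟩ * f.sl (e ⟨m, hmn⟩) (pre e m) h
          + ∑ j ∈ univ.erase ⟨m, by omega⟩, l' j * f.sl (e ⟨m, hmn⟩) (pre e' j) h := by
        rw [← add_sum_erase _ _ (mem_univ (⟨m, by omega⟩ : Fin (n + 1)))]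
        simp only [hmm]
      rw [h1, h2] at hs
      have h3 : 0 ≤ ∑ j ∈ univ.erase ⟨m, by omega⟩, l' j * f.sl (e ⟨m, hmn⟩) (pre e' j) h :=
        sum_nonneg fun j _ => hnn j
      refine ⟨?_, ?_⟩
      · by_contra hcon
        push Not at hcon
        nlinarith
      · intro heq
        rw [heq] at hs
        have h4 : ∑ j ∈ univ.erase ⟨m, by omega⟩, l' j * f.sl (e ⟨m, hmn⟩) (pre e' j) h = 0 := by linarith
        have h5 := (sum_eq_zero_iff_of_nonneg fun j _ => hnn j).mp h4 (⟨m + 1, by omega⟩ : Fin (n + 1))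
          (by simp [Fin.ext_iff])
        have h6 := hlp' (⟨m + 1, by omega⟩ : Fin (n + 1)) (by simp)
        have h7 : f.sl (e ⟨m, hmn⟩) (pre e' (m + 1)) h = 0 := by
          rcases mul_eq_zero.mp h5 with h | h
          · exact absurd h h6.ne'
          · exact h
        by_contra hne
        have : e ⟨m, hmn⟩ ∉ pre e' (m + 1) := by
          rw [pre_succ _ hmn, mem_insert, hmm]
          rintro (h | h)
          · exact hne h
          · exact hnot h
        have := f.slack_pos (he'.face (m + 1)) hh this
        rw [← Fan.sl_apply] at this
        linarith
    obtain ⟨a1, a2⟩ := one e e' he he' hag l l' hl0 hl0' hlp hlp' hsum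
    obtain ⟨b1, -⟩ := one e' e he' he (fun j hj => (hag j hj).symm) l' l hl0' hl0 hlp' hlp (fun i => (hsum i).symm)
    have heq := le_antisymm a1 b1
    have hem := a2 heq
    have hcase : ∀ a : ℕ, a < m + 1 → a < m ∨ a = m := fun a ha => by omega
    refine ih (m + 1) (by omega) ?_ (Function.update l ⟨m, by omega⟩ 0) (Function.update l' ⟨m, by omega⟩ 0) ?_ ?_ ?_ ?_ ?_
    · intro j hj
      rcases hcase j hj with h | h
      · exact hag j h
      · have : j = ⟨m, hmn⟩ := Fin.ext h
        rw [this, hem]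
    · intro j hj
      rcases hcase j hj with h | h
      · rw [Function.update_of_ne (by intro h'; rw [h'] at h; simp at h), hl0 j h]
      · have : j = ⟨m, by omega⟩ := Fin.ext h
        rw [this, Function.update_self]
    · intro j hj
      rcases hcase j hj with h | h
      · rw [Function.update_of_ne (by intro h'; rw [h'] at h; simp at h), hl0' j h]
      · have : j = ⟨m, by omega⟩ := Fin.ext h
        rw [this, Function.update_self]
    · intro j hj
      rw [Function.update_of_ne (by intro h'; rw [h'] at hj; simp at hj)]
      exact hlp j (by omega)
    · intro j hj
      rw [Function.update_of_ne (by intro h'; rw [h'] at hj; simp at hj)]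
      exact hlp' j (by omega)
    · intro i
      have hu : ∀ (l : Fin (n + 1) → ℝ) (e : Fin n → V), ∑ j, Function.update l ⟨m, by omega⟩ 0 j * f.sl i (pre e j) h
          = ∑ j, l j * f.sl i (pre e j) h - l ⟨m, by omega⟩ * f.sl i (pre e m) h := by
        intro l e
        rw [← add_sum_erase _ _ (mem_univ (⟨m, by omega⟩ : Fin (n + 1))),
          ← add_sum_erase univ (fun j => l j * f.sl i (pre e j) h) (mem_univ (⟨m, by omega⟩ : Fin (n + 1)))]
        simp only [Function.update_self, zero_mul, zero_add, add_sub_cancel_left]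
        refine sum_congr rfl fun j hj => ?_
        rw [Function.update_of_ne (ne_of_mem_erase hj)]
      rw [hu, hu, hsum, heq, pre_congr hag]

end Fenchel


namespace Fenchel
open Finset

variable {V : Type} [Fintype V] [DecidableEq V] {n : ℕ}

lemma hyperplane_null {E : Type} [NormedAddCommGroup E] [InnerProductSpace ℝ E] [FiniteDimensional ℝ E]
    [MeasurableSpace E] [BorelSpace E] (μ : Measure E) [μ.IsAddHaarMeasure] {w : E} (hw : w ≠ 0) (c : ℝ) :
    μ {x | inner ℝ w x = c} = 0 := by
  by_cases hne : ∃ x0, inner ℝ w x0 = c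
  · obtain ⟨x0, hx0⟩ := hne
    have h1 : {x | inner ℝ w x = c} = (fun x => x + -x0) ⁻¹' ((ℝ ∙ w)ᗮ : Submodule ℝ E) := by
      ext x
      simp only [Set.mem_ofPred_eq, Set.mem_preimage, SetLike.mem_coe, Submodule.mem_orthogonal_singleton_iff_inner_right]
      rw [← sub_eq_add_neg, inner_sub_right, hx0, sub_eq_zero]
    rw [h1, measure_preimage_add_right]
    refine Measure.addHaar_submodule μ _ ?_
    intro htop
    have : w ∈ ((ℝ ∙ w)ᗮ : Submodule ℝ E) := by rw [htop]; trivial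
    rw [Submodule.mem_orthogonal_singleton_iff_inner_right] at this
    exact hw (inner_self_eq_zero.mp this)
  · have : {x | inner ℝ w x = c} = ∅ := by
      ext x; simp only [Set.mem_ofPred_eq, Set.mem_empty_iff_false, iff_false]; exact fun h => hne ⟨x, h⟩
    rw [this]; simp

/-- Standard simplex. -/
def Dl (n : ℕ) : Set (EuclideanSpace ℝ (Fin n)) := {x | (∀ i, 0 ≤ x i) ∧ ∑ i, x i ≤ 1}
def Dlo (n : ℕ) : Set (EuclideanSpace ℝ (Fin n)) := {x | (∀ i, 0 < x i) ∧ ∑ i, x i < 1}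

lemma Dl_diff (hn : 0 < n) : volume (Dl n \ Dlo n) = 0 := by
  have h1 : Dl n \ Dlo n ⊆ (⋃ i : Fin n, {x | inner ℝ (EuclideanSpace.single i (1:ℝ)) x = 0}) ∪
      {x | inner ℝ (WithLp.toLp 2 (fun _ => 1) : EuclideanSpace ℝ (Fin n)) x = 1} := by
    rintro x ⟨⟨h0, h1⟩, h2⟩
    simp only [Dlo, Set.mem_ofPred_eq, not_and_or, not_forall, not_lt] at h2
    rcases h2 with ⟨i, hi⟩ | h2
    · left
      simp only [Set.mem_iUnion]
      refine ⟨i, ?_⟩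
      have h3 : x i = 0 := le_antisymm hi (h0 i)
      rw [Set.mem_ofPred_eq, EuclideanSpace.inner_single_left, h3]; simp
    · right
      simp [PiLp.inner_apply]
      exact le_antisymm h1 h2
  refine measure_mono_null h1 (measure_union_null (measure_iUnion_null fun i => hyperplane_null _ ?_ _) (hyperplane_null _ ?_ _))
  · simp
  · intro h
    have := congrArg (fun x : EuclideanSpace ℝ (Fin n) => x ⟨0, hn⟩) h
    simp at this

lemma Dl_closed : IsClosed (Dl n) := by
  have : Dl n = (⋂ i, {x | 0 ≤ x i}) ∩ {x | ∑ i, x i ≤ 1} := by ext x; simp [Dl]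
  rw [this]
  refine (isClosed_iInter fun i => isClosed_le continuous_const (by fun_prop)).inter (isClosed_le (by fun_prop) continuous_const)

lemma Dl_compact : IsCompact (Dl n) := by
  refine Metric.isCompact_of_isClosed_isBounded Dl_closed ?_
  refine (Metric.isBounded_iff_subset_closedBall 0).mpr ⟨Real.sqrt n, ?_⟩
  rintro x ⟨h0, h1⟩
  rw [mem_closedBall_zero_iff, EuclideanSpace.norm_eq]
  apply Real.sqrt_le_sqrt
  calc ∑ i, ‖x i‖ ^ 2 ≤ ∑ i : Fin n, (1 : ℝ) := by
        refine sum_le_sum fun i _ => ?_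
        have : x i ≤ 1 := le_trans (single_le_sum (f := fun i => x i) (fun i _ => h0 i) (mem_univ i)) h1
        rw [Real.norm_eq_abs, sq_abs]
        nlinarith [h0 i]
    _ = n := by simp

abbrev EE (n : ℕ) := EuclideanSpace ℝ (Fin n)

noncomputable def Fan.A (f : Fan V (EE n) n) (e : Fin n → V) (h : V → ℝ) : EE n →ₗ[ℝ] EE n :=
  ∑ m : Fin n, (EuclideanSpace.proj m : EE n →L[ℝ] ℝ).toLinearMap.smulRight (f.bar (pre e m) h - f.bar (pre e n) h)

lemma Fan.A_apply (f : Fan V (EE n) n) (e : Fin n → V) (h : V → ℝ) (x : EE n) :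
    f.A e h x = ∑ m : Fin n, x m • (f.bar (pre e m) h - f.bar (pre e n) h) := by
  simp [Fan.A]

noncomputable def Fan.U (f : Fan V (EE n) n) (e : Fin n → V) : EE n →ₗ[ℝ] EE n :=
  (WithLp.linearEquiv 2 ℝ (Fin n → ℝ)).symm.toLinearMap ∘ₗ LinearMap.pi fun m => (innerₛₗ ℝ (f.u (e m)))

lemma Fan.U_apply (f : Fan V (EE n) n) (e : Fin n → V) (x : EE n) (m : Fin n) :
    f.U e x m = inner ℝ (f.u (e m)) x := by
  simp [Fan.U]

lemma Fan.U_det (f : Fan V (EE n) n) {e : Fin n → V} (he : f.IsFlag e) : LinearMap.det (f.U e) ≠ 0 := by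
  have hinj : LinearMap.ker (f.U e) = ⊥ := by
    rw [LinearMap.ker_eq_bot']
    intro x hx
    have h1 : x = f.vtx (univ.image e) 0 := by
      apply f.vtx_unique he.2
      intro i hi
      obtain ⟨m, -, rfl⟩ := mem_image.mp hi
      rw [← f.U_apply, hx]; simp
    rw [h1, map_zero]
  intro h0
  have := LinearMap.bot_lt_ker_of_det_eq_zero h0
  rw [hinj] at this
  exact lt_irrefl _ this

lemma Fan.detA (f : Fan V (EE n) n) {e : Fin n → V} (he : f.IsFlag e) {h : V → ℝ} (hh : f.T0 h) :
    |LinearMap.det (f.A e h)| = |LinearMap.det (f.U e)|⁻¹ * ∏ m : Fin n, f.sl (e m) (pre e m) h := by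
  have key : LinearMap.det (f.U e ∘ₗ f.A e h) = ∏ m : Fin n, (- f.sl (e m) (pre e m) h) := by
    rw [← LinearMap.det_toMatrix (EuclideanSpace.basisFun (Fin n) ℝ).toBasis]
    have hent : ∀ i j, LinearMap.toMatrix (EuclideanSpace.basisFun (Fin n) ℝ).toBasis (EuclideanSpace.basisFun (Fin n) ℝ).toBasis
        (f.U e ∘ₗ f.A e h) i j = - f.sl (e i) (pre e j) h := by
      intro i j
      rw [LinearMap.toMatrix_apply]
      have h1 : f.A e h (EuclideanSpace.single j 1) = f.bar (pre e j) h - f.bar (pre e n) h := by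
        rw [f.A_apply, sum_eq_single j]
        · simp
        · intro b _ hb; simp [hb]
        · simp
      have h0 := f.slack_zero (he.face n) h (j := e i) (mem_pre.mpr ⟨i, i.2, rfl⟩)
      simp only [OrthonormalBasis.coe_toBasis, EuclideanSpace.basisFun_apply, LinearMap.comp_apply, h1, OrthonormalBasis.coe_toBasis_repr_apply,
        EuclideanSpace.basisFun_repr]
      rw [f.U_apply, inner_sub_right, f.sl_apply]
      linarith
    rw [Matrix.det_of_lowerTriangular]
    · exact prod_congr rfl fun m _ => hent m m
    · intro i j hij
      rw [hent, f.sl_apply, f.slack_zero (he.face j) h, neg_zero]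
      exact mem_pre.mpr ⟨i, by simpa using hij, rfl⟩
  rw [LinearMap.det_comp] at key
  have h2 := congrArg abs key
  rw [abs_mul, Finset.abs_prod] at h2
  rw [eq_inv_mul_iff_mul_eq₀ (abs_ne_zero.mpr (f.U_det he)), h2]
  refine prod_congr rfl fun m _ => ?_
  rw [abs_neg, abs_of_pos]
  rw [f.sl_apply]
  refine f.slack_pos (he.face m) hh ?_
  rw [mem_pre]
  rintro ⟨j, hj, hje⟩
  rw [he.1 hje] at hj
  exact lt_irrefl _ hj

/-- Image of a simplex. -/
def Fan.simplexImg (f : Fan V (EE n) n) (e : Fin n → V) (h : V → ℝ) (D : Set (EE n)) : Set (EE n) :=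
  (fun x => f.bar (pre e n) h + x) '' (f.A e h '' D)

lemma Fan.vol_simp (f : Fan V (EE n) n) (e : Fin n → V) (h : V → ℝ) (D : Set (EE n)) :
    volume (f.simplexImg e h D) = ENNReal.ofReal |LinearMap.det (f.A e h)| * volume D := by
  rw [Fan.simplexImg, Set.image_add_left, measure_preimage_add, Measure.addHaar_image_linearMap]

/-- barycentric weights -/
def wt (x : EE n) : Fin (n + 1) → ℝ := Fin.snoc (α := fun _ => ℝ) (fun i => x i) (1 - ∑ i, x i)

lemma wt_sum (x : EE n) : ∑ j, wt x j = 1 := by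
  simp [wt, Fin.sum_univ_castSucc]

lemma Fan.simp_pt (f : Fan V (EE n) n) (e : Fin n → V) (h : V → ℝ) (x : EE n) :
    f.bar (pre e n) h + f.A e h x = ∑ j : Fin (n + 1), wt x j • f.bar (pre e j) h := by
  rw [Fin.sum_univ_castSucc, f.A_apply]
  simp only [wt, Fin.snoc_castSucc, Fin.snoc_last, Fin.val_castSucc, Fin.val_last, smul_sub, sum_sub_distrib, sub_smul, one_smul, ← sum_smul]
  abel

lemma Fan.sl_comb (f : Fan V (EE n) n) (e : Fin n → V) (h : V → ℝ) (x : EE n) (i : V) :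
    ∑ j, wt x j * f.sl i (pre e j) h = h i - inner ℝ (f.u i) (f.bar (pre e n) h + f.A e h x) := by
  rw [f.simp_pt, inner_sum]
  simp only [f.sl_apply, mul_sub, sum_sub_distrib, ← sum_mul, wt_sum, one_mul, inner_smul_right]

lemma wt_pos {x : EE n} (hx : x ∈ Dlo n) (j : Fin (n + 1)) : 0 < wt x j := by
  refine Fin.lastCases ?_ (fun i => ?_) j
  · simp only [wt, Fin.snoc_last]; linarith [hx.2]
  · simp only [wt, Fin.snoc_castSucc]; exact hx.1 i

lemma wt_nonneg {x : EE n} (hx : x ∈ Dl n) (j : Fin (n + 1)) : 0 ≤ wt x j := by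
  refine Fin.lastCases ?_ (fun i => ?_) j
  · simp only [wt, Fin.snoc_last]; linarith [hx.2]
  · simp only [wt, Fin.snoc_castSucc]; exact hx.1 i

open Classical in
noncomputable def Fan.flags (f : Fan V (EE n) n) : Finset (Fin n → V) := univ.filter fun e => f.IsFlag e

lemma Fan.mem_flags {f : Fan V (EE n) n} {e : Fin n → V} : e ∈ f.flags ↔ f.IsFlag e := by
  simp [Fan.flags]

lemma Fan.P_eq (f : Fan V (EE n) n) {h : V → ℝ} (hh : f.T0 h) :
    f.P h = ⋃ e ∈ f.flags, f.simplexImg e h (Dl n) := by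
  apply Set.Subset.antisymm
  · intro x hx
    have hVne : Nonempty (Fin n → V) := by
      obtain ⟨I, hI⟩ := f.nonempty
      have := f.card_eq I hI
      exact ⟨fun j => (I.equivFin.symm ⟨j, by rw [this]; exact j.2⟩ : I)⟩
    obtain ⟨e, he, -, l, hl0, hl1, hx'⟩ := f.cover hh n 0 (by simp) hVne.some (by intro a ha; simp at ha) x hx (by intro j hj; simp at hj)
    simp only [Set.mem_iUnion]
    refine ⟨e, Fan.mem_flags.mpr he, ?_⟩
    have hs : ∑ i : Fin n, l i.castSucc + l (Fin.last n) = 1 := by rw [← Fin.sum_univ_castSucc, hl1]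
    refine ⟨_, ⟨WithLp.toLp 2 fun i => l i.castSucc, ⟨fun i => hl0 _, ?_⟩, rfl⟩, ?_⟩
    · simp only; linarith [hl0 (Fin.last n)]
    · simp only
      rw [f.simp_pt, hx']
      refine sum_congr rfl fun j _ => ?_
      congr 1
      refine Fin.lastCases ?_ (fun i => ?_) j
      · simp only [wt, Fin.snoc_last]; linarith
      · simp only [wt, Fin.snoc_castSucc]
  · refine Set.iUnion₂_subset fun e he => ?_
    rintro _ ⟨_, ⟨x, hx, rfl⟩, rfl⟩
    simp only
    rw [f.simp_pt]
    exact (f.convex_P h).sum_mem (fun j _ => wt_nonneg hx j) (wt_sum x) fun j _ => f.bar_mem ((Fan.mem_flags.mp he).face j) hh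

lemma Fan.vol_P (f : Fan V (EE n) n) (hn : 0 < n) {h : V → ℝ} (hh : f.T0 h) :
    (volume (f.P h)).toReal = ∑ e ∈ f.flags, ((volume (Dl n)).toReal * |LinearMap.det (f.U e)|⁻¹) *
      ∏ m : Fin n, f.sl (e m) (pre e m) h := by
  have hcomp : ∀ e, IsCompact (f.simplexImg e h (Dl n)) := fun e => by
    refine (Dl_compact.image ?_).image (by fun_prop)
    exact LinearMap.continuous_of_finiteDimensional _
  have hnull : ∀ e, volume (f.simplexImg e h (Dl n) \ f.simplexImg e h (Dlo n)) = 0 := fun e => by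
    refine measure_mono_null (t := f.simplexImg e h (Dl n \ Dlo n)) ?_ ?_
    · rintro _ ⟨⟨_, ⟨x, hx, rfl⟩, rfl⟩, hno⟩
      exact ⟨_, ⟨x, ⟨hx, fun hx' => hno ⟨_, ⟨x, hx', rfl⟩, rfl⟩⟩, rfl⟩, rfl⟩
    · rw [f.vol_simp, Dl_diff hn, mul_zero]
  rw [f.P_eq hh, measure_biUnion_finset₀, ENNReal.toReal_sum]
  · refine sum_congr rfl fun e he => ?_
    rw [f.vol_simp, ENNReal.toReal_mul, ENNReal.toReal_ofReal (abs_nonneg _), f.detA (Fan.mem_flags.mp he) hh]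
    ring
  · exact fun e _ => (hcomp e).measure_lt_top.ne
  · intro e he e' he' hne
    refine measure_mono_null ?_ (measure_union_null (hnull e) (hnull e'))
    rintro y ⟨hy, hy'⟩
    by_contra hcon
    simp only [Set.mem_union, Set.mem_diff, not_or, not_and, not_not] at hcon
    obtain ⟨_, ⟨x, hx, rfl⟩, hxy⟩ := hcon.1 hy
    obtain ⟨_, ⟨x', hx', rfl⟩, hxy'⟩ := hcon.2 hy'
    simp only at hxy hxy'
    refine hne (f.disjoint hh (Fan.mem_flags.mp he) (Fan.mem_flags.mp he') n 0 (by simp) (by intro j hj; simp at hj) (wt x) (wt x')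
      (by intro j hj; simp at hj) (by intro j hj; simp at hj) (fun j _ => wt_pos hx j) (fun j _ => wt_pos hx' j) ?_)
    intro i
    rw [f.sl_comb, f.sl_comb, hxy, hxy']
  · exact fun e _ => (hcomp e).measurableSet.nullMeasurableSet

/-- The volume polynomial. -/
noncomputable def Fan.vp (f : Fan V (EE n) n) : MvPolynomial V ℝ :=
  ∑ e ∈ f.flags, MvPolynomial.C ((volume (Dl n)).toReal * |LinearMap.det (f.U e)|⁻¹) *
    ∏ m : Fin n, ∑ i, MvPolynomial.C (f.sl (e m) (pre e m) (Pi.single i 1)) * MvPolynomial.X i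

lemma Fan.eval_vp (f : Fan V (EE n) n) (h : V → ℝ) :
    MvPolynomial.eval h f.vp = ∑ e ∈ f.flags, ((volume (Dl n)).toReal * |LinearMap.det (f.U e)|⁻¹) *
      ∏ m : Fin n, f.sl (e m) (pre e m) h := by
  simp only [Fan.vp, map_sum, map_mul, map_prod, MvPolynomial.eval_C, MvPolynomial.eval_X]
  refine sum_congr rfl fun e _ => ?_
  congr 1
  refine prod_congr rfl fun m _ => ?_
  conv_rhs => rw [LinearMap.pi_apply_eq_sum_univ (f.sl (e m) (pre e m)) h]
  refine sum_congr rfl fun i _ => ?_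
  rw [smul_eq_mul, mul_comm]
  congr 2
  ext j
  simp [Pi.single_apply, eq_comm]

lemma Fan.eval_vp_vol (f : Fan V (EE n) n) (hn : 0 < n) {h : V → ℝ} (hh : f.T0 h) :
    MvPolynomial.eval h f.vp = (volume (f.P h)).toReal := by
  rw [f.eval_vp, f.vol_P hn hh]

lemma hom_aux (c : ℝ) (a : Fin n → V → ℝ) :
    (MvPolynomial.C c * ∏ m : Fin n, ∑ i, MvPolynomial.C (a m i) * (MvPolynomial.X i : MvPolynomial V ℝ)).IsHomogeneous n := by
  have h1 : (∏ m : Fin n, ∑ i, MvPolynomial.C (a m i) * (MvPolynomial.X i : MvPolynomial V ℝ)).IsHomogeneous (∑ m : Fin n, 1) := by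
    refine MvPolynomial.IsHomogeneous.prod _ _ _ fun m _ => MvPolynomial.IsHomogeneous.sum _ _ _ fun i _ => ?_
    exact MvPolynomial.isHomogeneous_C_mul_X _ _
  have h2 := (MvPolynomial.isHomogeneous_C V c).mul h1
  have h3 : 0 + ∑ m : Fin n, 1 = n := by simp
  rwa [h3] at h2

lemma Fan.vp_hom (f : Fan V (EE n) n) : f.vp.IsHomogeneous n :=
  MvPolynomial.IsHomogeneous.sum _ _ _ fun e _ => hom_aux _ _

lemma Fan.bar_ell (f : Fan V (EE n) n) {τ : Finset V} (hτ : f.IsFace τ) (x : EE n) : f.bar τ (f.ell x) = x := by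
  have hne : (f.facets.filter fun I => τ ⊆ I).Nonempty := by
    obtain ⟨I, hI, hs⟩ := hτ
    exact ⟨I, by simp [hI, hs]⟩
  have hcard : (0 : ℝ) < (f.facets.filter fun I => τ ⊆ I).card := by exact_mod_cast hne.card_pos
  rw [Fan.bar, LinearMap.smul_apply, LinearMap.sum_apply, sum_congr rfl (g := fun _ => x)]
  · rw [sum_const, ← Nat.cast_smul_eq_nsmul ℝ, smul_smul, inv_mul_cancel₀ hcard.ne', one_smul]
  · intro I hI
    rw [mem_filter] at hI
    exact (f.vtx_unique hI.1 fun i _ => rfl).symm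

lemma Fan.eval_vp_ell (f : Fan V (EE n) n) (h : V → ℝ) (x : EE n) :
    MvPolynomial.eval (h + f.ell x) f.vp = MvPolynomial.eval h f.vp := by
  rw [f.eval_vp, f.eval_vp]
  refine sum_congr rfl fun e he => ?_
  congr 1
  refine prod_congr rfl fun m _ => ?_
  rw [map_add, f.sl_apply _ _ (f.ell x), f.bar_ell ((Fan.mem_flags.mp he).face m)]
  simp [Fan.ell]

end Fenchel


namespace Fenchel
open Finset

variable {V : Type} [Fintype V] [DecidableEq V]

/-- Directional derivative of a polynomial. -/
noncomputable def DD (v : V → ℝ) (G : MvPolynomial V ℝ) : MvPolynomial V ℝ := ∑ i, v i • MvPolynomial.pderiv i G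

noncomputable def DL : List (V → ℝ) → MvPolynomial V ℝ → MvPolynomial V ℝ
  | [], G => G
  | v :: l, G => DL l (DD v G)

/-- Iterated differences. -/
def dif : List (V → ℝ) → ((V → ℝ) → ℝ) → (V → ℝ) → ℝ
  | [], g, h => g h
  | v :: l, g, h => dif l g (h + v) - dif l g h

noncomputable def Lam (G : MvPolynomial V ℝ) : MvPolynomial V ℝ →ₗ[ℝ] ℝ :=
  (MvPolynomial.basisMonomials V ℝ).constr ℝ fun α => (∏ i, ((α i).factorial : ℝ)) * MvPolynomial.coeff α G

lemma Lam_monomial (G : MvPolynomial V ℝ) (α : V →₀ ℕ) :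
    Lam G (MvPolynomial.monomial α 1) = (∏ i, ((α i).factorial : ℝ)) * MvPolynomial.coeff α G := by
  have := (MvPolynomial.basisMonomials V ℝ).constr_basis ℝ (fun α => (∏ i, ((α i).factorial : ℝ)) * MvPolynomial.coeff α G) α
  simpa [Lam] using this

lemma Lam_one (G : MvPolynomial V ℝ) : Lam G 1 = MvPolynomial.coeff 0 G := by
  have := Lam_monomial G 0
  simpa using this

lemma Lam_ext {Λ Λ' : MvPolynomial V ℝ →ₗ[ℝ] ℝ}
    (h : ∀ α, Λ (MvPolynomial.monomial α 1) = Λ' (MvPolynomial.monomial α 1)) (p : MvPolynomial V ℝ) : Λ p = Λ' p := by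
  have : Λ = Λ' := (MvPolynomial.basisMonomials V ℝ).ext fun α => by simpa using h α
  rw [this]

lemma Lam_zero (p : MvPolynomial V ℝ) : Lam 0 p = 0 := by
  refine Lam_ext (Λ' := 0) (fun α => ?_) p
  rw [Lam_monomial]; simp

lemma Lam_add (G G' p : MvPolynomial V ℝ) : Lam (G + G') p = Lam G p + Lam G' p := by
  refine Lam_ext (Λ' := Lam G + Lam G') (fun α => ?_) p
  rw [LinearMap.add_apply, Lam_monomial, Lam_monomial, Lam_monomial]; simp [mul_add]

lemma Lam_smul (c : ℝ) (G p : MvPolynomial V ℝ) : Lam (c • G) p = c * Lam G p := by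
  refine Lam_ext (Λ' := c • Lam G) (fun α => ?_) p
  rw [LinearMap.smul_apply, Lam_monomial, Lam_monomial]; simp; ring

lemma Lam_sum {ι : Type*} (s : Finset ι) (G : ι → MvPolynomial V ℝ) (p : MvPolynomial V ℝ) :
    Lam (∑ i ∈ s, G i) p = ∑ i ∈ s, Lam (G i) p := by
  classical
  induction s using Finset.induction_on with
  | empty => simp [Lam_zero]
  | insert a s ha ih => rw [sum_insert ha, sum_insert ha, Lam_add, ih]

lemma Lam_X (G : MvPolynomial V ℝ) (i : V) (p : MvPolynomial V ℝ) :
    Lam G (MvPolynomial.X i * p) = Lam (MvPolynomial.pderiv i G) p := by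
  refine Lam_ext (Λ := Lam G ∘ₗ LinearMap.mulLeft ℝ (MvPolynomial.X i)) (fun α => ?_) p
  rw [LinearMap.comp_apply, LinearMap.mulLeft_apply, MvPolynomial.X, MvPolynomial.monomial_mul, one_mul, Lam_monomial, Lam_monomial,
    MvPolynomial.coeff_pderiv, add_comm (Finsupp.single i 1) α, ← mul_prod_erase univ _ (mem_univ i),
    ← mul_prod_erase univ (fun j => ((α j).factorial : ℝ)) (mem_univ i)]
  have : ∏ x ∈ univ.erase i, (((α + Finsupp.single i 1 : V →₀ ℕ) x).factorial : ℝ) = ∏ x ∈ univ.erase i, ((α x).factorial : ℝ) := by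
    refine prod_congr rfl fun x hx => ?_
    rw [Finsupp.add_apply, Finsupp.single_eq_of_ne (ne_of_mem_erase hx), add_zero]
  rw [this]
  simp [Nat.factorial_succ]
  ring

lemma Lam_LL (G : MvPolynomial V ℝ) (v : V → ℝ) (p : MvPolynomial V ℝ) :
    Lam G (LL MvPolynomial.X v * p) = Lam (DD v G) p := by
  rw [LL, DD, Lam_sum, sum_mul, map_sum]
  refine sum_congr rfl fun i _ => ?_
  rw [smul_mul_assoc, map_smul, Lam_X, Lam_smul, smul_eq_mul]

lemma Lam_list (l : List (V → ℝ)) : ∀ (G p : MvPolynomial V ℝ),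
    Lam G ((l.map (LL MvPolynomial.X)).prod * p) = Lam (DL l G) p := by
  induction l with
  | nil => intro G p; simp [DL]
  | cons v l ih => intro G p; rw [List.map_cons, List.prod_cons, mul_assoc, Lam_LL, ih, DL]

lemma DD_hom {G : MvPolynomial V ℝ} {m : ℕ} (hG : G.IsHomogeneous (m + 1)) (v : V → ℝ) : (DD v G).IsHomogeneous m := by
  refine MvPolynomial.IsHomogeneous.sum _ _ _ fun i _ => ?_
  rw [MvPolynomial.smul_eq_C_mul]
  have h1 := (MvPolynomial.isHomogeneous_C V (v i)).mul (hG.pderiv (i := i))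
  simpa using h1

lemma DL_hom (l : List (V → ℝ)) : ∀ {G : MvPolynomial V ℝ}, G.IsHomogeneous l.length → (DL l G).IsHomogeneous 0 := by
  induction l with
  | nil => intro G hG; exact hG
  | cons v l ih => intro G hG; exact ih (DD_hom hG v)

lemma DL_const {l : List (V → ℝ)} {G : MvPolynomial V ℝ} (hG : G.IsHomogeneous l.length) (h : V → ℝ) :
    MvPolynomial.eval h (DL l G) = Lam G (l.map (LL MvPolynomial.X)).prod := by
  have h1 := DL_hom l hG
  rw [← MvPolynomial.totalDegree_zero_iff_isHomogeneous, MvPolynomial.totalDegree_eq_zero_iff_eq_C] at h1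
  rw [← mul_one (List.prod _), Lam_list, Lam_one, h1]
  simp

lemma hasDerivAt_eval (G : MvPolynomial V ℝ) (h v : V → ℝ) (t : ℝ) :
    HasDerivAt (fun t : ℝ => MvPolynomial.eval (h + t • v) G) (MvPolynomial.eval (h + t • v) (DD v G)) t := by
  induction G using MvPolynomial.induction_on with
  | C a => simpa [DD] using hasDerivAt_const t a
  | add p q hp hq =>
    have : DD v (p + q) = DD v p + DD v q := by simp [DD, sum_add_distrib]
    rw [this]
    simp only [map_add]
    exact hp.add hq
  | mul_X p i hp =>
    have h1 : HasDerivAt (fun t : ℝ => MvPolynomial.eval (h + t • v) (MvPolynomial.X i)) (v i) t := by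
      simpa using ((hasDerivAt_id t).mul_const (v i)).const_add (h i)
    have h2 : DD v (p * MvPolynomial.X i) = DD v p * MvPolynomial.X i + p * MvPolynomial.C (v i) := by
      have h3 : ∀ j, v j • MvPolynomial.pderiv j (p * MvPolynomial.X i) = (v j • MvPolynomial.pderiv j p) * MvPolynomial.X i
          + (if j = i then p * MvPolynomial.C (v i) else 0) := by
        intro j
        rw [MvPolynomial.pderiv_mul, MvPolynomial.pderiv_X, smul_add, smul_mul_assoc]
        congr 1
        split_ifs with hji
        · subst hji
          simp [MvPolynomial.smul_eq_C_mul]; ring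
        · simp [Pi.single_apply, Ne.symm hji]
      simp only [DD, h3, sum_add_distrib, sum_mul, sum_ite_eq', mem_univ, if_true]
    rw [h2]
    have := hp.mul h1
    simp only [map_mul, map_add, MvPolynomial.eval_C]
    exact this

lemma hasDerivAt_dif (l : List (V → ℝ)) : ∀ (G : MvPolynomial V ℝ) (h v : V → ℝ) (t : ℝ),
    HasDerivAt (fun t : ℝ => dif l (fun h => MvPolynomial.eval h G) (h + t • v))
      (dif l (fun h => MvPolynomial.eval h (DD v G)) (h + t • v)) t := by
  induction l with
  | nil => intro G h v t; exact hasDerivAt_eval G h v t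
  | cons w l ih =>
    intro G h v t
    simp only [dif]
    have h1 := ih G (h + w) v t
    have h2 := ih G h v t
    have := h1.sub h2
    have e : ∀ t : ℝ, h + t • v + w = h + w + t • v := fun t => by abel
    simp only [e]
    exact this

lemma dif_mvt (l : List (V → ℝ)) : ∀ (G : MvPolynomial V ℝ) (h : V → ℝ),
    ∃ h', ‖h' - h‖ ≤ (l.map fun v => ‖v‖).sum ∧
      dif l (fun h => MvPolynomial.eval h G) h = MvPolynomial.eval h' (DL l G) := by
  induction l with
  | nil => intro G h; exact ⟨h, by simp, rfl⟩
  | cons v l ih =>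
    intro G h
    obtain ⟨c, hc, hc'⟩ := exists_hasDerivAt_eq_slope (fun t : ℝ => dif l (fun h => MvPolynomial.eval h G) (h + t • v)) _
      (zero_lt_one) (fun t _ => (hasDerivAt_dif l G h v t).continuousAt.continuousWithinAt) (fun t _ => hasDerivAt_dif l G h v t)
    obtain ⟨h', hh', he⟩ := ih (DD v G) (h + c • v)
    refine ⟨h', ?_, ?_⟩
    · have : h' - h = (h' - (h + c • v)) + c • v := by abel
      rw [this, List.map_cons, List.sum_cons]
      refine (norm_add_le _ _).trans ?_
      rw [add_comm]
      refine add_le_add ?_ hh'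
      rw [norm_smul, Real.norm_eq_abs, abs_of_pos hc.1]
      exact mul_le_of_le_one_left (norm_nonneg _) hc.2.le
    · rw [DL, ← he, hc']
      simp [dif]

lemma dif_const {l : List (V → ℝ)} {G : MvPolynomial V ℝ} (hG : G.IsHomogeneous l.length) (h : V → ℝ) :
    dif l (fun h => MvPolynomial.eval h G) h = Lam G (l.map (LL MvPolynomial.X)).prod := by
  obtain ⟨h', -, he⟩ := dif_mvt l G h
  rw [he, DL_const hG]

lemma dif_sum {ι : Type*} [DecidableEq ι] (v : ι → V → ℝ) (g : (V → ℝ) → ℝ) : ∀ (l : List ι) (_ : l.Nodup) (h : V → ℝ),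
    dif (l.map v) g h = ∑ S ∈ l.toFinset.powerset, (-1 : ℝ) ^ (l.length + S.card) * g (h + ∑ i ∈ S, v i) := by
  intro l
  induction l with
  | nil => intro _ h; simp [dif]
  | cons a l ih =>
    intro hl h
    rw [List.nodup_cons] at hl
    have ha : a ∉ l.toFinset := by simpa using hl.1
    rw [List.map_cons, dif, ih hl.2, ih hl.2, List.toFinset_cons, sum_powerset_insert ha]
    have e1 : ∑ S ∈ l.toFinset.powerset, (-1 : ℝ) ^ ((a :: l).length + S.card) * g (h + ∑ i ∈ S, v i) =
        - ∑ S ∈ l.toFinset.powerset, (-1 : ℝ) ^ (l.length + S.card) * g (h + ∑ i ∈ S, v i) := by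
      rw [← sum_neg_distrib]
      refine sum_congr rfl fun S hS => ?_
      rw [List.length_cons]; ring
    have e2 : ∑ S ∈ l.toFinset.powerset, (-1 : ℝ) ^ ((a :: l).length + (insert a S).card) * g (h + ∑ i ∈ insert a S, v i) =
        ∑ S ∈ l.toFinset.powerset, (-1 : ℝ) ^ (l.length + S.card) * g (h + v a + ∑ i ∈ S, v i) := by
      refine sum_congr rfl fun S hS => ?_
      have haS : a ∉ S := fun h => ha (mem_powerset.mp hS h)
      rw [card_insert_of_notMem haS, List.length_cons, sum_insert haS, add_assoc h (v a)]
      ring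
    rw [e1, e2]; ring

lemma altsum {n : ℕ} {G : MvPolynomial V ℝ} (hG : G.IsHomogeneous n) (v : Fin n → V → ℝ) :
    ∑ S : Finset (Fin n), (-1 : ℝ) ^ (n + S.card) * MvPolynomial.eval (∑ i ∈ S, v i) G =
      Lam G (((List.finRange n).map fun i => LL MvPolynomial.X (v i)).prod) := by
  have h1 := dif_sum v (fun h => MvPolynomial.eval h G) (List.finRange n) (List.nodup_finRange n) 0
  rw [dif_const (by simpa using hG)] at h1
  simp only [List.map_map, zero_add, List.length_finRange, List.toFinset_finRange, powerset_univ] at h1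
  rw [← h1]
  rfl

lemma DL_smul (l : List (V → ℝ)) : ∀ (c : ℝ) (G : MvPolynomial V ℝ), DL l (c • G) = c • DL l G := by
  induction l with
  | nil => intro c G; rfl
  | cons v l ih =>
    intro c G
    have : DD v (c • G) = c • DD v G := by
      simp only [DD, smul_sum]
      refine sum_congr rfl fun i _ => ?_
      rw [Derivation.map_smul, smul_comm]
    rw [DL, DL, this, ih]

lemma DL_map_smul (c : ℝ) (l : List (V → ℝ)) : ∀ (G : MvPolynomial V ℝ),
    DL (l.map fun v => c • v) G = c ^ l.length • DL l G := by
  induction l with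
  | nil => intro G; simp [DL]
  | cons v l ih =>
    intro G
    have : DD (c • v) G = c • DD v G := by
      simp only [DD, smul_sum, Pi.smul_apply, smul_assoc]
    rw [List.map_cons, DL, DL, this, ih, DL_smul, smul_smul, List.length_cons, pow_succ]

/-- If the iterated differences are eventually `c * t ^ k`, the derivative is `c`. -/
lemma DL_of_dif (l : List (V → ℝ)) (G : MvPolynomial V ℝ) (h : V → ℝ) (c : ℝ)
    (hd : ∀ᶠ t : ℝ in nhdsWithin 0 (Set.Ioi 0), dif (l.map fun v => (-t) • v) (fun h => MvPolynomial.eval h G) h = (-t) ^ l.length * c) :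
    MvPolynomial.eval h (DL l G) = c := by
  choose h' hn he using fun t : ℝ => dif_mvt (l.map fun v => (-t) • v) G h
  have hlim : Filter.Tendsto h' (nhdsWithin 0 (Set.Ioi 0)) (nhds h) := by
    rw [tendsto_iff_norm_sub_tendsto_zero]
    have hb : Filter.Tendsto (fun t : ℝ => |t| * (l.map fun v => ‖v‖).sum) (nhdsWithin 0 (Set.Ioi 0)) (nhds 0) := by
      have : Continuous fun t : ℝ => |t| * (l.map fun v => ‖v‖).sum := by fun_prop
      have h2 := this.tendsto 0
      simp only [abs_zero, zero_mul] at h2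
      exact h2.mono_left nhdsWithin_le_nhds
    refine squeeze_zero (fun t => norm_nonneg _) (fun t => ?_) hb
    refine (hn t).trans (le_of_eq ?_)
    rw [List.map_map, ← List.sum_map_mul_left]
    congr 1
    refine List.map_congr_left fun v _ => ?_
    simp [norm_smul]
  have hc : Continuous fun h : V → ℝ => MvPolynomial.eval h (DL l G) := MvPolynomial.continuous_eval _
  have h1 := (hc.tendsto h).comp hlim
  refine tendsto_nhds_unique h1 (tendsto_const_nhds.congr' ?_)
  filter_upwards [hd, self_mem_nhdsWithin] with t ht ht0
  rw [he t, DL_map_smul, MvPolynomial.smul_eval] at ht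
  have : (-t) ^ l.length ≠ 0 := pow_ne_zero _ (neg_ne_zero.mpr (ne_of_gt ht0))
  exact (mul_left_cancel₀ this ht).symm

end Fenchel


namespace Fenchel
open Finset

variable {V : Type} [Fintype V] [DecidableEq V] {n : ℕ}

lemma Fan.T0_open (f : Fan V (EE n) n) : IsOpen {h | f.T0 h} := by
  have : {h | f.T0 h} = ⋂ I ∈ f.facets, ⋂ j : V, {h | j ∉ I → inner ℝ (f.u j) (f.vtx I h) < h j} := by
    ext h; simp [Fan.T0]
  rw [this]
  refine isOpen_biInter_finset fun I _ => isOpen_iInter_of_finite fun j => ?_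
  by_cases hj : j ∈ I
  · simp [hj]
  · simp only [hj, not_false_eq_true, true_imp_iff]
    have hc : Continuous (f.vtx I) := LinearMap.continuous_of_finiteDimensional _
    exact isOpen_lt (by fun_prop) (by fun_prop)

lemma Fan.T0_near (f : Fan V (EE n) n) {h : V → ℝ} (hh : f.T0 h) : ∃ ε > 0, ∀ h', ‖h' - h‖ < ε → f.T0 h' := by
  obtain ⟨ε, hε, hb⟩ := Metric.isOpen_iff.mp f.T0_open h hh
  exact ⟨ε, hε, fun h' hd => hb (by rwa [mem_ball_iff_norm])⟩

lemma Fan.poly_eq (f : Fan V (EE n) n) {k : V → ℝ} (hk : f.T0 k) {G G' : MvPolynomial V ℝ}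
    (hG : ∀ h, f.T0 h → MvPolynomial.eval h G = MvPolynomial.eval h G') : G = G' := by
  obtain ⟨ε, hε, hb⟩ := f.T0_near hk
  refine MvPolynomial.funext_set (fun i => Set.Ioo (k i - ε) (k i + ε)) (fun i => Set.Ioo_infinite (by linarith)) fun x hx => ?_
  refine hG x (hb x ?_)
  rw [pi_norm_lt_iff hε]
  intro i
  have := hx i (Set.mem_univ i)
  rw [Pi.sub_apply, Real.norm_eq_abs, abs_lt]
  constructor <;> linarith [this.1, this.2]

lemma dif_congr {g g' : (V → ℝ) → ℝ} : ∀ (l : List (V → ℝ)) (h : V → ℝ),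
    (∀ h', ‖h' - h‖ ≤ (l.map fun v => ‖v‖).sum → g h' = g' h') → dif l g h = dif l g' h := by
  intro l
  induction l with
  | nil => intro h hg; exact hg h (by simp)
  | cons v l ih =>
    intro h hg
    rw [dif, dif, ih (h + v), ih h]
    · intro h' hh'
      refine hg h' ?_
      rw [List.map_cons, List.sum_cons]; linarith [norm_nonneg v]
    · intro h' hh'
      refine hg h' ?_
      rw [List.map_cons, List.sum_cons]
      have : h' - h = v + (h' - (h + v)) := by abel
      rw [this]
      exact (norm_add_le _ _).trans (by linarith)

def Fan.W (f : Fan V (EE n) n) (l : List V) (h : V → ℝ) (t : ℝ) : Set (EE n) :=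
  {x | x ∈ f.P h ∧ ∀ i ∈ l, h i - t < inner ℝ (f.u i) x}

lemma Fan.W_meas (f : Fan V (EE n) n) (l : List V) (h : V → ℝ) (t : ℝ) : MeasurableSet (f.W l h t) := by
  have : f.W l h t = (⋂ j, {x | inner ℝ (f.u j) x ≤ h j}) ∩ ⋂ i, {x | i ∈ l → h i - t < inner ℝ (f.u i) x} := by
    ext x; simp [Fan.W, Fan.P]
  rw [this]
  refine (MeasurableSet.iInter fun j => (isClosed_le (by fun_prop) (by fun_prop)).measurableSet).inter (MeasurableSet.iInter fun i => ?_)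
  by_cases hi : i ∈ l
  · simp only [hi, true_imp_iff]
    exact (isOpen_lt (by fun_prop) (by fun_prop)).measurableSet
  · simp [hi]

lemma Fan.W_fin (f : Fan V (EE n) n) {k : V → ℝ} (hk : f.T0 k) (l : List V) (h : V → ℝ) (t : ℝ) : volume (f.W l h t) ≠ ⊤ :=
  ne_top_of_le_ne_top (f.isCompact_P hk h).measure_lt_top.ne (measure_mono fun _ hx => hx.1)

lemma Fan.dif_slab (f : Fan V (EE n) n) {k : V → ℝ} (hk : f.T0 k) {t : ℝ} (ht : 0 < t) : ∀ (l : List V), l.Nodup → ∀ h : V → ℝ,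
    dif (l.map fun i => (-t) • (Pi.single i 1 : V → ℝ)) (fun h => (volume (f.P h)).toReal) h = (-1) ^ l.length * (volume (f.W l h t)).toReal := by
  intro l
  induction l with
  | nil => intro _ h; simp [dif, Fan.W]
  | cons a l ih =>
    intro hl h
    rw [List.nodup_cons] at hl
    rw [List.map_cons, dif, ih hl.2, ih hl.2]
    set h' := h + (-t) • (Pi.single a 1 : V → ℝ) with hh'
    have ha : h' a = h a - t := by simp [hh', sub_eq_add_neg]
    have hj : ∀ j, j ≠ a → h' j = h j := fun j hja => by simp [hh', hja]
    have hsub : f.W l h' t ⊆ f.W l h t := by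
      rintro x ⟨hx, hx2⟩
      refine ⟨fun j => ?_, fun i hi => ?_⟩
      · by_cases hja : j = a
        · subst hja; linarith [hx j]
        · linarith [hx j, hj j hja]
      · have : i ≠ a := by rintro rfl; exact hl.1 hi
        rw [← hj i this]; exact hx2 i hi
    have hdiff : f.W (a :: l) h t = f.W l h t \ f.W l h' t := by
      ext x
      simp only [Set.mem_sdiff]
      constructor
      · rintro ⟨hx, hx2⟩
        refine ⟨⟨hx, fun i hi => hx2 i (by simp [hi])⟩, fun hx' => ?_⟩
        have h1 := hx2 a (by simp)
        have h2 := hx'.1 a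
        linarith
      · rintro ⟨⟨hx, hx2⟩, hno⟩
        refine ⟨hx, fun i hi => ?_⟩
        rcases List.mem_cons.mp hi with rfl | hi
        · by_contra hcon
          push Not at hcon
          refine hno ⟨fun j => ?_, fun j hj' => ?_⟩
          · by_cases hja : j = i
            · subst hja; linarith
            · rw [hj j hja]; exact hx j
          · have : j ≠ i := by rintro rfl; exact hl.1 hj'
            rw [hj j this]; exact hx2 j hj'
        · exact hx2 i hi
    rw [hdiff, measure_sdiff hsub (f.W_meas _ _ _).nullMeasurableSet (f.W_fin hk _ _ _),
      ENNReal.toReal_sub_of_le (measure_mono hsub) (f.W_fin hk _ _ _), List.length_cons]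
    ring

lemma Fan.slab_DL (f : Fan V (EE n) n) (hn : 0 < n) {h : V → ℝ} (hh : f.T0 h) {l : List V} (hl : l.Nodup) {c : ℝ}
    (hW : ∀ᶠ t : ℝ in nhdsWithin 0 (Set.Ioi 0), (volume (f.W l h t)).toReal = t ^ l.length * c) :
    MvPolynomial.eval h (DL (l.map fun i => (Pi.single i 1 : V → ℝ)) f.vp) = c := by
  apply DL_of_dif
  obtain ⟨ε, hε, hb⟩ := f.T0_near hh
  have hsm : ∀ᶠ t : ℝ in nhdsWithin 0 (Set.Ioi 0), t * l.length < ε := by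
    have hc : Continuous fun t : ℝ => t * l.length := by fun_prop
    have := hc.tendsto 0
    rw [zero_mul] at this
    exact (this.mono_left nhdsWithin_le_nhds).eventually_lt_const hε
  filter_upwards [hW, hsm, self_mem_nhdsWithin] with t ht hts ht0
  have ht0' : 0 < t := ht0
  rw [List.map_map]
  have e : ((fun v : V → ℝ => (-t) • v) ∘ fun i => (Pi.single i 1 : V → ℝ)) = fun i => (-t) • (Pi.single i 1 : V → ℝ) := rfl
  rw [e, dif_congr (g' := fun h => (volume (f.P h)).toReal), f.dif_slab hh ht0' l hl, ht, List.length_map]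
  · rw [← mul_assoc, ← mul_pow]; simp
  · intro h' hh'
    refine f.eval_vp_vol hn (hb h' (lt_of_le_of_lt hh' (lt_of_le_of_lt (le_of_eq ?_) hts)))
    rw [List.map_map]
    have e2 : ((fun v : V → ℝ => ‖v‖) ∘ fun i => (-t) • (Pi.single i 1 : V → ℝ)) = fun _ => t := by
      funext i
      simp [norm_smul, abs_of_pos ht0', Pi.norm_single]
    rw [e2]; simp [mul_comm]

lemma Fan.slab_nonface (f : Fan V (EE n) n) {h : V → ℝ} (hh : f.T0 h) {S : Finset V} (hS : ¬ f.IsFace S) :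
    ∀ᶠ t : ℝ in nhdsWithin 0 (Set.Ioi 0), f.W S.toList h t = ∅ := by
  obtain ⟨I, hI⟩ := f.nonempty
  have hne : (f.P h).Nonempty := ⟨_, f.vtx_mem hh.T hI⟩
  have hgc : Continuous fun x => ∑ i ∈ S, (h i - inner ℝ (f.u i) x) := by fun_prop
  obtain ⟨x0, hx0, hmin⟩ := (f.isCompact_P hh h).exists_isMinOn hne hgc.continuousOn
  have hpos : 0 < ∑ i ∈ S, (h i - inner ℝ (f.u i) x0) := by
    have hnn : ∀ i ∈ S, 0 ≤ h i - inner ℝ (f.u i) x0 := fun i _ => by linarith [hx0 i]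
    refine lt_of_le_of_ne (sum_nonneg hnn) fun h0 => hS ?_
    refine f.active_face hh hx0 S fun i hi => ?_
    have := (sum_eq_zero_iff_of_nonneg hnn).mp h0.symm i hi
    linarith
  have hsm : ∀ᶠ t : ℝ in nhdsWithin 0 (Set.Ioi 0), S.card * t < ∑ i ∈ S, (h i - inner ℝ (f.u i) x0) := by
    have hc : Continuous fun t : ℝ => S.card * t := by fun_prop
    have := hc.tendsto 0
    rw [mul_zero] at this
    exact (this.mono_left nhdsWithin_le_nhds).eventually_lt_const hpos
  filter_upwards [hsm] with t ht
  rw [Set.eq_empty_iff_forall_notMem]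
  rintro x ⟨hx, hx2⟩
  have h1 := hmin hx
  simp only [Set.mem_ofPred_eq] at h1
  have h2 : ∑ i ∈ S, (h i - inner ℝ (f.u i) x) ≤ ∑ i ∈ S, t :=
    sum_le_sum fun i hi => by linarith [hx2 i (by simpa using hi)]
  rw [sum_const, nsmul_eq_mul] at h2
  linarith

lemma vol_box (a : Fin n → ℝ) {t : ℝ} (ht : 0 < t) :
    volume {y : EE n | ∀ m, a m - t < y m ∧ y m ≤ a m} = ENNReal.ofReal t ^ n := by
  have h1 : {y : EE n | ∀ m, a m - t < y m ∧ y m ≤ a m} = (WithLp.ofLp : EE n → Fin n → ℝ) ⁻¹' (Set.pi Set.univ fun m => Set.Ioc (a m - t) (a m)) := by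
    ext y; simp
  rw [h1, (PiLp.volume_preserving_ofLp (Fin n)).measure_preimage]
  · rw [volume_pi_pi]; simp
  · exact (MeasurableSet.univ_pi fun m => measurableSet_Ioc).nullMeasurableSet

lemma Fan.slab_facet (f : Fan V (EE n) n) {e : Fin n → V} (he : f.IsFlag e) {h : V → ℝ} (hh : f.T0 h) :
    ∀ᶠ t : ℝ in nhdsWithin 0 (Set.Ioi 0), (volume (f.W (univ.image e).toList h t)).toReal = t ^ n * |(LinearMap.det (f.U e))⁻¹| := by
  set I := univ.image e with hIdef
  choose c hc using fun j => f.span I he.2 (f.u j)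
  have hsm : ∀ᶠ t : ℝ in nhdsWithin 0 (Set.Ioi 0), ∀ j, j ∉ I → t * ∑ i ∈ I, |c j i| < h j - inner ℝ (f.u j) (f.vtx I h) := by
    rw [Filter.eventually_all]
    intro j
    by_cases hj : j ∈ I
    · simp [hj]
    · simp only [hj, not_false_eq_true, true_imp_iff]
      have hcc : Continuous fun t : ℝ => t * ∑ i ∈ I, |c j i| := by fun_prop
      have := hcc.tendsto 0
      rw [zero_mul] at this
      exact (this.mono_left nhdsWithin_le_nhds).eventually_lt_const (by linarith [hh I he.2 j hj])
  filter_upwards [hsm, self_mem_nhdsWithin] with t ht ht0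
  have ht0' : 0 < t := ht0
  have hW : f.W I.toList h t = f.U e ⁻¹' {y : EE n | ∀ m, h (e m) - t < y m ∧ y m ≤ h (e m)} := by
    ext x
    constructor
    · rintro ⟨hx, hx2⟩ m
      rw [f.U_apply]
      exact ⟨hx2 (e m) (by simp [hIdef]), hx (e m)⟩
    · intro hx
      have hx' : ∀ i ∈ I, h i - t < inner ℝ (f.u i) x ∧ inner ℝ (f.u i) x ≤ h i := by
        intro i hi
        obtain ⟨m, -, rfl⟩ := mem_image.mp hi
        have := hx m
        rwa [f.U_apply] at this
      refine ⟨fun j => ?_, fun i hi => (hx' i (by simpa using hi)).1⟩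
      by_cases hj : j ∈ I
      · exact (hx' j hj).2
      · have h1 := ht j hj
        have h2 : inner ℝ (f.u j) x - inner ℝ (f.u j) (f.vtx I h) ≤ t * ∑ i ∈ I, |c j i| := by
          rw [← inner_sub_right]
          nth_rewrite 1 [hc j]
          rw [sum_inner, mul_sum]
          refine sum_le_sum fun i hi => ?_
          rw [real_inner_smul_left, inner_sub_right, f.vtx_eq I he.2 i hi]
          have h3 := hx' i hi
          calc c j i * (inner ℝ (f.u i) x - h i) ≤ |c j i * (inner ℝ (f.u i) x - h i)| := le_abs_self _
            _ = |c j i| * |inner ℝ (f.u i) x - h i| := abs_mul _ _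
            _ ≤ |c j i| * t := by
                refine mul_le_mul_of_nonneg_left ?_ (abs_nonneg _)
                rw [abs_le]; constructor <;> linarith
            _ = t * |c j i| := mul_comm _ _
        linarith
  rw [hW, Measure.addHaar_preimage_linearMap _ (f.U_det he), vol_box _ ht0', ENNReal.toReal_mul, ENNReal.toReal_pow,
    ENNReal.toReal_ofReal ht0'.le, ENNReal.toReal_ofReal (abs_nonneg _)]
  ring

lemma LL_single (i : V) : LL (MvPolynomial.X : V → MvPolynomial V ℝ) (Pi.single i 1) = MvPolynomial.X i := by
  rw [LL, sum_eq_single i]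
  · simp
  · intro j _ hj; simp [hj]
  · simp

lemma prod_list (S : Finset V) : (∏ i ∈ S, (MvPolynomial.X i : MvPolynomial V ℝ)) =
    ((S.toList.map fun i => (Pi.single i 1 : V → ℝ)).map (LL MvPolynomial.X)).prod := by
  rw [List.map_map]
  have : (LL (MvPolynomial.X : V → MvPolynomial V ℝ) ∘ fun i => (Pi.single i 1 : V → ℝ)) = MvPolynomial.X := by
    funext i; exact LL_single i
  rw [this, prod_map_toList]

theorem Fan.volFun (f : Fan V (EE n) n) (hn : 0 < n) {k : V → ℝ} (hk : f.T0 k) : VolFun f MvPolynomial.X (Lam f.vp) where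
  trans x p := by
    rw [Lam_LL]
    have : DD (f.ell x) f.vp = 0 := by
      refine MvPolynomial.funext fun h => ?_
      have h1 := hasDerivAt_eval f.vp h (f.ell x) 0
      have h2 : (fun t : ℝ => MvPolynomial.eval (h + t • f.ell x) f.vp) = fun _ => MvPolynomial.eval h f.vp := by
        funext t
        have : t • f.ell x = f.ell (t • x) := by
          funext i; simp [Fan.ell, inner_smul_right]
        rw [this, f.eval_vp_ell]
      rw [h2] at h1
      have h3 := h1.unique (hasDerivAt_const 0 _)
      simpa using h3
    rw [this, Lam_zero]
  nonface S p hS := by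
    rw [prod_list, Lam_list]
    have h0 : DL (S.toList.map fun i => (Pi.single i 1 : V → ℝ)) f.vp = 0 := by
      refine f.poly_eq hk fun h hh => ?_
      rw [map_zero]
      refine f.slab_DL hn hh S.nodup_toList ?_
      filter_upwards [f.slab_nonface hh hS] with t ht
      rw [ht]; simp
    rw [h0, Lam_zero]
  pos I hI := by
    obtain ⟨e, he, heI⟩ : ∃ e : Fin n → V, f.IsFlag e ∧ univ.image e = I := by
      have hcard := f.card_eq I hI
      let e : Fin n → V := fun j => (I.equivFin.symm (Fin.cast hcard.symm j) : I)
      have hinj : Function.Injective e := fun a b hab => by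
        have := I.equivFin.symm.injective (Subtype.ext hab)
        simpa using this
      have him : univ.image e = I := by
        refine eq_of_subset_of_card_le ?_ ?_
        · intro v hv
          obtain ⟨j, -, rfl⟩ := mem_image.mp hv
          exact (I.equivFin.symm (Fin.cast hcard.symm j)).2
        · rw [card_image_of_injective _ hinj, hcard]; simp
      exact ⟨e, ⟨hinj, him ▸ hI⟩, him⟩
    have hlen : I.toList.length = n := by rw [length_toList, f.card_eq I hI]
    have h1 := f.slab_DL hn hk I.nodup_toList (c := |(LinearMap.det (f.U e))⁻¹|) (by
      have := f.slab_facet he hk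
      rw [heI] at this
      rw [hlen]; exact this)
    rw [DL_const (by rw [List.length_map, hlen]; exact f.vp_hom), ← prod_list] at h1
    rw [h1]
    exact abs_pos.mpr (inv_ne_zero (f.U_det he))

end Fenchel


namespace Fenchel
open Finset

variable {V : Type} [Fintype V] [DecidableEq V] {n : ℕ}

lemma Fan.mixedVolume_P (f : Fan V (EE n) n) (hn : 0 < n) (h : Fin n → V → ℝ) (hh : ∀ i, f.T0 (h i)) :
    mixedVolume (fun i => f.P (h i)) = ((n.factorial : ℝ))⁻¹ *
      Lam f.vp ((List.finRange n).map fun i => LL MvPolynomial.X (h i)).prod := by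
  rw [mixedVolume, ← altsum f.vp_hom]
  congr 1
  refine sum_congr rfl fun S _ => ?_
  congr 1
  rcases S.eq_empty_or_nonempty with rfl | hS
  · have : Nonempty (Fin n) := ⟨⟨0, hn⟩⟩
    have hN : Nontrivial (EE n) := inferInstance
    have h0 : volume (0 : Set (EE n)) = 0 := by
      rw [← Set.singleton_zero]
      exact measure_singleton _
    rw [sum_empty, sum_empty, h0, f.eval_vp, ENNReal.toReal_zero, sum_eq_zero]
    intro e _
    rw [prod_eq_zero (mem_univ ⟨0, hn⟩) (map_zero _), mul_zero]
  · rw [f.P_sum S hS h fun i _ => hh i, f.eval_vp_vol hn (Fan.T0.sum S hS h fun i _ => hh i)]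

/-- body family -/
def fam {n : ℕ} {α : Type*} (x y : α) (K : Fin (n - 2) → α) : Fin n → α := fun j =>
  if h : (j : ℕ) < 2 then (if (j : ℕ) = 0 then x else y) else K ⟨(j : ℕ) - 2, by have := j.isLt; omega⟩

lemma fam_comp {α β : Type*} (g : α → β) (x y : α) (K : Fin (n - 2) → α) :
    (fun j => g (fam x y K j)) = fam (g x) (g y) (fun l => g (K l)) := by
  funext j
  simp only [fam]
  split_ifs <;> rfl

lemma fam_forall {α : Type*} {p : α → Prop} {x y : α} {K : Fin (n - 2) → α} (hx : p x) (hy : p y) (hK : ∀ l, p (K l)) (j : Fin n) :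
    p (fam x y K j) := by
  simp only [fam]
  split_ifs
  · exact hx
  · exact hy
  · exact hK _

lemma fam_list {m : ℕ} {α β : Type*} (g : α → β) (x y : α) (K : Fin m → α) :
    (List.finRange (m + 2)).map (fun i => g (fam (n := m + 2) x y K i)) = g x :: g y :: (((List.finRange m).map K).map g) := by
  rw [List.finRange_succ, List.finRange_succ]
  simp only [List.map_cons, List.map_map]
  congr 1

theorem Fan.fenchel_P (f : Fan V (EE n) n) (hn : 2 ≤ n) {a b c : V → ℝ} {k : Fin (n - 2) → V → ℝ}
    (ha : f.T0 a) (hb : f.T0 b) (hc : f.T0 c) (hk : ∀ l, f.T0 (k l)) :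
    mixedVolume (fam (f.P a) (f.P a) fun l => f.P (k l)) * mixedVolume (fam (f.P b) (f.P c) fun l => f.P (k l)) ≤
      2 * mixedVolume (fam (f.P a) (f.P b) fun l => f.P (k l)) * mixedVolume (fam (f.P a) (f.P c) fun l => f.P (k l)) := by
  obtain ⟨m, rfl⟩ : ∃ m, n = m + 2 := ⟨n - 2, by omega⟩
  have key : ∀ x y, f.T0 x → f.T0 y → mixedVolume (fam (f.P x) (f.P y) fun l => f.P (k l)) =
      (((m + 2).factorial : ℝ))⁻¹ * Lam f.vp (LL MvPolynomial.X x * (LL MvPolynomial.X y * (((List.finRange m).map k).map (LL MvPolynomial.X)).prod)) := by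
    intro x y hx hy
    rw [← fam_comp, f.mixedVolume_P (by omega) _ (fam_forall hx hy hk), fam_list (LL MvPolynomial.X), List.prod_cons, List.prod_cons]
  rw [key a a ha ha, key b c hb hc, key a b ha hb, key a c ha hc]
  have h1 := (f.volFun (by omega) ha).fenchel ((List.finRange m).map k) (by
    intro x hx
    obtain ⟨l, -, rfl⟩ := List.mem_map.mp hx
    exact hk l) (by simp) a b c ha hb hc
  set r := (((m + 2).factorial : ℝ))⁻¹
  have hr : 0 ≤ r := by positivity
  nlinarith [mul_le_mul_of_nonneg_left h1 (mul_nonneg hr hr)]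

end Fenchel


namespace Fenchel
open Finset

variable {V : Type} [Fintype V] [DecidableEq V] {n : ℕ}

/-- Polyhedron. -/
def PH (u : V → EE n) (y : V → ℝ) : Set (EE n) := {x | ∀ j, inner ℝ (u j) x ≤ y j}

lemma PH_closed (u : V → EE n) (y : V → ℝ) : IsClosed (PH u y) := by
  have : PH u y = ⋂ j, {x | inner ℝ (u j) x ≤ y j} := by ext x; simp [PH]
  rw [this]
  exact isClosed_iInter fun j => isClosed_le (by fun_prop) (by fun_prop)

/-- generic perturbation -/
lemma generic (u : V → EE n) {ε : ℝ} (hε : 0 < ε) : ∃ y : V → ℝ, (∀ j, |y j - 1| < ε) ∧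
    ∀ (I : Finset V) (x : EE n), (∀ i ∈ I, inner ℝ (u i) x = y i) → LinearIndependent ℝ (fun i : I => u i) := by
  have hdep : ∀ I : Finset V, ∃ c : V → ℝ, ¬ LinearIndependent ℝ (fun i : I => u i) → (∃ i, c i ≠ 0) ∧ ∑ i, c i • u i = 0 ∧ ∀ i ∉ I, c i = 0 := by
    intro I
    by_cases hI : LinearIndependent ℝ (fun i : I => u i)
    · exact ⟨0, fun h => absurd hI h⟩
    · obtain ⟨g, hg, i, hi⟩ := Fintype.not_linearIndependent_iff.mp hI
      refine ⟨fun j => if h : j ∈ I then g ⟨j, h⟩ else 0, fun _ => ⟨⟨i, by simpa using hi⟩, ?_, fun j hj => by simp [hj]⟩⟩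
      rw [← hg, ← sum_subset (subset_univ I), ← sum_coe_sort I]
      · refine sum_congr rfl fun j _ => ?_
        simp
      · intro j _ hj; simp [hj]
  choose c hc using hdep
  let φ : Finset V → (V → ℝ) →ₗ[ℝ] ℝ := fun I => ∑ i, c I i • LinearMap.proj i
  have hφ : ∀ I y, φ I y = ∑ i, c I i * y i := fun I y => by simp [φ]
  let B : Finset (Finset V) := by classical exact univ.filter fun I => ¬ LinearIndependent ℝ (fun i : I => u i)
  have hnull : volume (⋃ I ∈ B, (LinearMap.ker (φ I) : Set (V → ℝ))) = 0 := by
    refine (measure_biUnion_null_iff (I := (B : Set (Finset V))) B.countable_toSet).mpr ?_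
    intro I hI
    have hI' : ¬ LinearIndependent ℝ (fun i : I => u i) := by simpa [B] using hI
    refine Measure.addHaar_submodule _ _ fun htop => ?_
    obtain ⟨⟨i, hi⟩, -, -⟩ := hc I hI'
    have h1 : (Pi.single i 1 : V → ℝ) ∈ LinearMap.ker (φ I) := by rw [htop]; trivial
    rw [LinearMap.mem_ker, hφ, sum_eq_single i] at h1
    · simp at h1; exact hi h1
    · intro j _ hj; simp [hj]
    · simp
  have hball : 0 < volume (Metric.ball (fun _ => 1 : V → ℝ) ε) := Metric.measure_ball_pos _ _ hε
  have hnot : ¬ (Metric.ball (fun _ => 1 : V → ℝ) ε ⊆ ⋃ I ∈ B, (LinearMap.ker (φ I) : Set (V → ℝ))) := fun hsub =>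
    absurd (measure_mono_null hsub hnull) hball.ne'
  obtain ⟨y, hy, hy2⟩ := Set.not_subset.mp hnot
  refine ⟨y, ?_, ?_⟩
  · rw [Metric.mem_ball, dist_pi_lt_iff hε] at hy
    exact fun j => by simpa [Real.dist_eq] using hy j
  · intro I x hx
    by_contra hI
    obtain ⟨-, h0, h1⟩ := hc I hI
    apply hy2
    simp only [Set.mem_iUnion]
    refine ⟨I, by simpa [B] using hI, ?_⟩
    rw [SetLike.mem_coe, LinearMap.mem_ker, hφ]
    have h2 : inner ℝ (∑ i, c I i • u i) x = 0 := by rw [h0, inner_zero_left]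
    rw [sum_inner] at h2
    rw [← h2]
    refine sum_congr rfl fun i _ => ?_
    rw [real_inner_smul_left]
    by_cases hi : i ∈ I
    · rw [hx i hi]
    · rw [h1 i hi]; simp

lemma close_active (u : V → EE n) (hP : IsCompact (PH u fun _ => 1)) : ∃ ε > 0, ε < 1 ∧ ∀ y : V → ℝ, (∀ j, |y j - 1| < ε) →
    (∀ x ∈ PH u y, (1 + ε)⁻¹ • x ∈ PH u fun _ => 1) ∧
    ∀ x ∈ PH u y, ∀ I : Finset V, (∀ i ∈ I, inner ℝ (u i) x = y i) → ∃ p ∈ PH u (fun _ => 1), ∀ i ∈ I, inner ℝ (u i) p = 1 := by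
  have hne : (PH u fun _ => 1).Nonempty := ⟨0, fun j => by simp⟩
  have hmin : ∀ I : Finset V, ∃ d > 0, (∃ p ∈ PH u (fun _ => 1), ∀ i ∈ I, inner ℝ (u i) p = 1) ∨
      ∀ p ∈ PH u (fun _ => 1), d ≤ ∑ i ∈ I, (1 - inner ℝ (u i) p) := by
    intro I
    have hgc : Continuous fun x => ∑ i ∈ I, (1 - inner ℝ (u i) x) := by fun_prop
    obtain ⟨p, hp, hmin⟩ := hP.exists_isMinOn hne hgc.continuousOn
    have hnn : ∀ i ∈ I, 0 ≤ 1 - inner ℝ (u i) p := fun i _ => by linarith [hp i]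
    rcases (sum_nonneg hnn).eq_or_lt with h0 | h0
    · refine ⟨1, one_pos, Or.inl ⟨p, hp, fun i hi => ?_⟩⟩
      have := (sum_eq_zero_iff_of_nonneg hnn).mp h0.symm i hi
      linarith
    · exact ⟨_, h0, Or.inr fun q hq => hmin hq⟩
  choose d hd hmin using hmin
  have hev : ∀ᶠ ε : ℝ in nhdsWithin 0 (Set.Ioi 0), ∀ I : Finset V, I.card * (2 * ε) < d I := by
    rw [Filter.eventually_all]
    intro I
    have hcc : Continuous fun t : ℝ => I.card * (2 * t) := by fun_prop
    have := hcc.tendsto 0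
    simp only [mul_zero] at this
    exact (this.mono_left nhdsWithin_le_nhds).eventually_lt_const (hd I)
  have hev1 : ∀ᶠ ε : ℝ in nhdsWithin 0 (Set.Ioi 0), ε < 1 :=
    (Filter.tendsto_id.mono_left nhdsWithin_le_nhds : Filter.Tendsto id (nhdsWithin (0:ℝ) (Set.Ioi 0)) (nhds 0)).eventually_lt_const one_pos
  obtain ⟨ε, hε, hε1, hε0⟩ := (hev.and (hev1.and self_mem_nhdsWithin)).exists
  have hε0' : 0 < ε := hε0
  refine ⟨ε, hε0', hε1, fun y hy => ?_⟩
  have h1e : 0 < 1 + ε := by linarith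
  have hy' : ∀ j, 1 - ε < y j ∧ y j < 1 + ε := fun j => by
    have := abs_lt.mp (hy j); constructor <;> linarith
  have hscale : ∀ x ∈ PH u y, (1 + ε)⁻¹ • x ∈ PH u fun _ => 1 := by
    intro x hx j
    rw [inner_smul_right, inv_mul_le_iff₀ h1e]
    linarith [hx j, (hy' j).2]
  refine ⟨hscale, fun x hx I hI => ?_⟩
  rcases hmin I with h | h
  · exact h
  exfalso
  have h2 := h _ (hscale x hx)
  have h3 : ∑ i ∈ I, (1 - inner ℝ (u i) ((1 + ε)⁻¹ • x)) ≤ ∑ i ∈ I, (2 * ε) := by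
    refine sum_le_sum fun i hi => ?_
    rw [inner_smul_right, hI i hi]
    have : 1 - 2 * ε ≤ (1 + ε)⁻¹ * y i := by
      rw [le_inv_mul_iff₀ h1e]
      nlinarith [(hy' i).1]
    linarith
  rw [sum_const, nsmul_eq_mul] at h3
  linarith [hε I]

lemma PH_move {u : V → EE n} {y : V → ℝ} {x d : EE n} (hx : x ∈ PH u y)
    (hd : ∀ j, inner ℝ (u j) x = y j → inner ℝ (u j) d ≤ 0) : ∃ s : ℝ, 0 < s ∧ x + s • d ∈ PH u y := by
  have hev : ∀ᶠ s : ℝ in nhdsWithin 0 (Set.Ioi 0), ∀ j, inner ℝ (u j) (x + s • d) ≤ y j := by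
    rw [Filter.eventually_all]
    intro j
    rcases (hx j).eq_or_lt with h0 | h0
    · filter_upwards [self_mem_nhdsWithin] with s hs
      have hs' : 0 < s := hs
      rw [inner_add_right, inner_smul_right, h0]
      nlinarith [hd j h0]
    · have hcc : Continuous fun s : ℝ => inner ℝ (u j) (x + s • d) := by fun_prop
      have := hcc.tendsto 0
      simp only [zero_smul, add_zero] at this
      filter_upwards [(this.mono_left nhdsWithin_le_nhds).eventually_lt_const h0] with s hs
      exact hs.le
  obtain ⟨s, hs, hs0⟩ := (hev.and self_mem_nhdsWithin).exists
  exact ⟨s, hs0, hs⟩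

lemma vtx_exists (u : V → EE n) (I : Finset V) : ∃ L : (V → ℝ) →ₗ[ℝ] EE n, LinearIndependent ℝ (fun i : I => u i) → I.card = n →
    (∀ i ∈ I, ∀ h, inner ℝ (u i) (L h) = h i) ∧ ∀ w, ∃ c : V → ℝ, w = ∑ i ∈ I, c i • u i := by
  by_cases hI : LinearIndependent ℝ (fun i : I => u i) ∧ I.card = n
  swap
  · exact ⟨0, fun h1 h2 => absurd ⟨h1, h2⟩ hI⟩
  obtain ⟨hI, hcard⟩ := hI
  have hspan : ∀ w, ∃ c : V → ℝ, w = ∑ i ∈ I, c i • u i := by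
    intro w
    have hs := hI.span_eq_top_of_card_eq_finrank' (by simp [hcard])
    have hw : w ∈ Submodule.span ℝ (Set.range fun i : I => u i) := by rw [hs]; trivial
    obtain ⟨c, hc⟩ := (Submodule.mem_span_range_iff_exists_fun ℝ).mp hw
    refine ⟨fun j => if h : j ∈ I then c ⟨j, h⟩ else 0, ?_⟩
    rw [← hc, ← sum_coe_sort I]
    exact sum_congr rfl fun i _ => by simp
  let T : EE n →ₗ[ℝ] (I → ℝ) := LinearMap.pi fun i => innerₛₗ ℝ (u i)
  have hT : ∀ x i, T x i = inner ℝ (u i) x := fun x i => by simp [T]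
  have hinj : Function.Injective T := by
    rw [← LinearMap.ker_eq_bot, LinearMap.ker_eq_bot']
    intro x hx
    obtain ⟨c, hc⟩ := hspan x
    have : inner ℝ x x = 0 := by
      nth_rewrite 1 [hc]
      rw [sum_inner]
      refine sum_eq_zero fun i hi => ?_
      rw [real_inner_smul_left, ← hT x ⟨i, hi⟩, hx]; simp
    exact inner_self_eq_zero.mp this
  let e := LinearEquiv.ofInjectiveOfFinrankEq T hinj (by simp [hcard])
  let r : (V → ℝ) →ₗ[ℝ] (I → ℝ) := LinearMap.pi fun i : I => (LinearMap.proj (i : V) : (V → ℝ) →ₗ[ℝ] ℝ)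
  refine ⟨e.symm.toLinearMap ∘ₗ r, fun _ _ => ⟨fun i hi h => ?_, hspan⟩⟩
  rw [← hT _ ⟨i, hi⟩]
  have : T (e.symm (r h)) = r h :=
    e.apply_symm_apply _
  rw [LinearMap.comp_apply, LinearEquiv.coe_coe, this]
  rfl

theorem fan_of_polytope (u : V → EE n) (hP : IsCompact (PH u fun _ => 1)) :
    ∃ (f : Fan V (EE n) n) (y : V → ℝ), f.u = u ∧ (∀ j, 0 < y j) ∧ f.T0 y ∧
      ∀ I ∈ f.facets, ∃ p ∈ PH u (fun _ => 1), ∀ i ∈ I, inner ℝ (u i) p = 1 := by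
  classical
  obtain ⟨ε, hε, hε1, hclose⟩ := close_active u hP
  obtain ⟨y, hy, hgen⟩ := generic u hε
  obtain ⟨hscale, hact⟩ := hclose y hy
  have hypos : ∀ j, 0 < y j := fun j => by have := abs_lt.mp (hy j); linarith
  have hQ : IsCompact (PH u y) := by
    refine IsCompact.of_isClosed_subset (hP.smul (1 + ε)) (PH_closed u y) fun x hx => ?_
    exact ⟨_, hscale x hx, by simp only; rw [smul_smul, mul_inv_cancel₀ (by linarith), one_smul]⟩
  choose L hL using vtx_exists u
  have hcard_le : ∀ I : Finset V, LinearIndependent ℝ (fun i : I => u i) → I.card ≤ n := fun I hI => by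
    have := hI.fintype_card_le_finrank
    simpa using this
  let Fc : Finset (Finset V) := univ.filter fun I => I.card = n ∧ ∃ x ∈ PH u y, ∀ i ∈ I, inner ℝ (u i) x = y i
  have hFc : ∀ I, I ∈ Fc ↔ I.card = n ∧ ∃ x ∈ PH u y, ∀ i ∈ I, inner ℝ (u i) x = y i := fun I => by simp [Fc]
  have hLF : ∀ I ∈ Fc, (∀ i ∈ I, ∀ h, inner ℝ (u i) (L I h) = h i) ∧ ∀ w, ∃ c : V → ℝ, w = ∑ i ∈ I, c i • u i := by
    intro I hI
    obtain ⟨hc, x, hx, hxI⟩ := (hFc I).mp hI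
    exact hL I (hgen I x hxI) hc
  have huniq : ∀ I ∈ Fc, ∀ x x', (∀ i ∈ I, inner ℝ (u i) x = inner ℝ (u i) x') → x = x' := by
    intro I hI x x' hxx
    obtain ⟨c, hc⟩ := (hLF I hI).2 (x - x')
    have : inner ℝ (x - x') (x - x') = 0 := by
      nth_rewrite 1 [hc]
      rw [sum_inner]
      refine sum_eq_zero fun i hi => ?_
      rw [real_inner_smul_left, inner_sub_right, hxx i hi]; simp
    exact sub_eq_zero.mp (inner_self_eq_zero.mp this)
  have hmax : ∀ I ∈ Fc, ∀ x ∈ PH u y, (∀ i ∈ I, inner ℝ (u i) x = y i) → ∀ j, inner ℝ (u j) x = y j → j ∈ I := by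
    intro I hI x hx hxI j hj
    by_contra hjI
    have h1 := hcard_le (insert j I) (hgen _ x (by
      intro i hi
      rcases mem_insert.mp hi with rfl | hi
      · exact hj
      · exact hxI i hi))
    rw [card_insert_of_notMem hjI, ((hFc I).mp hI).1] at h1
    omega
  have hadj : ∀ I ∈ Fc, ∀ i ∈ I, ∃ i', i' ∉ I ∧ insert i' (I.erase i) ∈ Fc := by
    intro I hI i hi
    obtain ⟨hc, x, hx, hxI⟩ := (hFc I).mp hI
    set d := L I (-Pi.single i 1) with hd
    have hdi : inner ℝ (u i) d = -1 := by rw [hd, (hLF I hI).1 i hi]; simp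
    have hdk : ∀ k ∈ I, k ≠ i → inner ℝ (u k) d = 0 := fun k hk hki => by rw [hd, (hLF I hI).1 k hk]; simp [hki]
    let R : Set (EE n) := PH u y ∩ ⋂ k ∈ I.erase i, {z | inner ℝ (u k) z = y k}
    have hR : IsCompact R := hQ.inter_right (isClosed_biInter fun k _ => isClosed_eq (by fun_prop) (by fun_prop))
    have hmemR : ∀ z, z ∈ R ↔ z ∈ PH u y ∧ ∀ k ∈ I, k ≠ i → inner ℝ (u k) z = y k := fun z => by
      simp only [R, Set.mem_inter_iff, Set.mem_iInter, mem_erase, Set.mem_ofPred_eq]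
      exact ⟨fun h => ⟨h.1, fun k hk hki => h.2 k ⟨hki, hk⟩⟩, fun h => ⟨h.1, fun k hk => h.2 k hk.2 hk.1⟩⟩
    have hxR : x ∈ R := (hmemR x).mpr ⟨hx, fun k hk _ => hxI k hk⟩
    have hgc : Continuous fun z => inner ℝ (u i) z := by fun_prop
    obtain ⟨z, hz, hzmin⟩ := hR.exists_isMinOn ⟨x, hxR⟩ hgc.continuousOn
    have hmoveR : ∀ z ∈ R, ∀ s : ℝ, z + s • d ∈ PH u y → z + s • d ∈ R := by
      intro z hz s hs
      refine (hmemR _).mpr ⟨hs, fun k hk hki => ?_⟩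
      rw [inner_add_right, inner_smul_right, hdk k hk hki, ((hmemR z).mp hz).2 k hk hki]; simp
    have hzlt : inner ℝ (u i) z < y i := by
      obtain ⟨s, hs, hsx⟩ := PH_move (d := d) hx (by
        intro j hj
        have hjI := hmax I hI x hx hxI j hj
        by_cases hji : j = i
        · subst hji; rw [hdi]; norm_num
        · rw [hdk j hjI hji])
      have h1 := hzmin (hmoveR x hxR s hsx)
      simp only [Set.mem_ofPred_eq] at h1
      rw [inner_add_right, inner_smul_right, hdi, hxI i hi] at h1
      linarith
    have hex : ∃ i', inner ℝ (u i') z = y i' ∧ 0 < inner ℝ (u i') d := by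
      by_contra hcon
      push Not at hcon
      obtain ⟨s, hs, hsz⟩ := PH_move (d := d) ((hmemR z).mp hz).1 hcon
      have h1 := hzmin (hmoveR z hz s hsz)
      simp only [Set.mem_ofPred_eq] at h1
      rw [inner_add_right, inner_smul_right, hdi] at h1
      linarith
    obtain ⟨i', hi'1, hi'2⟩ := hex
    have hi'I : i' ∉ I := by
      intro h
      by_cases hii : i' = i
      · subst hii; linarith
      · linarith [hdk i' h hii]
    refine ⟨i', hi'I, (hFc _).mpr ⟨?_, z, ((hmemR z).mp hz).1, ?_⟩⟩
    · rw [card_insert_of_notMem (fun h => hi'I (mem_of_mem_erase h)), card_erase_of_mem hi]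
      have : 0 < I.card := card_pos.mpr ⟨i, hi⟩
      omega
    · intro k hk
      rcases mem_insert.mp hk with rfl | hk
      · exact hi'1
      · exact ((hmemR z).mp hz).2 k (mem_of_mem_erase hk) (ne_of_mem_erase hk)
  have hne : Fc.Nonempty := by
    obtain ⟨x, hx⟩ := hQ.extremePoints_nonempty ⟨0, fun j => by simpa using (hypos j).le⟩
    set I : Finset V := univ.filter fun j => inner ℝ (u j) x = y j with hIdef
    have hxI : ∀ i ∈ I, inner ℝ (u i) x = y i := fun i hi => by simpa [hIdef] using hi
    refine ⟨I, (hFc I).mpr ⟨?_, x, hx.1, hxI⟩⟩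
    by_contra hcn
    have hli := hgen I x hxI
    have hlt : I.card < n := lt_of_le_of_ne (hcard_le I hli) hcn
    obtain ⟨d, hd0, hd⟩ : ∃ d : EE n, d ≠ 0 ∧ ∀ i ∈ I, inner ℝ (u i) d = 0 := by
      let T : EE n →ₗ[ℝ] (I → ℝ) := LinearMap.pi fun i => innerₛₗ ℝ (u i)
      have hker : LinearMap.ker T ≠ ⊥ := LinearMap.ker_ne_bot_of_finrank_lt (by simpa using hlt)
      obtain ⟨d, hd, hd0⟩ := Submodule.exists_mem_ne_zero_of_ne_bot hker
      refine ⟨d, hd0, fun i hi => ?_⟩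
      have := congrFun (LinearMap.mem_ker.mp hd) ⟨i, hi⟩
      simpa [T] using this
    obtain ⟨s, hs, hs1⟩ := PH_move (d := d) hx.1 fun j hj => (hd j (by simp [hIdef, hj])).le
    obtain ⟨t, ht, ht1⟩ := PH_move (d := -d) hx.1 fun j hj => by rw [inner_neg_right, hd j (by simp [hIdef, hj])]; simp
    have hseg : x ∈ openSegment ℝ (x + s • d) (x + t • -d) := by
      refine ⟨t / (s + t), s / (s + t), by positivity, by positivity, by field_simp; ring, ?_⟩
      have e1 : t / (s + t) + s / (s + t) = 1 := by field_simp; ring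
      have e2 : t / (s + t) * s = s / (s + t) * t := by ring
      have : (t / (s + t)) • (x + s • d) + (s / (s + t)) • (x + t • -d) = (t / (s + t) + s / (s + t)) • x + (t / (s + t) * s - s / (s + t) * t) • d := by module
      rw [this, e1, e2, sub_self, zero_smul, add_zero, one_smul]
    have := hx.2 hs1 ht1 hseg
    have h2 : s • d = 0 := by simpa using this
    exact hd0 ((smul_eq_zero.mp h2).resolve_left hs.ne')
  let f : Fan V (EE n) n :=
    { u := u
      facets := Fc
      card_eq := fun I hI => ((hFc I).mp hI).1
      vtx := L
      vtx_eq := fun I hI i hi h => (hLF I hI).1 i hi h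
      span := fun I hI w => (hLF I hI).2 w
      adj := hadj
      nonempty := hne }
  refine ⟨f, y, rfl, hypos, ?_, ?_⟩
  · intro I hI j hj
    obtain ⟨hc, x, hx, hxI⟩ := (hFc I).mp hI
    have hxe : L I y = x := huniq I hI _ _ fun i hi => by rw [(hLF I hI).1 i hi, hxI i hi]
    change inner ℝ (u j) (L I y) < y j
    rw [hxe]
    exact lt_of_le_of_ne (hx j) fun h => hj (hmax I hI x hx hxI j h)
  · intro I hI
    obtain ⟨hc, x, hx, hxI⟩ := (hFc I).mp hI
    exact hact x hx I hxI

end Fenchel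


namespace Fenchel
open Finset

variable {n : ℕ}

lemma PH_extreme_finite {V : Type} [Fintype V] [DecidableEq V] (u : V → EE n) (y : V → ℝ) :
    ((PH u y).extremePoints ℝ).Finite := by
  classical
  refine Set.Finite.of_injOn (f := fun w => univ.filter fun j => inner ℝ (u j) w = y j) (t := (Set.univ : Set (Finset V)))
    (fun _ _ => Set.mem_univ _) ?_ Set.finite_univ
  intro w hw w' hw' hww
  have hact : ∀ j, inner ℝ (u j) w = y j → inner ℝ (u j) w' = y j := by
    intro j hj
    have h1 : j ∈ univ.filter fun j => inner ℝ (u j) w = y j := by simp [hj]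
    simp only at hww
    rw [hww] at h1
    simpa using h1
  obtain ⟨s, hs, hs1⟩ := PH_move (d := w - w') hw.1 fun j hj => by
    rw [inner_sub_right, hact j hj, hj]; simp
  have hseg : w ∈ openSegment ℝ w' (w + s • (w - w')) := by
    refine ⟨s / (1 + s), 1 / (1 + s), by positivity, by positivity, by field_simp; ring, ?_⟩
    have e1 : s / (1 + s) = 1 - 1 / (1 + s) := by field_simp; ring
    have e2 : 1 / (1 + s) * s = 1 - 1 / (1 + s) := by field_simp; ring
    have : (s / (1 + s)) • w' + (1 / (1 + s)) • (w + s • (w - w'))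
      = (s / (1 + s) - 1 / (1 + s) * s) • w' + (1 / (1 + s) + 1 / (1 + s) * s) • w := by module
    rw [this, e1, e2, sub_self, zero_smul, zero_add]
    simp
  exact (hw.2 hw'.1 hs1 hseg).symm

lemma PH_convex {V : Type} [Fintype V] [DecidableEq V] (u : V → EE n) (y : V → ℝ) : Convex ℝ (PH u y) := by
  intro a ha b hb s t hs ht hst j
  rw [inner_add_right, inner_smul_right, inner_smul_right]
  have := mul_le_mul_of_nonneg_left (ha j) hs
  have := mul_le_mul_of_nonneg_left (hb j) ht
  calc _ ≤ s * y j + t * y j := by linarith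
    _ = y j := by rw [← add_mul, hst, one_mul]

theorem facet_desc (S : Finset (EE n)) (h0 : 0 ∈ interior (convexHull ℝ (S : Set (EE n)))) :
    ∃ (V : Type) (_ : Fintype V) (_ : DecidableEq V) (u : V → EE n), convexHull ℝ (S : Set (EE n)) = PH u fun _ => 1 := by
  classical
  let Q : Set (EE n) := PH (fun v : S => (v : EE n)) fun _ => 1
  have hhull : ∀ w ∈ Q, ∀ x ∈ convexHull ℝ (S : Set (EE n)), inner ℝ w x ≤ 1 := by
    intro w hw x hx
    have : convexHull ℝ (S : Set (EE n)) ⊆ PH (fun _ : Unit => w) fun _ => 1 := by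
      refine convexHull_min (fun v hv _ => ?_) (PH_convex _ _)
      rw [real_inner_comm]
      exact hw ⟨v, hv⟩
    exact this hx ()
  have hQc : IsCompact Q := by
    obtain ⟨ρ, hρ, hball⟩ := Metric.mem_nhds_iff.mp (mem_interior_iff_mem_nhds.mp h0)
    refine Metric.isCompact_of_isClosed_isBounded (PH_closed _ _) ?_
    refine (Metric.isBounded_iff_subset_closedBall 0).mpr ⟨2 / ρ, fun w hw => ?_⟩
    rw [mem_closedBall_zero_iff]
    by_cases hw0 : w = 0
    · subst hw0; simp; positivity
    have hn : 0 < ‖w‖ := norm_pos_iff.mpr hw0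
    have h1 := hhull w hw ((ρ / 2 / ‖w‖) • w) (hball (by
      rw [mem_ball_zero_iff, norm_smul, Real.norm_of_nonneg (by positivity)]
      field_simp
      linarith))
    rw [inner_smul_right, real_inner_self_eq_norm_sq] at h1
    have h2 : ρ / 2 / ‖w‖ * ‖w‖ ^ 2 = ρ / 2 * ‖w‖ := by field_simp
    rw [h2] at h1
    rw [le_div_iff₀ hρ]
    linarith
  have hfin : (Q.extremePoints ℝ).Finite := PH_extreme_finite _ _
  have hKM : convexHull ℝ (Q.extremePoints ℝ) = Q := by
    have h1 := closure_convexHull_extremePoints hQc (PH_convex _ _)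
    rwa [(hfin.isClosed_convexHull ℝ).closure_eq] at h1
  refine ⟨hfin.toFinset, inferInstance, inferInstance, fun v => v, ?_⟩
  apply Set.Subset.antisymm
  · intro x hx j
    exact hhull _ (extremePoints_subset (hfin.mem_toFinset.mp j.2)) x hx
  · intro x hx
    by_contra hxS
    obtain ⟨g, s, hg1, hg2⟩ := geometric_hahn_banach_closed_point (convex_convexHull ℝ _) (S.finite_toSet.isClosed_convexHull ℝ) hxS
    have hs : 0 < s := by simpa using hg1 0 (interior_subset h0)
    let w := (InnerProductSpace.toDual ℝ (EE n)).symm g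
    have hw : ∀ z, inner ℝ w z = g z := fun z => InnerProductSpace.toDual_symm_apply
    have hwQ : s⁻¹ • w ∈ Q := by
      intro v
      rw [real_inner_comm, real_inner_smul_left, hw, inv_mul_le_iff₀ hs, mul_one]
      exact (hg1 _ (subset_convexHull ℝ _ v.2)).le
    have hsub : Q ⊆ PH (fun _ : Unit => x) fun _ => 1 := by
      rw [← hKM]
      refine convexHull_min (fun v hv _ => ?_) (PH_convex _ _)
      rw [real_inner_comm]
      exact hx ⟨v, hfin.mem_toFinset.mpr hv⟩
    have h1 := hsub hwQ ()
    rw [real_inner_comm, real_inner_smul_left, hw, inv_mul_le_iff₀ hs, mul_one] at h1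
    linarith

/-- Polytope approximation from outside. -/
theorem approx {K : Set (EE n)} (hK : IsConvexBody K) {δ : ℝ} (hδ : 0 < δ) :
    ∃ S : Finset (EE n), K ⊆ convexHull ℝ (S : Set (EE n)) ∧ convexHull ℝ (S : Set (EE n)) ⊆ Metric.cthickening δ K := by
  classical
  obtain ⟨F, hF0, hFδ⟩ : ∃ F : Finset (EE n), (0 : EE n) ∈ interior (convexHull ℝ (F : Set (EE n))) ∧
      convexHull ℝ (F : Set (EE n)) ⊆ Metric.closedBall 0 δ := by
    obtain ⟨b, hb1, hb2⟩ := exists_mem_interior_convexHull_affineBasis (Metric.closedBall_mem_nhds (0 : EE n) hδ)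
    exact ⟨univ.image b, by simpa using hb1, by simpa using hb2⟩
  obtain ⟨ρ, hρ, hball⟩ := Metric.mem_nhds_iff.mp (mem_interior_iff_mem_nhds.mp hF0)
  obtain ⟨N, hNK, hNf, hN⟩ := hK.2.1.finite_cover_balls hρ
  refine ⟨hNf.toFinset + F, ?_, ?_⟩
  · intro x hx
    obtain ⟨c, hc, hxc⟩ := Set.mem_iUnion₂.mp (hN hx)
    rw [Finset.coe_add, convexHull_add]
    refine Set.mem_add.mpr ⟨c, subset_convexHull ℝ _ (by simpa using hc), x - c, hball ?_, by abel⟩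
    rw [mem_ball_zero_iff, ← dist_eq_norm]
    exact hxc
  · rw [Finset.coe_add, convexHull_add]
    rintro _ ⟨a, ha, b, hb, rfl⟩
    have ha' : a ∈ K := convexHull_min (by simpa using hNK) hK.1 ha
    refine Metric.mem_cthickening_of_dist_le _ a _ _ ha' ?_
    have := hFδ hb
    rw [mem_closedBall_zero_iff] at this
    simpa [dist_eq_norm] using this

end Fenchel


namespace Fenchel
open Finset

theorem exists_fan {n : ℕ} (hn : 0 < n) {ι : Type} [Fintype ι] [Nonempty ι] (K : ι → Set (EE n)) (hK : ∀ i, IsConvexBody (K i))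
    {δ : ℝ} (hδ : 0 < δ) : ∃ (V : Type) (_ : Fintype V) (_ : DecidableEq V) (f : Fan V (EE n) n) (h : ι → V → ℝ),
      ∀ i, f.T0 (h i) ∧ K i ⊆ f.P (h i) ∧ f.P (h i) ⊆ Metric.cthickening δ (K i) := by
  classical
  have hδ2 : 0 < δ / 2 := by positivity
  choose S hS1 hS2 using fun i => approx (hK i) hδ2
  let Q : ι → Set (EE n) := fun i => convexHull ℝ (S i : Set (EE n))
  have hQint : ∀ i, (interior (Q i)).Nonempty := fun i => (hK i).2.2.mono (interior_mono (hS1 i))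
  have hQne : ∀ i, (Q i).Nonempty := fun i => (hQint i).mono interior_subset
  have hQc : ∀ i, IsCompact (Q i) := fun i => (S i).finite_toSet.isCompact_convexHull ℝ
  obtain ⟨p0, hp0⟩ : (interior (∑ i, Q i)).Nonempty := by
    obtain ⟨i0⟩ := ‹Nonempty ι›
    choose a ha using hQne
    obtain ⟨x0, hx0⟩ := hQint i0
    rw [← add_sum_erase univ Q (mem_univ i0)]
    refine ⟨x0 + ∑ i ∈ univ.erase i0, a i, subset_interior_add_left (Set.add_mem_add hx0 ?_)⟩
    exact (Set.mem_finsetSum _ _ _).mpr ⟨a, fun {i} _ => ha i, rfl⟩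
  let W : Finset (EE n) := (∑ i, S i) + {-p0}
  have hW : convexHull ℝ (W : Set (EE n)) = (∑ i, Q i) + {-p0} := by
    simp only [W, Finset.coe_add, Finset.coe_sum, Finset.coe_singleton, convexHull_add, convexHull_singleton, convexHull_sum, Q]
  have h0 : (0 : EE n) ∈ interior (convexHull ℝ (W : Set (EE n))) := by
    rw [hW]
    exact subset_interior_add_left (Set.mem_add.mpr ⟨p0, hp0, -p0, by simp, by simp⟩)
  obtain ⟨V, i1, i2, u, hu⟩ := facet_desc W h0
  have hc : IsCompact (PH u fun _ => 1) := by
    rw [← hu]; exact W.finite_toSet.isCompact_convexHull ℝ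
  obtain ⟨f, y, hfu, hypos, hyT, hfac⟩ := fan_of_polytope u hc
  have hmax : ∀ i j, ∃ p ∈ Q i, ∀ q ∈ Q i, inner ℝ (u j) q ≤ inner ℝ (u j) p := by
    intro i j
    have hgc : Continuous fun z => inner ℝ (u j) z := by fun_prop
    obtain ⟨p, hp, hpm⟩ := (hQc i).exists_isMaxOn (hQne i) hgc.continuousOn
    exact ⟨p, hp, fun q hq => hpm hq⟩
  choose m hm1 hm2 using hmax
  let hs : ι → V → ℝ := fun i j => inner ℝ (u j) (m i j)
  have hvtx : ∀ I ∈ f.facets, ∀ i, f.vtx I (hs i) ∈ Q i := by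
    intro I hI
    obtain ⟨p, hp, hpI⟩ := hfac I hI
    rw [← hu, hW] at hp
    obtain ⟨q, hq, r, hr, hqr⟩ := Set.mem_add.mp hp
    obtain ⟨g, hg, hgq⟩ := (Set.mem_finsetSum univ Q q).mp hq
    have hrr : r = -p0 := hr
    have key : ∀ i, ∀ k ∈ I, inner ℝ (u k) (g i) = hs i k := by
      intro i k hk
      refine le_antisymm (hm2 i k _ (hg (mem_univ i))) ?_
      have hmem : (m i k + ∑ l ∈ univ.erase i, g l) + -p0 ∈ PH u fun _ => 1 := by
        rw [← hu, hW]
        refine Set.add_mem_add ?_ rfl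
        rw [← add_sum_erase univ Q (mem_univ i)]
        exact Set.add_mem_add (hm1 i k) ((Set.mem_finsetSum _ _ _).mpr ⟨g, fun {l} _ => hg (mem_univ l), rfl⟩)
      have h1 := hmem k
      have h2 := hpI k hk
      rw [← hqr, ← hgq, hrr, ← add_sum_erase univ g (mem_univ i)] at h2
      simp only [inner_add_right] at h1 h2
      change inner ℝ (u k) (m i k) ≤ _
      linarith
    intro i
    rw [← f.vtx_unique hI (x := g i) fun k hk => by rw [hfu]; exact key i k hk]
    exact hg (mem_univ i)
  have hT : ∀ i, f.T (hs i) := by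
    intro i I hI j
    rw [hfu]
    exact hm2 i j _ (hvtx I hI i)
  obtain ⟨M, hM0, hM⟩ : ∃ M > 0, ∀ I ∈ f.facets, ‖f.vtx I y‖ ≤ M := by
    refine ⟨1 + ∑ I ∈ f.facets, ‖f.vtx I y‖, by positivity, fun I hI => ?_⟩
    have := single_le_sum (f := fun I => ‖f.vtx I y‖) (fun _ _ => norm_nonneg _) hI
    linarith
  let ε := δ / 2 / M
  have hε : 0 < ε := by positivity
  refine ⟨V, i1, i2, f, fun i => hs i + ε • y, fun i => ⟨(hT i).add_T0 (hyT.smul hε), ?_, ?_⟩⟩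
  · intro x hx j
    have h1 := hm2 i j x (hS1 i hx)
    rw [hfu]
    change _ ≤ inner ℝ (u j) (m i j) + ε * y j
    have := mul_pos hε (hypos j)
    linarith
  · have hsub : f.P (hs i + ε • y) ⊆ Metric.cthickening (δ / 2) (Q i) := by
      refine f.hull hyT ((convex_convexHull ℝ _).cthickening _) Metric.isClosed_cthickening fun I hI => ?_
      refine Metric.mem_cthickening_of_dist_le _ _ _ _ (hvtx I hI i) ?_
      rw [map_add, map_smul, dist_eq_norm, add_sub_cancel_left, norm_smul, Real.norm_of_nonneg hε.le]
      calc ε * ‖f.vtx I y‖ ≤ ε * M := by gcongr; exact hM I hI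
        _ = δ / 2 := by simp only [ε]; field_simp
    refine hsub.trans ((Metric.cthickening_subset_of_subset _ (hS2 i)).trans ?_)
    refine (Metric.cthickening_cthickening_subset hδ2.le hδ2.le (K i)).trans ?_
    rw [add_halves]

end Fenchel


namespace Fenchel
open Finset

lemma cthickening_eq {n : ℕ} {A : Set (EE n)} (h : IsCompact A) {δ : ℝ} (hδ : 0 ≤ δ) :
    Metric.cthickening δ A = A + Metric.closedBall 0 δ := (h.add_closedBall_zero hδ).symm

lemma sum_closedBall {n : ℕ} {ι : Type*} [DecidableEq ι] (S : Finset ι) {δ : ℝ} :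
    (∑ i ∈ S, Metric.closedBall (0 : EE n) δ) ⊆ Metric.closedBall 0 (S.card * δ) := by
  induction S using Finset.induction_on with
  | empty => simp
  | insert a S ha ih =>
    rw [sum_insert ha, card_insert_of_notMem ha]
    refine (Set.add_subset_add_left ih).trans ?_
    rintro _ ⟨x, hx, y, hy, rfl⟩
    rw [mem_closedBall_zero_iff] at *
    push_cast
    refine (norm_add_le _ _).trans ?_
    linarith

lemma sum_mono {n : ℕ} {ι : Type*} [DecidableEq ι] (S : Finset ι) {A B : ι → Set (EE n)} (h : ∀ i, A i ⊆ B i) :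
    ∑ i ∈ S, A i ⊆ ∑ i ∈ S, B i := by
  induction S using Finset.induction_on with
  | empty => simp
  | insert a S ha ih => rw [sum_insert ha, sum_insert ha]; exact Set.add_subset_add (h a) ih

lemma sum_compact {n : ℕ} {ι : Type*} [DecidableEq ι] (S : Finset ι) {A : ι → Set (EE n)} (h : ∀ i, IsCompact (A i)) :
    IsCompact (∑ i ∈ S, A i) := by
  induction S using Finset.induction_on with
  | empty => rw [sum_empty, ← Set.singleton_zero]; exact isCompact_singleton
  | insert a S ha ih => rw [sum_insert ha]; exact (h a).add ih

lemma sum_cthick {n : ℕ} {ι : Type*} [DecidableEq ι] (S : Finset ι) {A : ι → Set (EE n)} (h : ∀ i, IsCompact (A i)) {δ : ℝ} (hδ : 0 ≤ δ) :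
    ∑ i ∈ S, Metric.cthickening δ (A i) ⊆ Metric.cthickening (S.card * δ) (∑ i ∈ S, A i) := by
  rw [sum_congr rfl fun i _ => cthickening_eq (h i) hδ, sum_add_distrib,
    cthickening_eq (sum_compact S h) (by positivity)]
  exact Set.add_subset_add_left (sum_closedBall S)

lemma tendsto_mixedVolume {n : ℕ} {K : Fin n → Set (EE n)} (hK : ∀ i, IsCompact (K i)) {Q : ℕ → Fin n → Set (EE n)} {δ : ℕ → ℝ}
    (hδ : ∀ N, 0 ≤ δ N) (hδ0 : Filter.Tendsto δ Filter.atTop (nhds 0)) (h1 : ∀ N i, K i ⊆ Q N i)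
    (h2 : ∀ N i, Q N i ⊆ Metric.cthickening (δ N) (K i)) :
    Filter.Tendsto (fun N => mixedVolume (Q N)) Filter.atTop (nhds (mixedVolume K)) := by
  unfold mixedVolume
  refine Filter.Tendsto.const_mul _ (tendsto_finset_sum _ fun S _ => Filter.Tendsto.const_mul _ ?_)
  have hc := sum_compact S hK
  refine (ENNReal.tendsto_toReal hc.measure_lt_top.ne).comp ?_
  have h3 : Filter.Tendsto (fun N => volume (Metric.cthickening (S.card * δ N) (∑ i ∈ S, K i))) Filter.atTop
      (nhds (volume (∑ i ∈ S, K i))) := by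
    refine (tendsto_measure_cthickening_of_isCompact hc).comp ?_
    simpa using hδ0.const_mul (S.card : ℝ)
  refine tendsto_of_tendsto_of_tendsto_of_le_of_le tendsto_const_nhds h3 (fun N => measure_mono (sum_mono S (h1 N))) fun N => ?_
  exact measure_mono ((sum_mono S (h2 N)).trans (sum_cthick S hK (hδ N)))

lemma fam_forall₂ {n : ℕ} {α β : Type*} {p : α → β → Prop} {x y : α} {K : Fin (n - 2) → α} {x' y' : β} {K' : Fin (n - 2) → β}
    (hx : p x x') (hy : p y y') (hK : ∀ l, p (K l) (K' l)) (j : Fin n) : p (fam x y K j) (fam x' y' K' j) := by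
  simp only [fam]
  split_ifs
  · exact hx
  · exact hy
  · exact hK _

theorem fenchel_fam (n : ℕ) (hn : 2 ≤ n) (A B C : Set (EE n)) (K : Fin (n - 2) → Set (EE n))
    (hA : IsConvexBody A) (hB : IsConvexBody B) (hC : IsConvexBody C) (hK : ∀ l, IsConvexBody (K l)) :
    mixedVolume (fam A A K) * mixedVolume (fam B C K) ≤ 2 * mixedVolume (fam A B K) * mixedVolume (fam A C K) := by
  let F : Option (Option (Option (Fin (n - 2)))) → Set (EE n) := fun i =>
    i.elim A fun i => i.elim B fun i => i.elim C K
  have hF : ∀ i, IsConvexBody (F i) := by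
    rintro (_ | _ | _ | l)
    · exact hA
    · exact hB
    · exact hC
    · exact hK l
  have hδ : ∀ N : ℕ, (0 : ℝ) < 1 / ((N : ℝ) + 1) := fun N => Nat.one_div_pos_of_nat
  choose V i1 i2 f h hh using fun N : ℕ => exists_fan (by omega : 0 < n) F hF (hδ N)
  have hcpt : ∀ i, IsCompact (F i) := fun i => (hF i).2.1
  have lim : ∀ i j, Filter.Tendsto (fun N => mixedVolume (fam ((f N).P (h N i)) ((f N).P (h N j)) fun l => (f N).P (h N (some (some (some l))))))
      Filter.atTop (nhds (mixedVolume (fam (F i) (F j) K))) := by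
    intro i j
    refine tendsto_mixedVolume (fam_forall (hcpt i) (hcpt j) fun l => (hK l).2.1) (fun N => (hδ N).le) tendsto_one_div_add_atTop_nhds_zero_nat ?_ ?_
    · intro N
      exact fam_forall₂ (p := fun s t : Set (EE n) => s ⊆ t) (hh N i).2.1 (hh N j).2.1 fun l => (hh N (some (some (some l)))).2.1
    · intro N
      exact fam_forall₂ (p := fun s t : Set (EE n) => s ⊆ Metric.cthickening (1 / ((N : ℝ) + 1)) t) (hh N i).2.2 (hh N j).2.2 fun l => (hh N (some (some (some l)))).2.2
  have e1 := (lim none none).mul (lim (some none) (some (some none)))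
  have e2 := ((lim none (some none)).const_mul 2).mul (lim none (some (some none)))
  refine le_of_tendsto_of_tendsto' e1 e2 fun N => ?_
  exact (f N).fenchel_P hn (hh N _).1 (hh N _).1 (hh N _).1 fun l => (hh N _).1

end Fenchel

theorem fenchel_inequality (n : ℕ) (hn : 2 ≤ n)
    (A B C : Set (EuclideanSpace ℝ (Fin n)))
    (K : Fin (n - 2) → Set (EuclideanSpace ℝ (Fin n)))
    (hA : IsConvexBody A) (hB : IsConvexBody B) (hC : IsConvexBody C)
    (hK : ∀ l, IsConvexBody (K l)) :
    mixedVolume (fun j : Fin n =>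
        if h : (j : ℕ) < 2 then A else K ⟨(j : ℕ) - 2, by have := j.isLt; omega⟩) *
      mixedVolume (fun j : Fin n =>
        if h : (j : ℕ) < 2 then (if (j : ℕ) = 0 then B else C)
        else K ⟨(j : ℕ) - 2, by have := j.isLt; omega⟩) ≤
    2 * mixedVolume (fun j : Fin n =>
        if h : (j : ℕ) < 2 then (if (j : ℕ) = 0 then A else B)
        else K ⟨(j : ℕ) - 2, by have := j.isLt; omega⟩) *
      mixedVolume (fun j : Fin n =>
        if h : (j : ℕ) < 2 then (if (j : ℕ) = 0 then A else C)
        else K ⟨(j : ℕ) - 2, by have := j.isLt; omega⟩) := by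
  have h := Fenchel.fenchel_fam n hn A B C K hA hB hC hK
  have e : (fun j : Fin n => if h : (j : ℕ) < 2 then A else K ⟨(j : ℕ) - 2, by have := j.isLt; omega⟩) = Fenchel.fam A A K := by
    funext j
    simp only [Fenchel.fam, ite_self]
  rw [e]
  exact h
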